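/- arXiv:2403.20265 — 4 statements merged into one kernel-verified Lean document; each statement's English description precedes it below -/
import Mathlib

section
/- Let 1 < p < 2, b > 1 and x ≥ 1, and set A(x) := diag(bx, −x^{p−1}) ∈ ℝ^{2×2}. Then there exists a laminate of finite order ω on ℝ^{2×2} with barycenter A(x) which can be written as ω = (1−γ)μ + γδ_{A(x+1)}, where γ = (1 − b/((b+1)(1+x)))·(1 − ((1+x^{−1})^{p−1} − 1)/(b^{p−1} + (1+x^{−1})^{p−1})), and μ is a probability measure with supp μ ⊂ 𝒟 ∩ K_p and supp μ ⊂ {X : |A(x)|/(√2·b) ≤ |X| ≤ 2√2·|A(x)|}. -/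
open MeasureTheory Set Filter Topology

noncomputable section

namespace Paper

variable {ι κ : Type*}

/-- Frobenius (Hilbert–Schmidt) norm of a matrix. -/
def frobNorm [Fintype ι] [Fintype κ] (A : Matrix κ ι ℝ) : ℝ :=
  Real.sqrt (∑ k, ∑ i, (A k i) ^ 2)

/-- Frobenius distance from a matrix to a set of matrices. -/
def frobDist [Fintype ι] [Fintype κ] (X : Matrix κ ι ℝ) (S : Set (Matrix κ ι ℝ)) : ℝ :=
  sInf ((fun Y => frobNorm (X - Y)) '' S)

/-- The affine map `x ↦ A x + b`. -/
def lmap [Fintype ι] (A : Matrix κ ι ℝ) (b : κ → ℝ) (x : ι → ℝ) : κ → ℝ :=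
  fun k => (∑ i, A k i * x i) + b k

/-- A regular domain: open, bounded, connected, with Lebesgue-null boundary. -/
def IsRegularDomain [Fintype ι] (Ω : Set (ι → ℝ)) : Prop :=
  IsOpen Ω ∧ Bornology.IsBounded Ω ∧ IsConnected Ω ∧ volume (frontier Ω) = 0

/-- `u` agrees with an affine map on `S`. -/
def IsAffineOn [Fintype ι] (u : (ι → ℝ) → κ → ℝ) (S : Set (ι → ℝ)) : Prop :=
  ∃ (B : Matrix κ ι ℝ) (c : κ → ℝ), ∀ x ∈ S, u x = lmap B c x

/-- `u` is piecewise affine on `Ω`. -/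
def IsPiecewiseAffineOn [Fintype ι] (u : (ι → ℝ) → κ → ℝ) (Ω : Set (ι → ℝ)) : Prop :=
  ∃ 𝒮 : Set (Set (ι → ℝ)), 𝒮.Countable ∧
    (∀ V ∈ 𝒮, IsRegularDomain V ∧ V ⊆ Ω ∧ IsAffineOn u V) ∧
    𝒮.PairwiseDisjoint id ∧ volume (Ω \ ⋃₀ 𝒮) = 0

/-- `G` is the weak (distributional) gradient of `u` on `Ω`, and `u ∈ W^{1,1}(Ω)`. -/
structure HasWeakGradientOn [Fintype ι] [DecidableEq ι] [Fintype κ]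
    (u : (ι → ℝ) → κ → ℝ) (G : (ι → ℝ) → Matrix κ ι ℝ) (Ω : Set (ι → ℝ)) : Prop where
  integrable : IntegrableOn u Ω volume
  integrable_grad : ∀ (k : κ) (i : ι), IntegrableOn (fun x => G x k i) Ω volume
  parts : ∀ φ : (ι → ℝ) → ℝ, (∀ n : ℕ, ContDiff ℝ n φ) → HasCompactSupport φ →
    tsupport φ ⊆ Ω → ∀ (k : κ) (i : ι),
      ∫ x in Ω, u x k * fderiv ℝ φ x (Pi.single i 1) = - ∫ x in Ω, G x k i * φ x

/-- Membership in `C^α(S)`: continuous on `S` and (for `α > 0`) `α`-Hölder on `S`. -/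
def MemHolder [Fintype ι] [Fintype κ] (α : ℝ) (S : Set (ι → ℝ)) (u : (ι → ℝ) → κ → ℝ) : Prop :=
  ContinuousOn u S ∧ ∃ C : ℝ, ∀ x ∈ S, ∀ y ∈ S, dist (u x) (u y) ≤ C * dist x y ^ α

/-- The `C^α` norm on `S`. -/
def holderNorm [Fintype ι] [Fintype κ] (α : ℝ) (S : Set (ι → ℝ)) (u : (ι → ℝ) → κ → ℝ) : ℝ :=
  sSup ((fun x => ‖u x‖) '' S) +
    sSup {r : ℝ | ∃ x ∈ S, ∃ y ∈ S, x ≠ y ∧ r = dist (u x) (u y) / dist x y ^ α}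

/-- `K` can be reduced to `K'` in weak `L^p`, with constant `M`. -/
def ReducesWith [Fintype ι] [DecidableEq ι] [Fintype κ] (M : ℝ)
    (K K' : Set (Matrix κ ι ℝ)) (p : ℝ) : Prop :=
  ∀ A ∈ K, ∀ b : κ → ℝ, ∀ ε ∈ Set.Ioo (0:ℝ) 1, ∀ α ∈ Set.Ioo (0:ℝ) 1, ∀ s ∈ Set.Ioi (1:ℝ),
    ∀ Ω : Set (ι → ℝ), IsRegularDomain Ω →
      ∃ (u : (ι → ℝ) → κ → ℝ) (G : (ι → ℝ) → Matrix κ ι ℝ),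
        IsPiecewiseAffineOn u Ω ∧ HasWeakGradientOn u G Ω ∧ MemHolder α (closure Ω) u ∧
        (∀ x ∈ frontier Ω, u x = lmap A b x) ∧
        (∫ x in {x ∈ Ω | G x ∉ K'}, (1 + frobNorm (G x)) ^ s) < ε * (volume Ω).toReal ∧
        ∀ t : ℝ, 0 < t →
          volume {x ∈ Ω | t < frobNorm (G x)}
            ≤ ENNReal.ofReal (M ^ p * (1 + frobNorm A ^ p) * t ^ (-p)) * volume Ω

/-- `K` can be reduced to `K'` in weak `L^p`. -/
def ReducedTo [Fintype ι] [DecidableEq ι] [Fintype κ]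
    (K K' : Set (Matrix κ ι ℝ)) (p : ℝ) : Prop :=
  ∃ M : ℝ, 1 ≤ M ∧ ReducesWith M K K' p

instance : MeasurableSpace (Matrix κ ι ℝ) :=
  inferInstanceAs (MeasurableSpace (κ → ι → ℝ))

/-- Laminates of finite order: the smallest family of (probability) measures on matrix space
containing Dirac masses and closed under elementary splitting. -/
inductive IsLaminate [Fintype ι] [Fintype κ] : Measure (Matrix κ ι ℝ) → Prop
  | dirac (A : Matrix κ ι ℝ) : IsLaminate (Measure.dirac A)
  | split (lam lam' : ℝ) (A B B' : Matrix κ ι ℝ) (ν' : Measure (Matrix κ ι ℝ))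
      (hlam : lam ∈ Set.Ioc (0:ℝ) 1) (hlam' : lam' ∈ Set.Ioo (0:ℝ) 1)
      (hprob : IsProbabilityMeasure ν') (hrank : (B' - B).rank = 1)
      (hA : A = lam' • B + (1 - lam') • B')
      (hν : IsLaminate (ENNReal.ofReal lam • Measure.dirac A + ENNReal.ofReal (1 - lam) • ν')) :
      IsLaminate (ENNReal.ofReal lam •
          (ENNReal.ofReal lam' • Measure.dirac B + ENNReal.ofReal (1 - lam') • Measure.dirac B')
        + ENNReal.ofReal (1 - lam) • ν')

/-- Barycenter (center of mass) of a measure on matrix space, defined entrywise. -/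
def barycenter [Fintype ι] [Fintype κ] (ν : Measure (Matrix κ ι ℝ)) : Matrix κ ι ℝ :=
  Matrix.of fun k i => ∫ X, X k i ∂ν

/-- Staircase-laminate data for `K` with base `A`. -/
structure StaircaseData [Fintype ι] [Fintype κ]
    (K : Set (Matrix κ ι ℝ)) (A : Matrix κ ι ℝ) : Type _ where
  Aseq : ℕ → Matrix κ ι ℝ
  μseq : ℕ → Measure (Matrix κ ι ℝ)
  γseq : ℕ → ℝ
  base : Aseq 0 = A
  notMem : ∀ n, Aseq n ∉ K
  prob : ∀ n, 1 ≤ n → IsProbabilityMeasure (μseq n)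
  suppK : ∀ n, 1 ≤ n → μseq n Kᶜ = 0
  γmem : ∀ n, 1 ≤ n → γseq n ∈ Set.Ioo (0:ℝ) 1
  mono : Monotone fun n => frobNorm (Aseq n)
  norm_tendsto : Tendsto (fun n => frobNorm (Aseq n)) atTop atTop
  beta_tendsto : Tendsto (fun n => ∏ k ∈ Finset.range n, γseq (k + 1)) atTop (nhds 0)
  laminate : ∀ n, 1 ≤ n →
    IsLaminate (ENNReal.ofReal (1 - γseq n) • μseq n
      + ENNReal.ofReal (γseq n) • Measure.dirac (Aseq n))
  bary : ∀ n, 1 ≤ n →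
    barycenter (ENNReal.ofReal (1 - γseq n) • μseq n
      + ENNReal.ofReal (γseq n) • Measure.dirac (Aseq n)) = Aseq (n - 1)

variable [Fintype ι] [Fintype κ]

/-- `β_n = γ_1 ⋯ γ_n`. -/
def beta {K : Set (Matrix κ ι ℝ)} {A : Matrix κ ι ℝ} (D : StaircaseData K A) (n : ℕ) : ℝ :=
  ∏ k ∈ Finset.range n, D.γseq (k + 1)

/-- The finite-stage laminates `ν^N`. -/
def nuN {K : Set (Matrix κ ι ℝ)} {A : Matrix κ ι ℝ} (D : StaircaseData K A) (N : ℕ) :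
    Measure (Matrix κ ι ℝ) :=
  (∑ n ∈ Finset.range N, ENNReal.ofReal (beta D n * (1 - D.γseq (n + 1))) • D.μseq (n + 1))
    + ENNReal.ofReal (beta D N) • Measure.dirac (D.Aseq N)

/-- The associated staircase laminate `ν^∞`. -/
def nuInf {K : Set (Matrix κ ι ℝ)} {A : Matrix κ ι ℝ} (D : StaircaseData K A) :
    Measure (Matrix κ ι ℝ) :=
  Measure.sum fun n => ENNReal.ofReal (beta D n * (1 - D.γseq (n + 1))) • D.μseq (n + 1)


/-- The special orthogonal group `SO(2)` as a set of `2×2` matrices. -/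
def SO2 : Set (Matrix (Fin 2) (Fin 2) ℝ) := {R | R.transpose * R = 1 ∧ R.det = 1}

/-- The set `E_ρ = {diag(λ, ρλ) R : λ ≥ 0, R ∈ SO(2)}`. -/
def Eset (ρ : ℝ) : Set (Matrix (Fin 2) (Fin 2) ℝ) :=
  {X | ∃ lam : ℝ, 0 ≤ lam ∧ ∃ R ∈ SO2, X = Matrix.diagonal ![lam, ρ * lam] * R}

/-- The set `K_p = {diag(λ, λ^{p−1}) R : λ ≥ 0, R ∈ SO(2)}` of the `p`-Laplace inclusion. -/
def Kpset (p : ℝ) : Set (Matrix (Fin 2) (Fin 2) ℝ) :=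
  {X | ∃ lam : ℝ, 0 ≤ lam ∧ ∃ R ∈ SO2, X = Matrix.diagonal ![lam, lam ^ (p - 1)] * R}

instance : MeasurableSingletonClass (Matrix κ ι ℝ) :=
  inferInstanceAs (MeasurableSingletonClass (κ → ι → ℝ))

/-- The barycenter of a finitely supported measure with three atoms. -/
lemma barycenter_three_diracs (a b c : ℝ) (ha : 0 ≤ a) (hb : 0 ≤ b) (hc : 0 ≤ c)
    (A B C : Matrix κ ι ℝ) :
    barycenter (ENNReal.ofReal a • Measure.dirac A + ENNReal.ofReal b • Measure.dirac B
      + ENNReal.ofReal c • Measure.dirac C) = a • A + b • B + c • C := by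
  have hi : ∀ (r : ℝ) (X : Matrix κ ι ℝ) (k : κ) (i : ι),
      Integrable (fun Y : Matrix κ ι ℝ => Y k i) (ENNReal.ofReal r • Measure.dirac X) :=
    fun r X k i => (integrable_dirac (by simp)).smul_measure ENNReal.ofReal_ne_top
  ext k i
  simp only [barycenter, Matrix.of_apply]
  rw [integral_add_measure ((hi a A k i).add_measure (hi b B k i)) (hi c C k i),
    integral_add_measure (hi a A k i) (hi b B k i)]
  simp [integral_smul_measure, ENNReal.toReal_ofReal, ha, hb, hc]

lemma frobNorm_diagonal (u v : ℝ) :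
    frobNorm (Matrix.diagonal ![u, v]) = Real.sqrt (u ^ 2 + v ^ 2) := by
  simp [frobNorm, Fin.sum_univ_two]

lemma diagonal_mem_Kpset {p l : ℝ} (hl : 0 ≤ l) :
    Matrix.diagonal ![l, l ^ (p - 1)] ∈ Kpset p :=
  ⟨l, hl, 1, ⟨by simp, by simp⟩, by simp⟩

lemma neg_diagonal_mem_Kpset {p l : ℝ} (hl : 0 ≤ l) :
    Matrix.diagonal ![-l, -(l ^ (p - 1))] ∈ Kpset p := by
  refine ⟨l, hl, -1, ⟨by simp, by simp [Matrix.det_fin_two]⟩, ?_⟩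
  ext i j
  fin_cases i <;> fin_cases j <;> simp

lemma rank_diagonal_sub_of_snd_ne {u v w : ℝ} (h : v ≠ w) :
    (Matrix.diagonal ![u, v] - Matrix.diagonal ![u, w]).rank = 1 := by
  rw [Matrix.diagonal_sub, Matrix.rank_diagonal, Fintype.card_eq_one_iff]
  refine ⟨⟨1, by simpa [sub_eq_zero] using h⟩, ?_⟩
  rintro ⟨i, hi⟩
  fin_cases i
  · exact absurd (sub_self u) hi
  · rfl

lemma rank_diagonal_sub_of_fst_ne {u v w : ℝ} (h : v ≠ w) :
    (Matrix.diagonal ![v, u] - Matrix.diagonal ![w, u]).rank = 1 := by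
  rw [Matrix.diagonal_sub, Matrix.rank_diagonal, Fintype.card_eq_one_iff]
  refine ⟨⟨0, by simpa [sub_eq_zero] using h⟩, ?_⟩
  rintro ⟨i, hi⟩
  fin_cases i
  · rfl
  · exact absurd (sub_self u) hi

/-- Splitting a Dirac mass and then one of the two resulting atoms gives a laminate. -/
lemma isLaminate_of_two_splits {s t : ℝ} (hs : s ∈ Ioo (0 : ℝ) 1) (ht : t ∈ Ioo (0 : ℝ) 1)
    {A B B' C C' : Matrix κ ι ℝ} (hB : (B' - B).rank = 1) (hC : (C' - C).rank = 1)
    (hA : A = s • B + (1 - s) • B') (hBC : B = t • C + (1 - t) • C') :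
    IsLaminate (ENNReal.ofReal (s * t) • Measure.dirac C
      + ENNReal.ofReal (s * (1 - t)) • Measure.dirac C'
      + ENNReal.ofReal (1 - s) • Measure.dirac B') := by
  have h1 := IsLaminate.split 1 s A B B' (Measure.dirac A) (by simp) hs inferInstance hB hA
    (by simpa using IsLaminate.dirac A)
  have h2 := IsLaminate.split s t B C C' (Measure.dirac B') ⟨hs.1, hs.2.le⟩ ht inferInstance hC
    hBC (by simpa using h1)
  rwa [smul_add, smul_smul, smul_smul, ← ENNReal.ofReal_mul hs.1.le,
    ← ENNReal.ofReal_mul hs.1.le] at h2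

lemma le_frobNorm_diagonal {u : ℝ} (v : ℝ) : |u| ≤ frobNorm (Matrix.diagonal ![u, v]) := by
  rw [frobNorm_diagonal]
  exact Real.abs_le_sqrt (by nlinarith [sq_nonneg v])

lemma frobNorm_diagonal_le {u v c : ℝ} (hu : |u| ≤ c) (hv : |v| ≤ c) :
    frobNorm (Matrix.diagonal ![u, v]) ≤ Real.sqrt 2 * c := by
  have hc : 0 ≤ c := (abs_nonneg u).trans hu
  rw [frobNorm_diagonal, ← Real.sqrt_sq hc, ← Real.sqrt_mul zero_le_two]
  refine Real.sqrt_le_sqrt ?_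
  linarith [sq_le_sq.2 (hu.trans (le_abs_self c)), sq_le_sq.2 (hv.trans (le_abs_self c))]

/-- A combination of two Dirac masses charges no set missing both atoms. -/
lemma two_diracs_setOf_not_eq_zero {a b : ENNReal} {P : Matrix κ ι ℝ → Prop}
    {A B : Matrix κ ι ℝ} (hA : P A) (hB : P B) :
    (a • Measure.dirac A + b • Measure.dirac B) {X | ¬ P X} = 0 := by
  simp [hA, hB]

/-- Lemma (staircase step for the `p`-Laplacian, Colombo–Tione). -/
theorem laminate_step_pLaplace (p b x : ℝ) (hp1 : 1 < p) (hp2 : p < 2) (hb : 1 < b) (hx : 1 ≤ x)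
    (γ : ℝ) (hγ : γ = (1 - b / ((b + 1) * (1 + x))) *
      (1 - ((1 + x⁻¹) ^ (p - 1) - 1) / (b ^ (p - 1) + (1 + x⁻¹) ^ (p - 1)))) :
    ∃ μ : Measure (Matrix (Fin 2) (Fin 2) ℝ), IsProbabilityMeasure μ ∧
      IsLaminate (ENNReal.ofReal (1 - γ) • μ
        + ENNReal.ofReal γ • Measure.dirac
            (Matrix.diagonal ![b * (x + 1), -((x + 1) ^ (p - 1))])) ∧
      barycenter (ENNReal.ofReal (1 - γ) • μ
        + ENNReal.ofReal γ • Measure.dirac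
            (Matrix.diagonal ![b * (x + 1), -((x + 1) ^ (p - 1))]))
        = Matrix.diagonal ![b * x, -(x ^ (p - 1))] ∧
      μ {X | ¬ ((∃ g, X = Matrix.diagonal g) ∧ X ∈ Kpset p)} = 0 ∧
      μ {X | ¬ (frobNorm (Matrix.diagonal ![b * x, -(x ^ (p - 1))]) / (Real.sqrt 2 * b)
          ≤ frobNorm X ∧
        frobNorm X ≤ 2 * Real.sqrt 2 * frobNorm (Matrix.diagonal ![b * x, -(x ^ (p - 1))]))} = 0 := by
  have hx0 : 0 < x := by linarith
  have hb0 : 0 < b := by linarith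
  have hq : 0 < p - 1 := by linarith
  have hbx : x ≤ b * x := by nlinarith
  have hpow_le : ∀ y : ℝ, 1 ≤ y → y ^ (p - 1) ≤ y := fun y hy => by
    simpa using Real.rpow_le_rpow_of_exponent_le hy (by linarith : p - 1 ≤ 1)
  have hPle : (b * x) ^ (p - 1) ≤ b * x := hpow_le _ (by linarith)
  have hSle : (x + 1) ^ (p - 1) ≤ x + 1 := hpow_le _ (by linarith)
  have hsle : x ^ (p - 1) ≤ x := hpow_le _ hx
  have hbinv : (1 + x⁻¹) ^ (p - 1) = (x + 1) ^ (p - 1) / x ^ (p - 1) := by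
    rw [← Real.div_rpow (by positivity) hx0.le]
    congr 1
    field_simp
  have hbmul : (b * x) ^ (p - 1) = b ^ (p - 1) * x ^ (p - 1) := Real.mul_rpow hb0.le hx0.le
  have hlt : x ^ (p - 1) < (x + 1) ^ (p - 1) := Real.rpow_lt_rpow hx0.le (by linarith) hq
  have hs0 : 0 < x ^ (p - 1) := Real.rpow_pos_of_pos hx0 _
  have hP0 : 0 < (b * x) ^ (p - 1) := Real.rpow_pos_of_pos (by positivity) _
  have hK₁ : Matrix.diagonal ![b * x, (b * x) ^ (p - 1)] ∈ Kpset p :=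
    diagonal_mem_Kpset (by positivity)
  have hK₂ : Matrix.diagonal ![-(x + 1), -((x + 1) ^ (p - 1))] ∈ Kpset p :=
    neg_diagonal_mem_Kpset (by positivity)
  have hb1 : 0 < b ^ (p - 1) := Real.rpow_pos_of_pos hb0 _
  rw [hbinv] at hγ
  generalize b ^ (p - 1) = β at *
  generalize x ^ (p - 1) = s at *
  generalize (x + 1) ^ (p - 1) = S at *
  generalize (b * x) ^ (p - 1) = P at *
  have hS0 : 0 < S := hs0.trans hlt
  obtain ⟨t₁, ht₁⟩ : ∃ t, t = (P + s) / (P + S) := ⟨_, rfl⟩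
  obtain ⟨t₂, ht₂⟩ : ∃ t, t = (b * x + (x + 1)) / (b * (x + 1) + (x + 1)) := ⟨_, rfl⟩
  have ht₁_mem : t₁ ∈ Ioo (0 : ℝ) 1 := by
    rw [ht₁]
    exact ⟨by positivity, (div_lt_one (by positivity)).2 (by linarith)⟩
  have ht₂_mem : t₂ ∈ Ioo (0 : ℝ) 1 := by
    rw [ht₂]
    exact ⟨by positivity, (div_lt_one (by positivity)).2 (by nlinarith)⟩
  have ht₁_eq : t₁ * (P + S) = P + s := by rw [ht₁]; field_simp
  have ht₂_eq : t₂ * (b * (x + 1) + (x + 1)) = b * x + (x + 1) := by rw [ht₂]; field_simp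
  have hγt : γ = t₁ * t₂ := by
    have h₁ : 1 - (S / s - 1) / (β + S / s) = t₁ := by
      rw [ht₁, hbmul]
      field_simp
      ring
    have h₂ : 1 - b / ((b + 1) * (1 + x)) = t₂ := by
      rw [ht₂]
      field_simp
      ring
    rw [hγ, h₁, h₂, mul_comm]
  have hγ0 : 0 < γ := hγt ▸ mul_pos ht₁_mem.1 ht₂_mem.1
  have hγ1 : 0 < 1 - γ := by
    have := mul_lt_mul ht₁_mem.2 ht₂_mem.2.le ht₂_mem.1 zero_le_one
    linarith
  have hw : 0 ≤ t₁ * (1 - t₂) := mul_nonneg ht₁_mem.1.le (by linarith [ht₂_mem.2])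
  have hv : 0 ≤ 1 - t₁ := by linarith [ht₁_mem.2]
  have hsplit₁ : (Matrix.diagonal ![b * x, -s] : Matrix (Fin 2) (Fin 2) ℝ)
      = t₁ • Matrix.diagonal ![b * x, -S] + (1 - t₁) • Matrix.diagonal ![b * x, P] := by
    ext i j
    fin_cases i <;> fin_cases j <;> simp <;> linarith
  have hsplit₂ : (Matrix.diagonal ![b * x, -S] : Matrix (Fin 2) (Fin 2) ℝ)
      = t₂ • Matrix.diagonal ![b * (x + 1), -S] + (1 - t₂) • Matrix.diagonal ![-(x + 1), -S] := by
    ext i j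
    fin_cases i <;> fin_cases j <;> simp <;> linarith
  have hmeas : ENNReal.ofReal (1 - γ) •
        (ENNReal.ofReal (t₁ * (1 - t₂) / (1 - γ)) • Measure.dirac (Matrix.diagonal ![-(x + 1), -S])
          + ENNReal.ofReal ((1 - t₁) / (1 - γ)) • Measure.dirac (Matrix.diagonal ![b * x, P]))
        + ENNReal.ofReal γ • Measure.dirac (Matrix.diagonal ![b * (x + 1), -S])
      = ENNReal.ofReal (t₁ * t₂) • Measure.dirac (Matrix.diagonal ![b * (x + 1), -S])
        + ENNReal.ofReal (t₁ * (1 - t₂)) • Measure.dirac (Matrix.diagonal ![-(x + 1), -S])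
        + ENNReal.ofReal (1 - t₁) • Measure.dirac (Matrix.diagonal ![b * x, P]) := by
    rw [smul_add, smul_smul, smul_smul, ← ENNReal.ofReal_mul hγ1.le, ← ENNReal.ofReal_mul hγ1.le,
      mul_div_cancel₀ _ hγ1.ne', mul_div_cancel₀ _ hγ1.ne', hγt]
    abel
  have hA_ge : b * x ≤ frobNorm (Matrix.diagonal ![b * x, -s]) :=
    (le_abs_self _).trans (le_frobNorm_diagonal _)
  have hA_le : frobNorm (Matrix.diagonal ![b * x, -s]) / (Real.sqrt 2 * b) ≤ x := by
    rw [div_le_iff₀ (by positivity)]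
    refine (frobNorm_diagonal_le (c := b * x) ?_ ?_).trans_eq (by ring)
    · rw [abs_of_pos (by positivity)]
    · rw [abs_neg, abs_of_pos hs0]
      linarith
  have h2 : 0 < Real.sqrt 2 := by positivity
  refine ⟨ENNReal.ofReal (t₁ * (1 - t₂) / (1 - γ)) •
        Measure.dirac (Matrix.diagonal ![-(x + 1), -S])
      + ENNReal.ofReal ((1 - t₁) / (1 - γ)) • Measure.dirac (Matrix.diagonal ![b * x, P]),
    ⟨?_⟩, ?_, ?_, ?_, ?_⟩
  · simp only [Measure.add_apply, Measure.smul_apply, measure_univ, smul_eq_mul, mul_one]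
    rw [← ENNReal.ofReal_add (by positivity) (by positivity), ← add_div,
      show t₁ * (1 - t₂) + (1 - t₁) = 1 - γ by rw [hγt]; ring, div_self hγ1.ne',
      ENNReal.ofReal_one]
  · rw [hmeas]
    exact isLaminate_of_two_splits ht₁_mem ht₂_mem (rank_diagonal_sub_of_snd_ne (by linarith))
      (rank_diagonal_sub_of_fst_ne (by nlinarith)) hsplit₁ hsplit₂
  · rw [hmeas, barycenter_three_diracs _ _ _ (hγt ▸ hγ0.le) hw hv, hsplit₁, hsplit₂]
    simp only [smul_add, smul_smul]
  · exact two_diracs_setOf_not_eq_zero (P := fun X => (∃ g, X = Matrix.diagonal g) ∧ X ∈ Kpset p)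
      ⟨⟨_, rfl⟩, hK₂⟩ ⟨⟨_, rfl⟩, hK₁⟩
  · refine two_diracs_setOf_not_eq_zero
      (P := fun X => frobNorm (Matrix.diagonal ![b * x, -s]) / (Real.sqrt 2 * b) ≤ frobNorm X ∧
        frobNorm X ≤ 2 * Real.sqrt 2 * frobNorm (Matrix.diagonal ![b * x, -s])) ⟨?_, ?_⟩ ⟨?_, ?_⟩
    · have h := le_frobNorm_diagonal (u := -(x + 1)) (-S)
      rw [abs_neg, abs_of_pos (by positivity)] at h
      linarith
    · refine (frobNorm_diagonal_le (c := x + 1) ?_ ?_).trans ?_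
      · rw [abs_neg, abs_of_pos (by positivity)]
      · rwa [abs_neg, abs_of_pos hS0]
      · nlinarith
    · exact hA_le.trans (hbx.trans ((le_abs_self _).trans (le_frobNorm_diagonal _)))
    · refine (frobNorm_diagonal_le (c := b * x) ?_ ?_).trans ?_
      · rw [abs_of_pos (by positivity)]
      · rwa [abs_of_pos hP0]
      · nlinarith

end Paper
end
end

section
/- For every positive integer n, the full matrix space ℝ^{2n×2n} can be reduced to the set {X ∈ ℝ^{2n×2n} : rank X ≤ 1} in weak L². -/
open MeasureTheory Set Filter Topology

noncomputable section

namespace Paper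

variable {ι κ : Type*}

theorem volume_linear_level_eq_zero [Fintype ι] (f : (ι → ℝ) →ₗ[ℝ] ℝ) (v : ι → ℝ) (hv : f v ≠ 0)
    (a : ℝ) : volume {x : ι → ℝ | f x = a} = 0 := by
  set y : ι → ℝ := (a / f v) • v with hy
  have hfy : f y = a := by rw [hy, map_smul, smul_eq_mul, div_mul_cancel₀ _ hv]
  have h : {x : ι → ℝ | f x = a} = (fun x => x + (-y)) ⁻¹' (LinearMap.ker f : Set (ι → ℝ)) := by
    ext x
    simp [hfy, ← sub_eq_add_neg, sub_eq_zero]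
  rw [h, measure_preimage_add_right]
  refine Measure.addHaar_submodule _ _ fun htop => hv ?_
  have : v ∈ LinearMap.ker f := by rw [htop]; trivial
  simpa using this

theorem volume_coord_eq_zero [Fintype ι] (j : ι) (a : ℝ) :
    volume {x : ι → ℝ | x j = a} = 0 := by
  classical
  exact volume_linear_level_eq_zero (LinearMap.proj j) (Pi.single j 1) (by simp) a

theorem volume_face_sub_eq_zero [Fintype ι] {i j : ι} (hij : i ≠ j) (c w : ι → ℝ) :
    volume {x : ι → ℝ | w i - |x i - c i| = w j - |x j - c j|} = 0 := by
  classical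
  have key : ∀ s t a : ℝ, s ≠ 0 → volume {x : ι → ℝ | s * x i + t * x j = a} = 0 := by
    intro s t a hs
    refine volume_linear_level_eq_zero (s • LinearMap.proj i + t • LinearMap.proj j)
      (Pi.single i 1) ?_ a
    simpa [hij.symm] using hs
  refine measure_mono_null (t := ({x : ι → ℝ | (1 : ℝ) * x i + (-1) * x j = w i - w j + c i - c j} ∪
      {x : ι → ℝ | (1 : ℝ) * x i + 1 * x j = w i - w j + c i + c j}) ∪
      ({x : ι → ℝ | (-1 : ℝ) * x i + (-1) * x j = w i - w j - c i - c j} ∪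
      {x : ι → ℝ | (-1 : ℝ) * x i + 1 * x j = w i - w j - c i + c j})) ?_
    (measure_union_null (measure_union_null (key _ _ _ (by norm_num)) (key _ _ _ (by norm_num)))
      (measure_union_null (key _ _ _ (by norm_num)) (key _ _ _ (by norm_num))))
  intro x (hx : _ = _)
  rcases abs_cases (x i - c i) with ⟨h1, -⟩ | ⟨h1, -⟩ <;>
  rcases abs_cases (x j - c j) with ⟨h2, -⟩ | ⟨h2, -⟩ <;> rw [h1, h2] at hx
  · left; left; show _ = _; linarith
  · left; right; show _ = _; linarith
  · right; left; show _ = _; linarith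
  · right; right; show _ = _; linarith

/-- The open box with centre `c` and half-widths `w`. -/
def box (c w : ι → ℝ) : Set (ι → ℝ) := {x | ∀ j, |x j - c j| < w j}

theorem box_eq_pi (c w : ι → ℝ) :
    box c w = Set.pi univ fun j => Ioo (c j - w j) (c j + w j) := by
  ext x
  refine ⟨fun h j _ => ?_, fun h j => ?_⟩
  · have := abs_lt.1 (h j)
    exact ⟨by linarith [this.1], by linarith [this.2]⟩
  · have := h j trivial
    exact abs_lt.2 ⟨by linarith [this.1], by linarith [this.2]⟩

theorem isOpen_box [Finite ι] (c w : ι → ℝ) : IsOpen (box c w) := by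
  rw [box_eq_pi]
  exact isOpen_set_pi finite_univ fun _ _ => isOpen_Ioo

theorem convex_box (c w : ι → ℝ) : Convex ℝ (box c w) := by
  rw [box_eq_pi]
  exact convex_pi fun _ _ => convex_Ioo _ _

/-- Restricting one coordinate of a box to a subinterval scales the volume accordingly. -/
theorem volume_box_slab [Fintype ι] (c w : ι → ℝ) (j : ι) (a b l : ℝ) (hl : 0 ≤ l)
    (hab : b - a = l * (2 * w j)) :
    volume {x ∈ box c w | a < x j ∧ x j < b} ≤ ENNReal.ofReal l * volume (box c w) := by
  classical
  have hsub : {x ∈ box c w | a < x j ∧ x j < b} ⊆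
      Set.pi univ fun i => Ioo (Function.update (fun i => c i - w i) j a i)
        (Function.update (fun i => c i + w i) j b i) := by
    rintro x ⟨hx, hx1, hx2⟩
    rw [box_eq_pi] at hx
    intro i _
    by_cases hi : i = j
    · subst hi; simpa using ⟨hx1, hx2⟩
    · simpa [hi] using hx i trivial
  refine (measure_mono hsub).trans ?_
  rw [box_eq_pi, Real.volume_pi_Ioo, Real.volume_pi_Ioo,
    ← Finset.mul_prod_erase _ _ (Finset.mem_univ j), ← Finset.mul_prod_erase _ _ (Finset.mem_univ j),
    ← mul_assoc, ← ENNReal.ofReal_mul hl]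
  refine le_of_eq (congr_arg₂ _ ?_ (Finset.prod_congr rfl fun i hi => ?_))
  · simp only [Function.update_self, hab]; congr 1; ring
  · simp [(Finset.mem_erase.1 hi).1]

theorem exists_box_cover [Fintype ι] (E : Set (ι → ℝ)) (hE : IsOpen E) (η : ι → ℝ)
    (hη : ∀ j, 0 < η j) :
    ∃ (T : Set (ι → ℝ)) (r : (ι → ℝ) → ℝ), T.Countable ∧
      (∀ c ∈ T, 0 < r c ∧ r c < 1 ∧ box (η * c) (r c • η) ⊆ E) ∧
      T.PairwiseDisjoint (fun c => box (η * c) (r c • η)) ∧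
      volume (E \ ⋃ c ∈ T, box (η * c) (r c • η)) = 0 := by
  classical
  set L : (ι → ℝ) → (ι → ℝ) := fun x j => x j / η j with hL
  have hLc : Continuous L := by fun_prop
  have hηL : ∀ x, η * L x = x := fun x => by
    ext j; simp [hL, mul_div_cancel₀ _ (hη j).ne']
  set s : Set (ι → ℝ) := {y | η * y ∈ E} with hs
  have hso : IsOpen s := hE.preimage (continuous_const.mul continuous_id)
  have hscale : ∀ (c x : ι → ℝ) (j : ι), |x j - (η * c) j| = η j * |L x j - c j| := by
    intro c x j
    have h : x j - (η * c) j = η j * (L x j - c j) := by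
      simp [hL, mul_sub, mul_div_cancel₀ _ (hη j).ne']
    rw [h, abs_mul, abs_of_pos (hη j)]
  have hmem : ∀ c x (r : ℝ), x ∈ box (η * c) (r • η) ↔ ∀ j, |L x j - c j| < r := by
    intro c x r
    refine forall_congr' fun j => ?_
    rw [hscale, Pi.smul_apply, smul_eq_mul, mul_comm r, mul_lt_mul_iff_right₀ (hη j)]
  have hsubs : ∀ c (r : ℝ), 0 < r → box (η * c) (r • η) ⊆ L ⁻¹' Metric.closedBall c r := by
    intro c r hr x hx
    rw [mem_preimage, mem_closedBall_iff_norm, pi_norm_le_iff_of_nonneg hr.le]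
    exact fun j => ((hmem c x r).1 hx j).le
  obtain ⟨T, r, hTc, hTs, hr, hnull, hdisj⟩ := Besicovitch.exists_disjoint_closedBall_covering_ae
    (Measure.map L volume) (fun y => {r | Metric.closedBall y r ⊆ s}) s (by
      intro x hx δ hδ
      obtain ⟨e, he, hes⟩ := Metric.isOpen_iff.1 hso x hx
      refine ⟨min (e / 2) (δ / 2), (Metric.closedBall_subset_ball ?_).trans hes, by positivity, ?_⟩
      · exact (min_le_left _ _).trans_lt (by linarith)
      · exact (min_le_right _ _).trans_lt (by linarith)) (fun _ => 1) (fun _ _ => one_pos)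
  refine ⟨T, r, hTc, fun c hc => ⟨(hr c hc).2.1, (hr c hc).2.2, fun x hx => ?_⟩, ?_, ?_⟩
  · have : η * L x ∈ E := (hr c hc).1 (hsubs _ _ (hr c hc).2.1 hx)
    rwa [hηL] at this
  · intro c hc c' hc' hne
    exact (Disjoint.preimage L (hdisj hc hc' hne)).mono (hsubs _ _ (hr c hc).2.1)
      (hsubs _ _ (hr c' hc').2.1)
  · have hms : MeasurableSet (s \ ⋃ c ∈ T, Metric.closedBall c (r c)) :=
      hso.measurableSet.diff (MeasurableSet.biUnion hTc fun _ _ => Metric.isClosed_closedBall.measurableSet)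
    rw [Measure.map_apply hLc.measurable hms] at hnull
    have hfaces : volume (⋃ c ∈ T, ⋃ j, ({x : ι → ℝ | x j = (η * c) j + η j * r c} ∪
        {x : ι → ℝ | x j = (η * c) j - η j * r c})) = 0 :=
      (measure_biUnion_null_iff hTc).2 fun c _ => measure_iUnion_null fun j =>
        measure_union_null (volume_coord_eq_zero _ _) (volume_coord_eq_zero _ _)
    refine measure_mono_null ?_ (measure_union_null hnull hfaces)
    rintro x ⟨hxE, hx⟩
    by_cases hxc : L x ∈ ⋃ c ∈ T, Metric.closedBall c (r c)
    · right
      simp only [mem_iUnion, exists_prop, not_exists, not_and] at hxc hx ⊢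
      obtain ⟨c, hc, hxc⟩ := hxc
      have h1 := hx c hc
      rw [hmem] at h1
      push Not at h1
      obtain ⟨j, hj⟩ := h1
      rw [mem_closedBall_iff_norm, pi_norm_le_iff_of_nonneg (hr c hc).2.1.le] at hxc
      have h2 : |x j - (η * c) j| = η j * r c := by
        rw [hscale, le_antisymm (show |L x j - c j| ≤ r c from hxc j) hj]
      refine ⟨c, hc, j, ?_⟩
      rcases abs_cases (x j - (η * c) j) with ⟨h3, -⟩ | ⟨h3, -⟩
      · left; show _ = _; linarith
      · right; show _ = _; linarith
    · left
      exact ⟨by rw [hs]; show η * L x ∈ E; rwa [hηL], hxc⟩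

/-- Inside one of a family of disjoint boxes, the distance to the complement of their union is the
distance to the nearest face. -/
theorem infDist_compl_boxes [Fintype ι] {U : Set (ι → ℝ)} {c w : ι → ℝ} (hU : box c w ⊆ U)
    (hface : ∀ y, (∀ i, |y i - c i| ≤ w i) → y ∉ box c w → y ∉ U)
    {x : ι → ℝ} (hx : x ∈ box c w) {j : ι}
    (hj : ∀ i, w j - |x j - c j| ≤ w i - |x i - c i|) :
    Metric.infDist x Uᶜ = w j - |x j - c j| := by
  classical
  set m := w j - |x j - c j| with hm
  have hm0 : 0 < m := by have := hx j; linarith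
  obtain ⟨y, hyU, hxy⟩ : ∃ y ∈ Uᶜ, dist x y ≤ m := by
    obtain ⟨s, hs, hs'⟩ : ∃ s : ℝ, |s| = 1 ∧ s * (x j - c j) = |x j - c j| := by
      rcases le_total 0 (x j - c j) with h | h
      · exact ⟨1, by simp, by rw [abs_of_nonneg h, one_mul]⟩
      · exact ⟨-1, by simp, by rw [abs_of_nonpos h]; ring⟩
    have hss : s * s = 1 := by rw [← abs_mul_abs_self, hs, one_mul]
    have hyj : |x j + s * m - c j| = w j := by
      have h1 : x j + s * m - c j = s * w j := by
        have : x j - c j = s * |x j - c j| := by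
          rw [← hs', ← mul_assoc, hss, one_mul]
        rw [hm, mul_sub, ← this]; ring
      rw [h1, abs_mul, hs, one_mul, abs_of_nonneg]
      exact (abs_nonneg _).trans (hx j).le
    refine ⟨Function.update x j (x j + s * m), hface _ (fun i => ?_) (fun h => ?_), ?_⟩
    · by_cases hi : i = j
      · subst hi; simp [hyj]
      · simpa [hi] using (hx i).le
    · have := h j
      rw [Function.update_self, hyj] at this
      exact lt_irrefl _ this
    · rw [dist_pi_le_iff hm0.le]
      intro i
      by_cases hi : i = j
      · subst hi
        simp [hs, abs_of_pos hm0]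
      · simp [hi, hm0.le]
  refine le_antisymm ((Metric.infDist_le_dist_of_mem hyU).trans hxy) ?_
  rw [Metric.le_infDist ⟨y, hyU⟩]
  intro z hz
  have hzb : z ∉ box c w := fun h => hz (hU h)
  simp only [box, Set.mem_ofPred_eq, not_forall, not_lt] at hzb
  obtain ⟨i, hi⟩ := hzb
  refine (hj i).trans (le_trans ?_ (dist_le_pi_dist x z i))
  rw [Real.dist_eq]
  have := abs_sub_le (z i) (x i) (c i)
  rw [abs_sub_comm (z i) (x i)] at this
  linarith

/-- A union of sets that is cut out box by box inherits the volume fraction of its pieces. -/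
theorem volume_biUnion_le_of_boxes [Fintype ι] {T : Set (ι → ℝ)} (hT : T.Countable)
    (B S : (ι → ℝ) → Set (ι → ℝ)) (hB : ∀ c ∈ T, IsOpen (B c)) (hd : T.PairwiseDisjoint B)
    (l : ENNReal) (hS : ∀ c ∈ T, volume (S c) ≤ l * volume (B c)) (W : Set (ι → ℝ))
    (hW : ∀ c ∈ T, B c ⊆ W) :
    volume (⋃ c ∈ T, S c) ≤ l * volume W := by
  have := hT.to_subtype
  calc volume (⋃ c ∈ T, S c) ≤ ∑' c : T, volume (S c) := measure_biUnion_le _ hT _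
    _ ≤ ∑' c : T, l * volume (B c) := ENNReal.tsum_le_tsum fun c => hS c c.2
    _ = l * volume (⋃ c ∈ T, B c) := by
      rw [ENNReal.tsum_mul_left, measure_biUnion hT hd fun c hc => (hB c hc).measurableSet]
    _ ≤ l * volume W := by gcongr; exact iUnion₂_subset hW

/-- A tent-like function: 1-Lipschitz, small, supported in `E`, with derivative `±e_k` outside a
small part of `E`, and piecewise affine. -/
theorem exists_tent [Fintype ι] (E : Set (ι → ℝ)) (hE : IsOpen E) (k : ι) (δ : ℝ) (hδ : 0 < δ) :
    ∃ (h : (ι → ℝ) → ℝ) (P Q N : Set (ι → ℝ)), LipschitzWith 1 h ∧ (∀ x, 0 ≤ h x ∧ h x ≤ δ) ∧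
      (∀ x ∉ E, h x = 0) ∧ IsOpen P ∧ IsOpen Q ∧ IsOpen N ∧ P ⊆ E ∧ Q ⊆ E ∧ N ⊆ E ∧
      Disjoint P Q ∧ Disjoint P N ∧ Disjoint Q N ∧ volume (E \ (P ∪ Q ∪ N)) = 0 ∧
      (∀ x ∈ P, ∀ᶠ y in 𝓝 x, h y = h x + (y k - x k)) ∧
      (∀ x ∈ Q, ∀ᶠ y in 𝓝 x, h y = h x - (y k - x k)) ∧
      (∀ x ∈ N, ∃ (j : ι) (s : ℝ), |s| = 1 ∧ ∀ᶠ y in 𝓝 x, h y = h x + s * (y j - x j)) ∧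
      volume N ≤ ENNReal.ofReal δ * volume E ∧
      (∀ W ⊆ E, IsOpen W → IsOpen (E \ W) → volume (P ∩ W) ≤ ENNReal.ofReal (1 / 2) * volume W) := by
  classical
  have hcard : (0 : ℝ) < Fintype.card ι := by
    have : Nonempty ι := ⟨k⟩
    exact_mod_cast Fintype.card_pos
  set θ : ℝ := min δ (δ / Fintype.card ι) with hθ
  have hθ0 : 0 < θ := lt_min hδ (div_pos hδ hcard)
  set η : ι → ℝ := fun j => if j = k then θ else 1 with hη
  have hηk : η k = θ := by simp [hη]
  have hηj : ∀ j, j ≠ k → η j = 1 := fun j hj => by simp [hη, hj]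
  obtain ⟨T, r, hTc, hT, hTd, hTnull⟩ := exists_box_cover E hE η (fun j => by
    by_cases h : j = k <;> simp [hη, h, hθ0])
  set B : (ι → ℝ) → Set (ι → ℝ) := fun c => box (η * c) (r c • η) with hB
  set U : Set (ι → ℝ) := ⋃ c ∈ T, B c with hU
  have hUE : U ⊆ E := iUnion₂_subset fun c hc => (hT c hc).2.2
  have hBo : ∀ c, IsOpen (B c) := fun c => isOpen_box _ _
  set φ : (ι → ℝ) → ι → (ι → ℝ) → ℝ := fun c j x => (r c • η) j - |x j - (η * c) j| with hφ
  have hφc : ∀ c j, Continuous (φ c j) := fun c j => by simp only [hφ]; fun_prop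
  set h : (ι → ℝ) → ℝ := fun x => Metric.infDist x Uᶜ with hh
  have hval : ∀ c ∈ T, ∀ x ∈ B c, ∀ j, (∀ i, φ c j x ≤ φ c i x) → h x = φ c j x := by
    intro c hc x hx j hj
    refine infDist_compl_boxes (subset_biUnion_of_mem (u := B) hc) (fun y hy hyb hyU => ?_) hx hj
    simp only [mem_iUnion, exists_prop] at hyU
    obtain ⟨c', hc', hy'⟩ := hyU
    have hne : c ≠ c' := by rintro rfl; exact hyb hy'
    have hycl : y ∈ closure (B c) := by
      rw [hB]
      simp only [box_eq_pi]
      rw [closure_pi_set]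
      intro i _
      have := abs_le.1 (hy i)
      have hpos : 0 < (r c • η) i := (abs_nonneg _).trans_lt (hx i)
      show y i ∈ closure (Ioo ((η * c) i - (r c • η) i) ((η * c) i + (r c • η) i))
      rw [closure_Ioo (by linarith)]
      exact ⟨by linarith [this.1], by linarith [this.2]⟩
    obtain ⟨z, hz', hz⟩ := mem_closure_iff.1 hycl _ (hBo c') hy'
    exact Set.disjoint_left.1 (hTd hc hc' hne) hz hz'
  set R : (ι → ℝ) → ι → Set (ι → ℝ) := fun c j =>
    {x ∈ B c | ∀ i, i ≠ j → φ c j x < φ c i x} with hR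
  have hRo : ∀ c j, IsOpen (R c j) := by
    intro c j
    have : R c j = B c ∩ ⋂ i, ⋂ (_ : i ≠ j), {x | φ c j x < φ c i x} := by
      ext x; simp only [hR, mem_inter_iff, mem_iInter]; rfl
    rw [this]
    exact (hBo c).inter (isOpen_iInter_of_finite fun i => isOpen_iInter_of_finite fun _ =>
      isOpen_lt (hφc c j) (hφc c i))
  have hRval : ∀ c ∈ T, ∀ j, ∀ x ∈ R c j, h x = φ c j x := by
    intro c hc j x hx
    refine hval c hc x hx.1 j fun i => ?_
    by_cases hi : i = j
    · rw [hi]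
    · exact (hx.2 i hi).le
  set P' : (ι → ℝ) → Set (ι → ℝ) := fun c => R c k ∩ {x | x k < (η * c) k} with hP'
  set Q' : (ι → ℝ) → Set (ι → ℝ) := fun c => R c k ∩ {x | (η * c) k < x k} with hQ'
  set N' : (ι → ℝ) → Set (ι → ℝ) := fun c =>
    ⋃ j, ⋃ (_ : j ≠ k), R c j ∩ {x | x j ≠ (η * c) j} with hN'
  have hP'o : ∀ c, IsOpen (P' c) := fun c =>
    (hRo c k).inter (isOpen_lt (continuous_apply k) continuous_const)
  have hQ'o : ∀ c, IsOpen (Q' c) := fun c =>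
    (hRo c k).inter (isOpen_lt continuous_const (continuous_apply k))
  have hN'o : ∀ c, IsOpen (N' c) := fun c => isOpen_iUnion fun j => isOpen_iUnion fun _ =>
    (hRo c j).inter (isOpen_ne_fun (continuous_apply j) continuous_const)
  have hRB : ∀ c j, R c j ⊆ B c := fun c j x hx => hx.1
  have hP'B : ∀ c, P' c ⊆ B c := fun c => inter_subset_left.trans (hRB c k)
  have hQ'B : ∀ c, Q' c ⊆ B c := fun c => inter_subset_left.trans (hRB c k)
  have hN'B : ∀ c, N' c ⊆ B c := fun c =>
    iUnion₂_subset fun j _ => inter_subset_left.trans (hRB c j)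
  have hdisj : ∀ S S' : (ι → ℝ) → Set (ι → ℝ), (∀ c, S c ⊆ B c) → (∀ c, S' c ⊆ B c) →
      (∀ c, ∀ x ∈ S c, x ∉ S' c) → Disjoint (⋃ c ∈ T, S c) (⋃ c ∈ T, S' c) := by
    intro S S' hS hS' hd
    rw [Set.disjoint_left]
    intro x hx hx'
    simp only [mem_iUnion, exists_prop] at hx hx'
    obtain ⟨c, hc, hx⟩ := hx
    obtain ⟨c', hc', hx'⟩ := hx'
    by_cases hne : c = c'
    · subst hne; exact hd c x hx hx'
    · exact Set.disjoint_left.1 (hTd hc hc' hne) (hS c hx) (hS' c' hx')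
  have hRdisj : ∀ c j x, j ≠ k → x ∈ R c k → x ∉ R c j := fun c j x hj hx hx' =>
    lt_asymm (hx.2 j hj) (hx'.2 k hj.symm)
  refine ⟨h, ⋃ c ∈ T, P' c, ⋃ c ∈ T, Q' c, ⋃ c ∈ T, N' c, Metric.lipschitz_infDist_pt _,
    fun x => ⟨Metric.infDist_nonneg, ?_⟩, fun x hx => Metric.infDist_zero_of_mem fun hxU => hx (hUE hxU),
    isOpen_biUnion fun c _ => hP'o c, isOpen_biUnion fun c _ => hQ'o c,
    isOpen_biUnion fun c _ => hN'o c,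
    iUnion₂_subset fun c hc => (hP'B c).trans (hT c hc).2.2,
    iUnion₂_subset fun c hc => (hQ'B c).trans (hT c hc).2.2,
    iUnion₂_subset fun c hc => (hN'B c).trans (hT c hc).2.2,
    hdisj _ _ hP'B hQ'B fun c x hx hx' => lt_asymm (show x k < (η * c) k from hx.2) hx'.2,
    hdisj _ _ hP'B hN'B fun c x hx hx' => ?_, hdisj _ _ hQ'B hN'B fun c x hx hx' => ?_,
    ?_, ?_, ?_, ?_, ?_, ?_⟩
  · by_cases hxU : x ∈ U
    · simp only [hU, mem_iUnion, exists_prop] at hxU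
      obtain ⟨c, hc, hxc⟩ := hxU
      have : Nonempty ι := ⟨k⟩
      obtain ⟨j, hj⟩ := Finite.exists_min fun i => φ c i x
      rw [hval c hc x hxc j hj]
      refine (hj k).trans ?_
      have h1 : φ c k x ≤ r c * θ := by
        simp only [hφ, Pi.smul_apply, smul_eq_mul, hηk]
        linarith [abs_nonneg (x k - (η * c) k)]
      have h2 : r c * θ ≤ 1 * θ := by gcongr; exact (hT c hc).2.1.le
      linarith [min_le_left δ (δ / Fintype.card ι)]
    · have : h x = 0 := Metric.infDist_zero_of_mem hxU
      rw [this]; exact hδ.le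
  · simp only [hN', mem_iUnion, exists_prop] at hx'
    obtain ⟨j, hj, hx', -⟩ := hx'
    exact hRdisj c j x hj hx.1 hx'
  · simp only [hN', mem_iUnion, exists_prop] at hx'
    obtain ⟨j, hj, hx', -⟩ := hx'
    exact hRdisj c j x hj hx.1 hx'
  · have hnull : volume (⋃ c ∈ T, ((⋃ j, {x : ι → ℝ | x j = (η * c) j}) ∪
        ⋃ i, ⋃ j, ⋃ (_ : i ≠ j), {x : ι → ℝ | φ c i x = φ c j x})) = 0 :=
      (measure_biUnion_null_iff hTc).2 fun c _ => measure_union_null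
        (measure_iUnion_null fun j => volume_coord_eq_zero _ _)
        (measure_iUnion_null fun i => measure_iUnion_null fun j => measure_iUnion_null fun hij =>
          volume_face_sub_eq_zero hij _ _)
    refine measure_mono_null ?_ (measure_union_null hTnull hnull)
    rintro x ⟨hxE, hx⟩
    by_cases hxU : x ∈ U
    · right
      simp only [hU, mem_iUnion, exists_prop] at hxU
      obtain ⟨c, hc, hxc⟩ := hxU
      refine mem_biUnion hc ?_
      by_contra hcon
      simp only [mem_union, mem_iUnion, exists_prop, not_or, not_exists, not_and] at hcon hx
      have : Nonempty ι := ⟨k⟩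
      obtain ⟨j, hj⟩ := Finite.exists_min fun i => φ c i x
      have hxR : x ∈ R c j := ⟨hxc, fun i hi => lt_of_le_of_ne (hj i) fun he => hcon.2 j i hi.symm he⟩
      by_cases hjk : j = k
      · subst hjk
        rcases lt_or_gt_of_ne (show x j ≠ (η * c) j from hcon.1 j) with hlt | hgt
        · exact hx.1.1 c hc ⟨hxR, hlt⟩
        · exact hx.1.2 c hc ⟨hxR, hgt⟩
      · exact hx.2 c hc (mem_iUnion₂.2 ⟨j, hjk, hxR, hcon.1 j⟩)
    · left; exact ⟨hxE, hxU⟩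
  · intro x hx
    simp only [mem_iUnion, exists_prop] at hx
    obtain ⟨c, hc, hx⟩ := hx
    have hf : ∀ y ∈ P' c, h y = (r c • η) k + (y k - (η * c) k) := fun y hy => by
      have h0 : y k < (η * c) k := hy.2
      rw [hRval c hc k y hy.1]
      simp only [hφ]
      rw [abs_of_neg (sub_neg.2 h0)]
      ring
    filter_upwards [(hP'o c).mem_nhds hx] with y hy
    rw [hf y hy, hf x hx]; ring
  · intro x hx
    simp only [mem_iUnion, exists_prop] at hx
    obtain ⟨c, hc, hx⟩ := hx
    have hf : ∀ y ∈ Q' c, h y = (r c • η) k - (y k - (η * c) k) := fun y hy => by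
      have h0 : (η * c) k < y k := hy.2
      rw [hRval c hc k y hy.1]
      simp only [hφ]
      rw [abs_of_pos (sub_pos.2 h0)]
    filter_upwards [(hQ'o c).mem_nhds hx] with y hy
    rw [hf y hy, hf x hx]; ring
  · intro x hx
    simp only [hN', mem_iUnion, exists_prop] at hx
    obtain ⟨c, hc, j, hj, hx, hxj⟩ := hx
    rcases lt_or_gt_of_ne (show x j ≠ (η * c) j from hxj) with hlt | hgt
    · refine ⟨j, 1, by simp, ?_⟩
      have hf : ∀ y ∈ R c j, y j < (η * c) j → h y = (r c • η) j + (y j - (η * c) j) :=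
        fun y hy h0 => by
          rw [hRval c hc j y hy]
          simp only [hφ]
          rw [abs_of_neg (sub_neg.2 h0)]
          ring
      filter_upwards [(hRo c j).mem_nhds hx,
        (isOpen_lt (continuous_apply j) continuous_const).mem_nhds hlt] with y hy hy'
      rw [hf y hy hy', hf x hx hlt]; ring
    · refine ⟨j, -1, by simp, ?_⟩
      have hf : ∀ y ∈ R c j, (η * c) j < y j → h y = (r c • η) j - (y j - (η * c) j) :=
        fun y hy h0 => by
          rw [hRval c hc j y hy]
          simp only [hφ]
          rw [abs_of_pos (sub_pos.2 h0)]
      filter_upwards [(hRo c j).mem_nhds hx,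
        (isOpen_lt continuous_const (continuous_apply j)).mem_nhds hgt] with y hy hy'
      rw [hf y hy hy', hf x hx hgt]; ring
  · refine volume_biUnion_le_of_boxes hTc B N' (fun c _ => hBo c) hTd _ (fun c hc => ?_) E
      fun c hc => (hT c hc).2.2
    have hsub : N' c ⊆ ⋃ j ∈ Finset.univ.erase k,
        ({x ∈ B c | (η * c) j + (1 - θ) * r c < x j ∧ x j < (η * c) j + r c} ∪
          {x ∈ B c | (η * c) j - r c < x j ∧ x j < (η * c) j - (1 - θ) * r c}) := by
      intro x hx
      simp only [hN', mem_iUnion, exists_prop] at hx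
      obtain ⟨j, hj, hx, -⟩ := hx
      refine mem_biUnion (by simpa using hj) ?_
      have h1 := hx.2 k hj.symm
      have h2 := hx.1 j
      simp only [hφ, Pi.smul_apply, smul_eq_mul, hηk, hηj j hj, mul_one] at h1 h2
      have h3 := abs_nonneg (x k - (η * c) k)
      rcases abs_cases (x j - (η * c) j) with ⟨h4, -⟩ | ⟨h4, -⟩ <;> rw [h4] at h1 h2
      · exact Or.inl ⟨hx.1, by linarith, by linarith⟩
      · exact Or.inr ⟨hx.1, by linarith, by linarith⟩
    calc volume (N' c) ≤ ∑ j ∈ Finset.univ.erase k, volume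
          ({x ∈ B c | (η * c) j + (1 - θ) * r c < x j ∧ x j < (η * c) j + r c} ∪
          {x ∈ B c | (η * c) j - r c < x j ∧ x j < (η * c) j - (1 - θ) * r c}) :=
          (measure_mono hsub).trans (measure_biUnion_finset_le _ _)
      _ ≤ ∑ j ∈ Finset.univ.erase k, ENNReal.ofReal θ * volume (B c) := by
        refine Finset.sum_le_sum fun j hj => (measure_union_le _ _).trans ?_
        have hw : (r c • η) j = r c := by simp [hηj j (Finset.ne_of_mem_erase hj)]
        have e : ENNReal.ofReal θ = ENNReal.ofReal (θ / 2) + ENNReal.ofReal (θ / 2) := by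
          rw [← ENNReal.ofReal_add (by positivity) (by positivity), add_halves]
        rw [e, add_mul]
        exact add_le_add (volume_box_slab _ _ j _ _ _ (by positivity) (by rw [hw]; ring))
          (volume_box_slab _ _ j _ _ _ (by positivity) (by rw [hw]; ring))
      _ ≤ ∑ j : ι, ENNReal.ofReal θ * volume (B c) :=
        Finset.sum_le_sum_of_subset (Finset.erase_subset _ _)
      _ = (Fintype.card ι : ENNReal) * ENNReal.ofReal θ * volume (B c) := by
        rw [Finset.sum_const, Finset.card_univ, nsmul_eq_mul, mul_assoc]
      _ ≤ ENNReal.ofReal δ * volume (B c) := by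
        gcongr
        rw [← ENNReal.ofReal_natCast, ← ENNReal.ofReal_mul hcard.le]
        refine ENNReal.ofReal_le_ofReal ?_
        rw [← le_div_iff₀' hcard]
        exact min_le_right _ _
  · intro W hWE hWo hWo'
    have hsub : (⋃ c ∈ T, P' c) ∩ W ⊆ ⋃ c ∈ {c ∈ T | B c ⊆ W}, P' c := by
      rintro x ⟨hx, hxW⟩
      simp only [mem_iUnion, exists_prop] at hx
      obtain ⟨c, hc, hx⟩ := hx
      refine mem_biUnion (show c ∈ {c ∈ T | B c ⊆ W} from ⟨hc, ?_⟩) hx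
      refine (convex_box _ _).isPreconnected.subset_left_of_subset_union hWo hWo' disjoint_sdiff_right
        ?_ ⟨x, hP'B c hx, hxW⟩
      rw [union_sdiff_cancel hWE]
      exact (hT c hc).2.2
    refine (measure_mono hsub).trans (volume_biUnion_le_of_boxes (hTc.mono (sep_subset _ _)) B P'
      (fun c _ => hBo c) (hTd.subset (sep_subset _ _)) _ (fun c hc => ?_) W fun c hc => hc.2)
    refine (measure_mono ?_).trans (volume_box_slab (η * c) (r c • η) k
      ((η * c) k - (r c • η) k) ((η * c) k) (1 / 2) (by norm_num) (by ring))
    intro x hx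
    refine ⟨hP'B c hx, ?_, hx.2⟩
    have := abs_lt.1 (hP'B c hx k)
    linarith [this.1]

/-- `u` is affine near `x`, with gradient `B`. -/
def LocallyAffineAt [Fintype ι] (u : (ι → ℝ) → κ → ℝ) (x : ι → ℝ) (B : Matrix κ ι ℝ) : Prop :=
  ∀ᶠ y in 𝓝 x, u y = u x + B.mulVec (y - x)

theorem LocallyAffineAt.add_smul [Fintype ι] [DecidableEq ι] {u u' : (ι → ℝ) → κ → ℝ}
    {h : (ι → ℝ) → ℝ} {x : ι → ℝ} {B : Matrix κ ι ℝ} {v : κ → ℝ} {j : ι} {s : ℝ}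
    (hu : LocallyAffineAt u x B) (hh : ∀ᶠ y in 𝓝 x, h y = h x + s * (y j - x j))
    (hu' : ∀ y a, u' y a = u y a + v a * h y) :
    LocallyAffineAt u' x (B + Matrix.vecMulVec v (Pi.single j s)) := by
  filter_upwards [hu, hh] with y hy hy'
  ext a
  have e : (Matrix.vecMulVec v (Pi.single j s)).mulVec (y - x) a = v a * (s * (y j - x j)) := by
    simp [Matrix.mulVec, dotProduct, Matrix.vecMulVec_apply, Pi.single_apply, mul_assoc]
  rw [hu', hy, hy', Pi.add_apply, Pi.add_apply, Matrix.add_mulVec, Pi.add_apply, e, hu']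
  ring

/-- The matrix `A` with the columns in `s` scaled by `w` and the other columns set to zero. -/
def scaleCols [DecidableEq ι] (A : Matrix κ ι ℝ) (w : ι → ℝ) (s : Finset ι) : Matrix κ ι ℝ :=
  Matrix.of fun a b => if b ∈ s then w b * A a b else 0

theorem rank_scaleCols_le [Fintype ι] [Fintype κ] [DecidableEq ι] (A : Matrix κ ι ℝ) (w : ι → ℝ)
    (s : Finset ι) : (scaleCols A w s).rank ≤ s.card := by
  classical
  have h : scaleCols A w s = A * Matrix.diagonal fun b => if b ∈ s then w b else 0 := by
    ext a b
    simp only [scaleCols, Matrix.of_apply, Matrix.mul_diagonal]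
    split_ifs <;> ring
  rw [h]
  refine (Matrix.rank_mul_le_right _ _).trans ?_
  rw [Matrix.rank_diagonal, Fintype.card_subtype]
  refine Finset.card_le_card fun b hb => ?_
  by_contra hbs
  simp [hbs] at hb

/-- An intermediate state of the construction: a map `u`, the open set `V` where it will still be
modified, and, at the points of `V`, the set `σ` of columns of the gradient that do not vanish. -/
structure Stage (ι κ : Type*) where
  u : (ι → ℝ) → κ → ℝ
  V : Set (ι → ℝ)
  σ : (ι → ℝ) → Finset ι

namespace Stage

/-- The set of live points at which the columns `i` and `l` are both active. -/
def pair (S : Stage ι κ) (i l : ι) : Set (ι → ℝ) := {x ∈ S.V | i ∈ S.σ x ∧ l ∈ S.σ x}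

structure Valid [Fintype ι] [DecidableEq ι] (A : Matrix κ ι ℝ) (w : ι → ℝ) (S : Stage ι κ) :
    Prop where
  isOpen : IsOpen S.V
  two_le : ∀ x ∈ S.V, 2 ≤ (S.σ x).card
  locConst : ∀ x ∈ S.V, ∀ᶠ y in 𝓝 x, S.σ y = S.σ x
  affine : ∀ x ∈ S.V, LocallyAffineAt S.u x (scaleCols A w (S.σ x))

theorem Valid.isOpen_sep [Fintype ι] [DecidableEq ι] {A : Matrix κ ι ℝ} {w : ι → ℝ}
    {S : Stage ι κ} (hS : S.Valid A w) (p : Finset ι → Prop) : IsOpen {x ∈ S.V | p (S.σ x)} := by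
  rw [isOpen_iff_eventually]
  rintro x ⟨hxV, hx⟩
  filter_upwards [hS.isOpen.mem_nhds hxV, hS.locConst x hxV] with y hy hy'
  refine ⟨hy, ?_⟩
  rw [hy']; exact hx

/-- `S'` arises from `S` by splitting the column `k`; `D` is the part where this produces rank one
gradients, `N` the exceptional part, and `h` the profile of the perturbation. -/
structure IsStep [Fintype ι] [Fintype κ] (A : Matrix κ ι ℝ) (w : ι → ℝ) (k : ι) (δ : ℝ)
    (S S' : Stage ι κ) (h : (ι → ℝ) → ℝ) (D N : Set (ι → ℝ)) : Prop where
  lipschitz : LipschitzWith 1 h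
  nonneg : ∀ x, 0 ≤ h x
  le : ∀ x, h x ≤ δ
  eq_zero : ∀ x ∉ S.V, h x = 0
  u_eq : ∀ x a, S'.u x a = S.u x a + w k * A a k * h x
  subset : S'.V ⊆ S.V
  isOpen_done : IsOpen D
  isOpen_err : IsOpen N
  done_subset : D ⊆ S.V
  err_subset : N ⊆ S.V
  done_disj : Disjoint D S'.V
  err_disj : Disjoint N S'.V
  null : volume (S.V \ (S'.V ∪ D ∪ N)) = 0
  done_affine : ∀ x ∈ D, ∃ B, LocallyAffineAt S'.u x B ∧ B.rank ≤ 1 ∧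
    ∀ a b, |B a b| ≤ |w b * A a b| + |w k * A a k|
  err_affine : ∀ x ∈ N, ∃ B, LocallyAffineAt S'.u x B ∧
    ∀ a b, |B a b| ≤ |w b * A a b| + |w k * A a k|
  volume_err : volume N ≤ ENNReal.ofReal δ * volume S.V
  volume_pair : ∀ l, volume (S'.pair k l) ≤ ENNReal.ofReal (1 / 2) * volume (S.pair k l)
  pair_subset : ∀ i l, S'.pair i l ⊆ S.pair i l

theorem Valid.exists_step [Fintype ι] [DecidableEq ι] [Fintype κ] {A : Matrix κ ι ℝ} {w : ι → ℝ}
    {S : Stage ι κ} (hS : S.Valid A w) (k : ι) (δ : ℝ) (hδ : 0 < δ) :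
    ∃ (S' : Stage ι κ) (h : (ι → ℝ) → ℝ) (D N : Set (ι → ℝ)),
      S'.Valid A (Function.update w k (2 * w k)) ∧ IsStep A w k δ S S' h D N := by
  classical
  set E : Set (ι → ℝ) := {x ∈ S.V | k ∈ S.σ x} with hEdef
  have hE : IsOpen E := hS.isOpen_sep (fun s => k ∈ s)
  obtain ⟨h, P, Q, N, hlip, hb, hz, hPo, hQo, hNo, hPE, hQE, hNE, hPQ, hPN, hQN, hnull, hP, hQ, hN,
    hNvol, hhalf⟩ := exists_tent E hE k δ hδ
  have hEV : E ⊆ S.V := fun x hx => hx.1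
  set u' : (ι → ℝ) → κ → ℝ := fun x a => S.u x a + w k * A a k * h x with hu'
  set v : κ → ℝ := fun a => w k * A a k with hv
  have hu'v : ∀ y a, u' y a = S.u y a + v a * h y := fun y a => rfl
  have hoff : IsOpen {x ∈ S.V | k ∉ S.σ x} := hS.isOpen_sep (fun s => k ∉ s)
  set σ' : (ι → ℝ) → Finset ι := fun x => if x ∈ Q then (S.σ x).erase k else S.σ x with hσ'
  have hσQ : ∀ x ∈ Q, σ' x = (S.σ x).erase k := fun x hx => by simp [hσ', hx]
  have hσn : ∀ x, x ∉ Q → σ' x = S.σ x := fun x hx => by simp [hσ', hx]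
  have hσsub : ∀ x, σ' x ⊆ S.σ x := fun x => by
    by_cases hx : x ∈ Q
    · rw [hσQ x hx]; exact Finset.erase_subset _ _
    · rw [hσn x hx]
  set V' : Set (ι → ℝ) := {x ∈ S.V | k ∉ S.σ x} ∪ P ∪ (Q ∩ {x ∈ S.V | 3 ≤ (S.σ x).card}) with hV'
  set D : Set (ι → ℝ) := Q ∩ {x ∈ S.V | (S.σ x).card < 3} with hD
  have hP' : ∀ x ∈ P, LocallyAffineAt u' x
      (scaleCols A (Function.update w k (2 * w k)) (S.σ x)) := by
    intro x hx
    convert (hS.affine x (hEV (hPE hx))).add_smul (h := h) (j := k) (s := 1)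
      (by simpa using hP x hx) hu'v using 1
    ext a b
    have hk : k ∈ S.σ x := (hPE hx).2
    by_cases hbk : b = k
    · subst hbk
      simp [scaleCols, Matrix.vecMulVec_apply, hk, hv]; ring
    · simp [scaleCols, Matrix.vecMulVec_apply, hbk]
  have hQ' : ∀ x ∈ Q, ∀ w' : ι → ℝ, (∀ b, b ≠ k → w' b = w b) → LocallyAffineAt u' x
      (scaleCols A w' ((S.σ x).erase k)) := by
    intro x hx w' hw'
    convert (hS.affine x (hEV (hQE hx))).add_smul (h := h) (j := k) (s := -1)
      (by simpa only [neg_one_mul, ← sub_eq_add_neg] using hQ x hx) hu'v using 1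
    ext a b
    have hk : k ∈ S.σ x := (hQE hx).2
    by_cases hbk : b = k
    · subst hbk
      simp [scaleCols, Matrix.vecMulVec_apply, hk, hv]
    · simp [scaleCols, Matrix.vecMulVec_apply, hbk, hw' b hbk]
  have hpair : ∀ i l, (Stage.mk u' V' σ').pair i l ⊆ S.pair i l := by
    rintro i l x ⟨hx, hi, hl⟩
    refine ⟨?_, hσsub x hi, hσsub x hl⟩
    rcases hx with (hx | hx) | hx
    · exact hx.1
    · exact hEV (hPE hx)
    · exact hEV (hQE hx.1)
  refine ⟨⟨u', V', σ'⟩, h, D, N, ⟨?_, ?_, ?_, ?_⟩, ?_⟩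
  · exact (hoff.union hPo).union (hQo.inter (hS.isOpen_sep fun s => 3 ≤ s.card))
  · rintro x ((hx | hx) | ⟨hx, hx'⟩)
    · show 2 ≤ (σ' x).card
      rw [hσn x fun h => hx.2 (hQE h).2]; exact hS.two_le x hx.1
    · show 2 ≤ (σ' x).card
      rw [hσn x fun h => Set.disjoint_left.1 hPQ hx h]; exact hS.two_le x (hEV (hPE hx))
    · show 2 ≤ (σ' x).card
      rw [hσQ x hx, Finset.card_erase_of_mem (hQE hx).2]
      have := hx'.2
      omega
  · rintro x ((hx | hx) | ⟨hx, hx'⟩)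
    · filter_upwards [hoff.mem_nhds hx, hS.locConst x hx.1] with y hy hy'
      show σ' y = σ' x
      rw [hσn x fun h => hx.2 (hQE h).2, hσn y fun h => hy.2 (hQE h).2, hy']
    · filter_upwards [hPo.mem_nhds hx, hS.locConst x (hEV (hPE hx))] with y hy hy'
      show σ' y = σ' x
      rw [hσn x fun h => Set.disjoint_left.1 hPQ hx h, hσn y fun h => Set.disjoint_left.1 hPQ hy h, hy']
    · filter_upwards [hQo.mem_nhds hx, hS.locConst x (hEV (hQE hx))] with y hy hy'
      show σ' y = σ' x
      rw [hσQ x hx, hσQ y hy, hy']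
  · rintro x ((hx | hx) | ⟨hx, hx'⟩)
    · show LocallyAffineAt u' x (scaleCols A _ (σ' x))
      rw [hσn x fun h => hx.2 (hQE h).2]
      convert (hS.affine x hx.1).add_smul (h := h) (j := k) (s := 0) ?_ hu'v using 1
      · ext a b
        by_cases hbk : b = k
        · subst hbk
          simp [scaleCols, Matrix.vecMulVec_apply, hx.2]
        · simp [scaleCols, Matrix.vecMulVec_apply, hbk]
      · filter_upwards [hoff.mem_nhds hx] with y hy
        rw [hz x fun h => hx.2 h.2, hz y fun h => hy.2 h.2]; ring
    · show LocallyAffineAt u' x (scaleCols A _ (σ' x))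
      rw [hσn x fun h => Set.disjoint_left.1 hPQ hx h]
      exact hP' x hx
    · show LocallyAffineAt u' x (scaleCols A _ (σ' x))
      rw [hσQ x hx]
      exact hQ' x hx _ fun b hb => by simp [hb]
  · refine ⟨hlip, fun x => (hb x).1, fun x => (hb x).2, fun x hx => hz x fun h => hx (hEV h),
      fun x a => rfl, ?_, hQo.inter (hS.isOpen_sep fun s => s.card < 3), hNo, fun x hx => hx.2.1,
      hNE.trans hEV, ?_, ?_, ?_, ?_, ?_, ?_, ?_, hpair⟩
    · rintro x ((hx | hx) | hx)
      · exact hx.1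
      · exact hEV (hPE hx)
      · exact hEV (hQE hx.1)
    · rw [Set.disjoint_left]
      rintro x ⟨hx, hx'⟩ ((hy | hy) | hy)
      · exact hy.2 (hQE hx).2
      · exact Set.disjoint_left.1 hPQ hy hx
      · exact absurd hy.2.2 (not_le.2 hx'.2)
    · rw [Set.disjoint_left]
      rintro x hx ((hy | hy) | hy)
      · exact hy.2 (hNE hx).2
      · exact Set.disjoint_left.1 hPN hy hx
      · exact Set.disjoint_left.1 hQN hy.1 hx
    · refine measure_mono_null ?_ hnull
      rintro x ⟨hxV, hx⟩
      simp only [mem_union, not_or] at hx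
      by_cases hk : k ∈ S.σ x
      · refine ⟨⟨hxV, hk⟩, ?_⟩
        rintro ((hxP | hxQ) | hxN)
        · exact hx.1.1 (Or.inl (Or.inr hxP))
        · by_cases h3 : 3 ≤ (S.σ x).card
          · exact hx.1.1 (Or.inr ⟨hxQ, hxV, h3⟩)
          · exact hx.1.2 ⟨hxQ, hxV, not_le.1 h3⟩
        · exact hx.2 hxN
      · exact absurd (Or.inl (Or.inl ⟨hxV, hk⟩)) hx.1.1
    · intro x hx
      refine ⟨_, hQ' x hx.1 w fun _ _ => rfl, (rank_scaleCols_le _ _ _).trans ?_, fun a b => ?_⟩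
      · rw [Finset.card_erase_of_mem (hQE hx.1).2]
        have := hx.2.2
        omega
      · simp only [scaleCols, Matrix.of_apply]
        split_ifs
        · exact le_add_of_nonneg_right (abs_nonneg _)
        · rw [abs_zero]; positivity
    · intro x hx
      obtain ⟨j, s, hs, hxs⟩ := hN x hx
      refine ⟨_, (hS.affine x (hEV (hNE hx))).add_smul hxs hu'v, fun a b => ?_⟩
      rw [Matrix.add_apply]
      refine (abs_add_le _ _).trans (add_le_add ?_ ?_)
      · simp only [scaleCols, Matrix.of_apply]
        split_ifs
        · exact le_rfl
        · rw [abs_zero]; positivity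
      · rw [Matrix.vecMulVec_apply, abs_mul]
        refine mul_le_of_le_one_right (abs_nonneg _) ?_
        rw [Pi.single_apply]
        split_ifs
        · exact hs.le
        · simp
    · exact hNvol.trans (by gcongr)
    · intro l
      have h1 : (Stage.mk u' V' σ').pair k l ⊆ P ∩ S.pair k l := by
        intro x hx
        refine ⟨?_, hpair k l hx⟩
        obtain ⟨hxV, hxk, -⟩ := hx
        rcases hxV with (hy | hy) | hy
        · exact absurd (hσsub x hxk) hy.2
        · exact hy
        · change k ∈ σ' x at hxk
          rw [hσQ x hy.1] at hxk
          simp at hxk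
      refine (measure_mono h1).trans (hhalf _ (fun x hx => ⟨hx.1, hx.2.1⟩)
        (hS.isOpen_sep fun s => k ∈ s ∧ l ∈ s) ?_)
      convert hS.isOpen_sep (fun s => k ∈ s ∧ l ∉ s) using 1
      ext x
      constructor
      · rintro ⟨⟨h1, h2⟩, h3⟩
        exact ⟨h1, h2, fun h4 => h3 ⟨h1, h2, h4⟩⟩
      · rintro ⟨h1, h2, h3⟩
        exact ⟨⟨h1, h2⟩, fun h4 => h3 h4.2.2⟩

end Stage

/-- The matrix of partial derivatives of `u` at `x`. -/
def grad [DecidableEq ι] [Fintype ι] (u : (ι → ℝ) → κ → ℝ) (x : ι → ℝ) : Matrix κ ι ℝ :=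
  Matrix.of fun a i => lineDeriv ℝ (fun y => u y a) x (Pi.single i 1)

theorem LocallyAffineAt.grad_eq [Fintype ι] [DecidableEq ι] {u : (ι → ℝ) → κ → ℝ} {x : ι → ℝ}
    {B : Matrix κ ι ℝ} (hu : LocallyAffineAt u x B) : grad u x = B := by
  ext a i
  have hc : Tendsto (fun t : ℝ => x + t • (Pi.single i 1 : ι → ℝ)) (𝓝 0) (𝓝 x) := by
    have : Continuous fun t : ℝ => x + t • (Pi.single i 1 : ι → ℝ) := by fun_prop
    simpa using this.tendsto 0
  refine HasDerivAt.deriv (f := fun t : ℝ => u (x + t • (Pi.single i 1 : ι → ℝ)) a) ?_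
  have h1 : HasDerivAt (fun t : ℝ => u x a + t * B a i) (B a i) 0 := by
    simpa using ((hasDerivAt_id (0 : ℝ)).mul_const (B a i)).const_add (u x a)
  refine h1.congr_of_eventuallyEq ?_
  filter_upwards [hc.eventually hu] with t ht
  rw [ht, add_sub_cancel_left, Matrix.mulVec_smul, Matrix.mulVec_single_one]
  simp

theorem LocallyAffineAt.eventually [Fintype ι] {u : (ι → ℝ) → κ → ℝ} {x : ι → ℝ}
    {B : Matrix κ ι ℝ} (hu : LocallyAffineAt u x B) : ∀ᶠ y in 𝓝 x, LocallyAffineAt u y B := by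
  filter_upwards [eventually_eventually_nhds.2 hu] with y hy
  filter_upwards [hy] with z hz
  rw [hz, hy.self_of_nhds, add_assoc, ← Matrix.mulVec_add]
  congr 2; abel

theorem LocallyAffineAt.congr [Fintype ι] {u u' : (ι → ℝ) → κ → ℝ} {x : ι → ℝ}
    {B : Matrix κ ι ℝ} (hu : LocallyAffineAt u x B) (h : ∀ᶠ y in 𝓝 x, u' y = u y) :
    LocallyAffineAt u' x B := by
  filter_upwards [hu, h] with y hy hy'
  rw [hy', hy, h.self_of_nhds]

/-- A locally affine map is affine on preconnected open sets. -/
theorem isAffineOn_of_locallyAffineAt [Fintype ι] {u : (ι → ℝ) → κ → ℝ}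
    {V : Set (ι → ℝ)} (hVo : IsOpen V) (hV : IsPreconnected V)
    (hu : ∀ x ∈ V, ∃ B, LocallyAffineAt u x B) : IsAffineOn u V := by
  classical
  rcases V.eq_empty_or_nonempty with rfl | ⟨x₀, hx₀⟩
  · exact ⟨0, 0, fun x hx => hx.elim⟩
  obtain ⟨B, hB⟩ := hu x₀ hx₀
  set Z : Set (ι → ℝ) := {y ∈ V | LocallyAffineAt u y B ∧ u y = u x₀ + B.mulVec (y - x₀)} with hZ
  have hZo : IsOpen Z := by
    rw [isOpen_iff_eventually]
    rintro y ⟨hyV, hy, hy'⟩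
    filter_upwards [hVo.mem_nhds hyV, hy.eventually, hy] with z hz hz1 hz2
    refine ⟨hz, hz1, ?_⟩
    rw [hz2, hy', add_assoc, ← Matrix.mulVec_add]
    congr 2; abel
  have hZo' : IsOpen (V \ Z) := by
    rw [isOpen_iff_eventually]
    rintro y ⟨hyV, hy⟩
    obtain ⟨B', hB'⟩ := hu y hyV
    filter_upwards [hVo.mem_nhds hyV, hB'.eventually, hB'] with z hz hz1 hz2
    refine ⟨hz, fun hzZ => hy ?_⟩
    have hBB : B' = B := by rw [← hz1.grad_eq, hzZ.2.1.grad_eq]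
    subst hBB
    refine ⟨hyV, hB', ?_⟩
    have h1 := hzZ.2.2
    rw [hz2] at h1
    have h2 : u y = u x₀ + B'.mulVec (z - x₀) - B'.mulVec (z - y) := eq_sub_of_add_eq h1
    rw [h2, add_sub_assoc, ← Matrix.mulVec_sub]
    congr 2; abel
  have hVZ : V ⊆ Z := hV.subset_left_of_subset_union hZo hZo' disjoint_sdiff_right
    (by rw [union_sdiff_cancel fun x hx => hx.1])
    ⟨x₀, hx₀, hx₀, hB, by simp⟩
  refine ⟨B, u x₀ - B.mulVec x₀, fun x hx => ?_⟩
  rw [(hVZ hx).2.2, Matrix.mulVec_sub]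
  ext a
  simp only [lmap, Pi.add_apply, Pi.sub_apply, Matrix.mulVec, dotProduct]
  ring

/-- A map that is locally affine almost everywhere is piecewise affine. -/
theorem isPiecewiseAffineOn_of_ae [Fintype ι] {u : (ι → ℝ) → κ → ℝ} {Ω : Set (ι → ℝ)}
    (hΩ : IsOpen Ω) (hu : volume {x ∈ Ω | ¬ ∃ B, LocallyAffineAt u x B} = 0) :
    IsPiecewiseAffineOn u Ω := by
  set O : Set (ι → ℝ) := {x ∈ Ω | ∃ B, LocallyAffineAt u x B} with hO
  have hOo : IsOpen O := by
    rw [isOpen_iff_eventually]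
    rintro x ⟨hx, B, hB⟩
    filter_upwards [hΩ.mem_nhds hx, hB.eventually] with y hy hy'
    exact ⟨hy, B, hy'⟩
  obtain ⟨T, r, hTc, hT, hTd, hnull⟩ := exists_box_cover O hOo (fun _ => 1) fun _ => one_pos
  refine ⟨(fun c => box ((fun _ => 1) * c) (r c • fun _ => 1)) '' T, hTc.image _, ?_, ?_, ?_⟩
  · rintro V ⟨c, hc, rfl⟩
    have hsub := (hT c hc).2.2
    have hconv := convex_box ((fun _ => 1) * c) (r c • fun _ => (1 : ℝ))
    refine ⟨⟨isOpen_box _ _, ?_, ⟨⟨(fun _ => 1) * c, fun j => ?_⟩, hconv.isPreconnected⟩,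
      hconv.addHaar_frontier _⟩, fun x hx => (hsub hx).1,
      isAffineOn_of_locallyAffineAt (isOpen_box _ _) hconv.isPreconnected fun x hx => (hsub hx).2⟩
    · simp only [box_eq_pi]
      exact Bornology.IsBounded.pi fun _ => Metric.isBounded_Ioo _ _
    · simpa using (hT c hc).1
  · rintro V ⟨c, hc, rfl⟩ V' ⟨c', hc', rfl⟩ hne
    exact hTd hc hc' fun h => hne (by rw [h])
  · refine measure_mono_null ?_ (measure_union_null hu hnull)
    rintro x ⟨hx, hx'⟩
    by_cases hxO : ∃ B, LocallyAffineAt u x B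
    · right
      refine ⟨⟨hx, hxO⟩, ?_⟩
      rwa [sUnion_image] at hx'
    · left; exact ⟨hx, hxO⟩

/-- An infinite sequence of successive steps, starting with the affine map `lmap A b` on `Ω`. -/
structure IsCascade [Fintype ι] [DecidableEq ι] [Fintype κ] (A : Matrix κ ι ℝ) (b : κ → ℝ)
    (Ω : Set (ι → ℝ)) (w : ℕ → ι → ℝ) (k : ℕ → ι) (δ : ℕ → ℝ) (S : ℕ → Stage ι κ)
    (h : ℕ → (ι → ℝ) → ℝ) (D N : ℕ → Set (ι → ℝ)) : Prop where
  zero_u : (S 0).u = lmap A b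
  zero_V : (S 0).V = Ω
  valid : ∀ j, (S j).Valid A (w j)
  step : ∀ j, Stage.IsStep A (w j) (k j) (δ j) (S j) (S (j + 1)) (h j) (D j) (N j)

theorem exists_isCascade [Fintype ι] [DecidableEq ι] [Fintype κ] (A : Matrix κ ι ℝ) (b : κ → ℝ)
    {Ω : Set (ι → ℝ)} (hΩ : IsOpen Ω) (w : ℕ → ι → ℝ) (k : ℕ → ι) (δ : ℕ → ℝ)
    (hι : 2 ≤ Fintype.card ι) (hδ : ∀ j, 0 < δ j) (hw0 : w 0 = 1)
    (hw : ∀ j, w (j + 1) = Function.update (w j) (k j) (2 * w j (k j))) :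
    ∃ S h D N, IsCascade A b Ω w k δ S h D N := by
  have hS0 : Stage.Valid A (w 0) (⟨lmap A b, Ω, fun _ => Finset.univ⟩ : Stage ι κ) := by
    refine ⟨hΩ, fun x _ => by simpa using hι, fun x _ => Eventually.of_forall fun _ => rfl,
      fun x _ => Eventually.of_forall fun y => ?_⟩
    ext a
    simp only [lmap, scaleCols, hw0, Matrix.mulVec, dotProduct, Pi.add_apply, Finset.mem_univ,
      if_true, Pi.one_apply, one_mul, Matrix.of_apply, Pi.sub_apply, mul_sub,
      Finset.sum_sub_distrib]
    ring
  have hstep : ∀ j (S : {S : Stage ι κ // S.Valid A (w j)}),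
      ∃ S' : {S : Stage ι κ // S.Valid A (w (j + 1))}, ∃ h D N,
        Stage.IsStep A (w j) (k j) (δ j) S.1 S'.1 h D N := by
    rintro j ⟨S, hS⟩
    obtain ⟨S', h, D, N, hS', hs⟩ := hS.exists_step (k j) (δ j) (hδ j)
    exact ⟨⟨S', by rwa [hw]⟩, h, D, N, hs⟩
  choose next h D N hn using hstep
  let S : ∀ j, {S : Stage ι κ // S.Valid A (w j)} := fun j => Nat.rec ⟨_, hS0⟩ next j
  exact ⟨fun j => (S j).1, fun j => h j (S j), fun j => D j (S j), fun j => N j (S j), rfl, rfl,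
    fun j => (S j).2, fun j => hn j (S j)⟩

namespace IsCascade

variable [Fintype ι] [DecidableEq ι] [Fintype κ] {A : Matrix κ ι ℝ} {b : κ → ℝ}
    {Ω : Set (ι → ℝ)} {w : ℕ → ι → ℝ} {k : ℕ → ι} {δ : ℕ → ℝ} {S : ℕ → Stage ι κ}
    {h : ℕ → (ι → ℝ) → ℝ} {D N : ℕ → Set (ι → ℝ)}

theorem antitone_V (hc : IsCascade A b Ω w k δ S h D N) : Antitone fun j => (S j).V :=
  antitone_nat_of_succ_le fun j => (hc.step j).subset

theorem V_subset (hc : IsCascade A b Ω w k δ S h D N) (j : ℕ) : (S j).V ⊆ Ω :=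
  hc.zero_V ▸ hc.antitone_V (Nat.zero_le j)

theorem volume_pair_le (hc : IsCascade A b Ω w k δ S h D N) (hw0 : w 0 = 1)
    (hw : ∀ j, w (j + 1) = Function.update (w j) (k j) (2 * w j (k j)))
    (j : ℕ) {i l : ι} (hil : i ≠ l) :
    volume ((S j).pair i l) ≤ ENNReal.ofReal ((w j i * w j l)⁻¹) * volume Ω := by
  have hcomm : ∀ (S : Stage ι κ) i l, S.pair i l = S.pair l i := fun S i l => by
    ext x; simp only [Stage.pair]; constructor <;> rintro ⟨h1, h2, h3⟩ <;> exact ⟨h1, h3, h2⟩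
  induction j with
  | zero =>
    rw [hw0]
    simp only [Pi.one_apply, mul_one, inv_one, ENNReal.ofReal_one, one_mul]
    exact measure_mono fun x hx => hc.V_subset 0 hx.1
  | succ j ih =>
    have half : ∀ m, m ≠ k j → volume ((S j).pair (k j) m)
        ≤ ENNReal.ofReal ((w j (k j) * w j m)⁻¹) * volume Ω →
        volume ((S (j + 1)).pair (k j) m)
          ≤ ENNReal.ofReal ((2 * w j (k j) * w j m)⁻¹) * volume Ω := fun m hm hv => by
      refine ((hc.step j).volume_pair m).trans ((mul_le_mul_right hv _).trans (le_of_eq ?_))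
      rw [← mul_assoc, ← ENNReal.ofReal_mul (by norm_num)]
      congr 2
      rw [mul_assoc, mul_inv 2]; norm_num
    by_cases hi : k j = i
    · subst hi
      have := half l hil.symm ih
      rwa [hw, Function.update_self, Function.update_of_ne hil.symm]
    · by_cases hl : k j = l
      · subst hl
        have := half i hil (by rw [hcomm, mul_comm (w j (k j))]; exact ih)
        rwa [hw, Function.update_self, Function.update_of_ne hil, hcomm, mul_comm (w j i)]
      · rw [hw, Function.update_of_ne (Ne.symm hi), Function.update_of_ne (Ne.symm hl)]
        exact (measure_mono ((hc.step j).pair_subset i l)).trans ih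

theorem volume_V_le (hc : IsCascade A b Ω w k δ S h D N) (hw0 : w 0 = 1)
    (hw : ∀ j, w (j + 1) = Function.update (w j) (k j) (2 * w j (k j)))
    (j : ℕ) {β : ℝ} (hβ : 0 < β) (hle : ∀ i, β ≤ w j i) :
    volume (S j).V ≤ ENNReal.ofReal (Fintype.card ι ^ 2 * (β ^ 2)⁻¹) * volume Ω := by
  have hsub : (S j).V ⊆ ⋃ p ∈ (Finset.univ : Finset ι).offDiag, (S j).pair p.1 p.2 := by
    intro x hx
    obtain ⟨i, hi, l, hl, hil⟩ := Finset.one_lt_card.1 ((hc.valid j).two_le x hx)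
    refine mem_iUnion₂.2 ⟨(i, l), by simpa using hil, hx, hi, hl⟩
  refine (measure_mono hsub).trans ((measure_biUnion_finset_le _ _).trans ?_)
  calc ∑ p ∈ (Finset.univ : Finset ι).offDiag, volume ((S j).pair p.1 p.2)
      ≤ ∑ p ∈ (Finset.univ : Finset ι).offDiag, ENNReal.ofReal ((β ^ 2)⁻¹) * volume Ω := by
        refine Finset.sum_le_sum fun p hp => (hc.volume_pair_le hw0 hw j
          (by simpa using hp)).trans ?_
        gcongr
        rw [sq]
        exact mul_le_mul (hle _) (hle _) hβ.le (hβ.le.trans (hle _))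
    _ ≤ ENNReal.ofReal (Fintype.card ι ^ 2 * (β ^ 2)⁻¹) * volume Ω := by
        rw [Finset.sum_const, nsmul_eq_mul, ← mul_assoc, ENNReal.ofReal_mul (by positivity)]
        gcongr
        rw [Finset.offDiag_card, Finset.card_univ]
        rw [← Nat.cast_pow, ENNReal.ofReal_natCast, sq]
        exact_mod_cast Nat.sub_le _ _

end IsCascade

/-- The weights of a cyclic doubling schedule. -/
def wt (d j : ℕ) (i : Fin d) : ℝ := 2 ^ ((j + d - 1 - i) / d)

theorem wt_zero (d : ℕ) : wt d 0 = 1 := by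
  ext i
  have : (0 + d - 1 - i) / d = 0 := Nat.div_eq_of_lt (by omega)
  rw [wt, this, pow_zero, Pi.one_apply]

theorem wt_succ (d j : ℕ) (hd : 0 < d) :
    wt d (j + 1) = Function.update (wt d j) ⟨j % d, Nat.mod_lt j hd⟩
      (2 * wt d j ⟨j % d, Nat.mod_lt j hd⟩) := by
  have key : ∀ i : Fin d, (j + 1 + d - 1 - i) / d
      = (j + d - 1 - i) / d + if i.1 = j % d then 1 else 0 := fun i => by
    have h1 : j + 1 + d - 1 - i = (j + d - 1 - i) + 1 := by omega
    have h2 : d ∣ (j + d - 1 - i) + 1 ↔ i.1 = j % d := by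
      have h3 : (j + d - 1 - i) + 1 = d * (j / d) + (d + j % d - i) := by
        have := Nat.div_add_mod j d
        omega
      rw [h3, Nat.dvd_add_right (dvd_mul_right _ _)]
      have h4 := Nat.mod_lt j hd
      constructor
      · rintro ⟨c, hc⟩
        have hc1 : c = 1 := by
          rcases c with _ | _ | c
          · simp at hc; omega
          · rfl
          · have : d * (c + 1 + 1) = d * c + 2 * d := by ring
            have := Nat.zero_le (d * c)
            omega
        subst hc1; omega
      · intro h; rw [h]; simp
    rw [h1, Nat.succ_div]
    simp only [h2]
  ext i
  by_cases hi : i.1 = j % d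
  · have : i = ⟨j % d, Nat.mod_lt j hd⟩ := Fin.ext hi
    rw [this, Function.update_self, ← this]
    rw [wt, wt, key, if_pos hi, pow_succ']
  · rw [Function.update_of_ne (fun h => hi (by rw [h]))]
    simp only [wt, key, hi, if_false, add_zero]

theorem le_wt (d j : ℕ) (i : Fin d) : 2 ^ (j / d) ≤ wt d j i :=
  pow_le_pow_right₀ (by norm_num) (Nat.div_le_div_right (by omega))

theorem wt_le (d j : ℕ) (i : Fin d) : wt d j i ≤ 2 * 2 ^ (j / d) := by
  rw [wt, ← pow_succ']
  refine pow_le_pow_right₀ (by norm_num) ?_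
  rw [← Nat.add_div_right j i.pos]
  exact Nat.div_le_div_right (by omega)

/-- Quantitative control of the parameters of a cascade: `K j` bounds the gradient entries at
step `j`. -/
structure IsTame (A : Matrix κ ι ℝ) (w : ℕ → ι → ℝ) (k : ℕ → ι) (δ : ℕ → ℝ) (K : ℕ → ℝ)
    (α : ℝ) : Prop where
  pos : ∀ j, 0 < δ j
  le_one : ∀ j, δ j ≤ 1
  nonneg : ∀ j, 0 ≤ K j
  entry_le : ∀ j a i, |w j i * A a i| + |w j (k j) * A a (k j)| ≤ K j
  mul_rpow_le : ∀ j, K j * δ j ^ (1 - α) ≤ (1 / 2) ^ j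

theorem IsTame.abs_coeff_le {A : Matrix κ ι ℝ} {w : ℕ → ι → ℝ} {k : ℕ → ι} {δ : ℕ → ℝ}
    {K : ℕ → ℝ} {α : ℝ} (ht : IsTame A w k δ K α) (j : ℕ) (a : κ) :
    |w j (k j) * A a (k j)| ≤ K j :=
  (le_add_of_nonneg_left (abs_nonneg _)).trans (ht.entry_le j a (k j))

theorem continuous_lmap [Fintype ι] (A : Matrix κ ι ℝ) (b : κ → ℝ) (a : κ) :
    Continuous fun x => lmap A b x a := by
  unfold lmap; fun_prop

theorem exists_lipschitzWith_lmap [Fintype ι] (A : Matrix κ ι ℝ) (b : κ → ℝ) (a : κ) :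
    ∃ C, LipschitzWith C fun x => lmap A b x a := by
  let L : (ι → ℝ) →L[ℝ] ℝ := ∑ i, A a i • ContinuousLinearMap.proj i
  have hL : (fun x => lmap A b x a) = fun x => L x + b a := by
    ext x; simp [L, lmap]
  rw [hL]
  exact ⟨_, L.lipschitz.add (LipschitzWith.const _)⟩

namespace IsCascade

/-- The limit map of a cascade. -/
def limit [Fintype ι] (A : Matrix κ ι ℝ) (b : κ → ℝ) (w : ℕ → ι → ℝ) (k : ℕ → ι)
    (h : ℕ → (ι → ℝ) → ℝ) (x : ι → ℝ) (a : κ) : ℝ :=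
  lmap A b x a + ∑' j, w j (k j) * A a (k j) * h j x

variable [Fintype ι] [DecidableEq ι] [Fintype κ] {A : Matrix κ ι ℝ} {b : κ → ℝ}
    {Ω : Set (ι → ℝ)} {w : ℕ → ι → ℝ} {k : ℕ → ι} {δ : ℕ → ℝ} {S : ℕ → Stage ι κ}
    {h : ℕ → (ι → ℝ) → ℝ} {D N : ℕ → Set (ι → ℝ)} {K : ℕ → ℝ} {α : ℝ}

theorem u_eq (hc : IsCascade A b Ω w k δ S h D N) (j : ℕ) (x : ι → ℝ) (a : κ) :
    (S j).u x a = lmap A b x a + ∑ i ∈ Finset.range j, w i (k i) * A a (k i) * h i x := by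
  induction j with
  | zero => simp [hc.zero_u]
  | succ j ih => rw [(hc.step j).u_eq, ih, Finset.sum_range_succ, add_assoc]

theorem limit_eq_of_notMem (hc : IsCascade A b Ω w k δ S h D N) {j : ℕ} {x : ι → ℝ}
    (hx : x ∉ (S j).V) : limit A b w k h x = (S j).u x := by
  ext a
  rw [hc.u_eq, limit, tsum_eq_sum]
  intro i hi
  rw [(hc.step i).eq_zero x fun h' => hx (hc.antitone_V (by simpa using hi) h'), mul_zero]

theorem exists_locallyAffineAt_done (hc : IsCascade A b Ω w k δ S h D N) {i : ℕ} {x : ι → ℝ}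
    (hx : x ∈ D i) : ∃ B, LocallyAffineAt (limit A b w k h) x B ∧ B.rank ≤ 1 ∧
      (∀ a l, |B a l| ≤ |w i l * A a l| + |w i (k i) * A a (k i)|) ∧
      ∀ j, i < j → LocallyAffineAt (S j).u x B := by
  obtain ⟨B, hB, hr, hb⟩ := (hc.step i).done_affine x hx
  have hnear : ∀ᶠ y in 𝓝 x, ∀ j, i < j → y ∉ (S j).V := by
    filter_upwards [(hc.step i).isOpen_done.mem_nhds hx] with y hy j hj hyV
    exact disjoint_left.1 (hc.step i).done_disj hy (hc.antitone_V hj hyV)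
  have hl : LocallyAffineAt (limit A b w k h) x B := hB.congr <| by
    filter_upwards [hnear] with y hy
    exact hc.limit_eq_of_notMem (hy _ i.lt_succ_self)
  refine ⟨B, hl, hr, hb, fun j hj => hl.congr ?_⟩
  filter_upwards [hnear] with y hy
  exact (hc.limit_eq_of_notMem (hy j hj)).symm

theorem exists_locallyAffineAt_err (hc : IsCascade A b Ω w k δ S h D N) {i : ℕ} {x : ι → ℝ}
    (hx : x ∈ N i) : ∃ B, LocallyAffineAt (limit A b w k h) x B ∧
      (∀ a l, |B a l| ≤ |w i l * A a l| + |w i (k i) * A a (k i)|) ∧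
      ∀ j, i < j → LocallyAffineAt (S j).u x B := by
  obtain ⟨B, hB, hb⟩ := (hc.step i).err_affine x hx
  have hnear : ∀ᶠ y in 𝓝 x, ∀ j, i < j → y ∉ (S j).V := by
    filter_upwards [(hc.step i).isOpen_err.mem_nhds hx] with y hy j hj hyV
    exact disjoint_left.1 (hc.step i).err_disj hy (hc.antitone_V hj hyV)
  have hl : LocallyAffineAt (limit A b w k h) x B := hB.congr <| by
    filter_upwards [hnear] with y hy
    exact hc.limit_eq_of_notMem (hy _ i.lt_succ_self)
  refine ⟨B, hl, hb, fun j hj => hl.congr ?_⟩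
  filter_upwards [hnear] with y hy
  exact (hc.limit_eq_of_notMem (hy j hj)).symm

theorem exists_locallyAffineAt (hc : IsCascade A b Ω w k δ S h D N) (ht : IsTame A w k δ K α)
    {i : ℕ} {x : ι → ℝ} (hx : x ∈ D i ∪ N i) :
    ∃ B, LocallyAffineAt (limit A b w k h) x B ∧ (∀ a l, |B a l| ≤ K i) ∧
      ∀ j, i < j → LocallyAffineAt (S j).u x B := by
  rcases hx with hx | hx
  · obtain ⟨B, h1, -, h2, h3⟩ := hc.exists_locallyAffineAt_done hx
    exact ⟨B, h1, fun a l => (h2 a l).trans (ht.entry_le i a l), h3⟩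
  · obtain ⟨B, h1, h2, h3⟩ := hc.exists_locallyAffineAt_err hx
    exact ⟨B, h1, fun a l => (h2 a l).trans (ht.entry_le i a l), h3⟩

theorem mem_V (hc : IsCascade A b Ω w k δ S h D N) {i : ℕ} {x : ι → ℝ} (hx : x ∈ D i ∪ N i) :
    x ∈ (S i).V :=
  hx.elim (fun h => (hc.step i).done_subset h) fun h => (hc.step i).err_subset h

theorem ae_exists_mem (hc : IsCascade A b Ω w k δ S h D N)
    (hV : Tendsto (fun j => volume (S j).V) atTop (𝓝 0)) :
    ∀ᵐ x, x ∈ Ω → ∃ i, x ∈ D i ∪ N i := by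
  have h1 : ∀ᵐ x, ∀ j, x ∉ (S j).V \ ((S (j + 1)).V ∪ D j ∪ N j) :=
    ae_all_iff.2 fun j => measure_eq_zero_iff_ae_notMem.1 (hc.step j).null
  have h2 : ∀ᵐ x, x ∉ ⋂ j, (S j).V := measure_eq_zero_iff_ae_notMem.1 <|
    le_antisymm (ge_of_tendsto hV (Eventually.of_forall fun j =>
      measure_mono (iInter_subset _ j))) zero_le
  filter_upwards [h1, h2] with x hx1 hx2 hxΩ
  by_contra! hno
  refine hx2 (mem_iInter.2 fun j => ?_)
  induction j with
  | zero => rwa [hc.zero_V]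
  | succ j ih =>
    by_contra hj
    refine hx1 j ⟨ih, ?_⟩
    rw [union_assoc]
    rintro (h | h)
    exacts [hj h, hno j h]

theorem isPiecewiseAffineOn_limit (hc : IsCascade A b Ω w k δ S h D N)
    (ht : IsTame A w k δ K α) (hΩ : IsOpen Ω)
    (hV : Tendsto (fun j => volume (S j).V) atTop (𝓝 0)) :
    IsPiecewiseAffineOn (limit A b w k h) Ω := by
  refine isPiecewiseAffineOn_of_ae hΩ (measure_eq_zero_iff_ae_notMem.2 ?_)
  filter_upwards [hc.ae_exists_mem hV] with x hx
  rintro ⟨hxΩ, hno⟩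
  obtain ⟨i, hi⟩ := hx hxΩ
  obtain ⟨B, hB, -⟩ := hc.exists_locallyAffineAt ht hi
  exact hno ⟨B, hB⟩

theorem limit_eq_lmap (hc : IsCascade A b Ω w k δ S h D N) {x : ι → ℝ} (hx : x ∉ Ω) :
    limit A b w k h x = lmap A b x := by
  rw [← hc.zero_u]
  exact hc.limit_eq_of_notMem (by rwa [hc.zero_V])

theorem abs_term_le (hc : IsCascade A b Ω w k δ S h D N) (ht : IsTame A w k δ K α)
    (hα : α ∈ Ioo (0 : ℝ) 1) (j : ℕ) (x : ι → ℝ) (a : κ) :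
    ‖w j (k j) * A a (k j) * h j x‖ ≤ (1 / 2) ^ j := by
  rw [norm_mul, Real.norm_eq_abs, Real.norm_eq_abs, abs_of_nonneg ((hc.step j).nonneg x)]
  calc |w j (k j) * A a (k j)| * h j x ≤ K j * δ j ^ (1 - α) := by
        refine mul_le_mul (ht.abs_coeff_le j a) (((hc.step j).le x).trans ?_)
          ((hc.step j).nonneg x) (ht.nonneg j)
        exact Real.self_le_rpow_of_le_one (ht.pos j).le (ht.le_one j) (by linarith [hα.1])
    _ ≤ _ := ht.mul_rpow_le j

theorem summable_term (hc : IsCascade A b Ω w k δ S h D N) (ht : IsTame A w k δ K α)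
    (hα : α ∈ Ioo (0 : ℝ) 1) (x : ι → ℝ) (a : κ) :
    Summable fun j => w j (k j) * A a (k j) * h j x :=
  Summable.of_norm_bounded summable_geometric_two fun j => hc.abs_term_le ht hα j x a

theorem continuous_limit (hc : IsCascade A b Ω w k δ S h D N) (ht : IsTame A w k δ K α)
    (hα : α ∈ Ioo (0 : ℝ) 1) : Continuous (limit A b w k h) :=
  continuous_pi fun a => (continuous_lmap A b a).add <|
    continuous_tsum (fun j => continuous_const.mul (hc.step j).lipschitz.continuous)
      summable_geometric_two fun j x => hc.abs_term_le ht hα j x a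

theorem tendsto_u (hc : IsCascade A b Ω w k δ S h D N) (ht : IsTame A w k δ K α)
    (hα : α ∈ Ioo (0 : ℝ) 1) (x : ι → ℝ) (a : κ) :
    Tendsto (fun j => (S j).u x a) atTop (𝓝 (limit A b w k h x a)) := by
  simp only [hc.u_eq]
  exact (hc.summable_term ht hα x a).hasSum.tendsto_sum_nat.const_add _

theorem abs_u_le (hc : IsCascade A b Ω w k δ S h D N) (ht : IsTame A w k δ K α)
    (hα : α ∈ Ioo (0 : ℝ) 1) (j : ℕ) (x : ι → ℝ) (a : κ) :
    |(S j).u x a| ≤ |lmap A b x a| + 2 := by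
  rw [hc.u_eq]
  refine (abs_add_le _ _).trans (add_le_add le_rfl ?_)
  refine (Finset.abs_sum_le_sum_abs _ _).trans ?_
  refine (Finset.sum_le_sum fun i _ => hc.abs_term_le ht hα i x a).trans ?_
  refine (summable_geometric_two.sum_le_tsum _ fun i _ => by positivity).trans ?_
  exact tsum_geometric_two.le

theorem exists_lipschitzWith_u (hc : IsCascade A b Ω w k δ S h D N) (j : ℕ) (a : κ) :
    ∃ C, LipschitzWith C fun x => (S j).u x a := by
  induction j with
  | zero => rw [hc.zero_u]; exact exists_lipschitzWith_lmap A b a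
  | succ j ih =>
    obtain ⟨C, hC⟩ := ih
    have := hC.add ((ContinuousLinearMap.lipschitz
      ((w j (k j) * A a (k j)) • ContinuousLinearMap.id ℝ ℝ)).comp (hc.step j).lipschitz)
    simp only [(hc.step j).u_eq]
    exact ⟨_, this⟩

theorem memHolder_limit (hc : IsCascade A b Ω w k δ S h D N) (ht : IsTame A w k δ K α)
    (hα : α ∈ Ioo (0 : ℝ) 1) (hΩ : Bornology.IsBounded Ω) :
    MemHolder α (closure Ω) (limit A b w k h) := by
  refine ⟨(hc.continuous_limit ht hα).continuousOn, ?_⟩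
  choose C hC using exists_lipschitzWith_lmap A b
  set R := Metric.diam (closure Ω) with hR
  set L : ℝ := ∑ a, (C a : ℝ)
  refine ⟨L * R ^ (1 - α) + 2, fun x hx y hy => ?_⟩
  have hdR : dist x y ≤ R := Metric.dist_le_diam_of_mem hΩ.closure hx hy
  have hL : 0 ≤ L := Finset.sum_nonneg fun a _ => NNReal.coe_nonneg _
  have h1α : 0 < 1 - α := by linarith [hα.2]
  have interp : ∀ s m : ℝ, 0 ≤ s → s ≤ m → s ≤ dist x y →
      s ≤ m ^ (1 - α) * dist x y ^ α := fun s m hs hm hd => by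
    calc s = s ^ (1 - α) * s ^ α := by
          rcases hs.eq_or_lt with rfl | hs'
          · rw [Real.zero_rpow hα.1.ne', mul_zero]
          · rw [← Real.rpow_add hs', sub_add_cancel, Real.rpow_one]
      _ ≤ m ^ (1 - α) * dist x y ^ α := by
          have := hα.1
          have := hs.trans hm
          gcongr
  have hR0 : 0 ≤ R := Metric.diam_nonneg
  refine (dist_pi_le_iff (by positivity)).2 fun a => ?_
  have h1 : dist (lmap A b x a) (lmap A b y a) ≤ L * R ^ (1 - α) * dist x y ^ α := by
    refine ((hC a).dist_le_mul x y).trans ?_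
    rw [mul_assoc]
    refine mul_le_mul ?_ (interp _ _ dist_nonneg hdR le_rfl) dist_nonneg hL
    exact Finset.single_le_sum (f := fun a => (C a : ℝ)) (fun a _ => NNReal.coe_nonneg _)
      (Finset.mem_univ a)
  have h2 : dist (∑' j, w j (k j) * A a (k j) * h j x) (∑' j, w j (k j) * A a (k j) * h j y)
      ≤ 2 * dist x y ^ α := by
    rw [dist_eq_norm, ← (hc.summable_term ht hα x a).tsum_sub (hc.summable_term ht hα y a)]
    refine tsum_of_norm_bounded (hasSum_geometric_two.mul_right (dist x y ^ α)) fun j => ?_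
    rw [← mul_sub, norm_mul, Real.norm_eq_abs, Real.norm_eq_abs]
    have hd : |h j x - h j y| ≤ δ j ^ (1 - α) * dist x y ^ α := by
      refine interp _ _ (abs_nonneg _) ?_ ?_
      · have := (hc.step j).nonneg x
        have := (hc.step j).nonneg y
        have := (hc.step j).le x
        have := (hc.step j).le y
        exact abs_le.2 ⟨by linarith, by linarith⟩
      · simpa [Real.dist_eq] using (hc.step j).lipschitz.dist_le_mul x y
    calc |w j (k j) * A a (k j)| * |h j x - h j y|
        ≤ K j * (δ j ^ (1 - α) * dist x y ^ α) :=
          mul_le_mul (ht.abs_coeff_le j a) hd (abs_nonneg _) (ht.nonneg j)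
      _ = K j * δ j ^ (1 - α) * dist x y ^ α := by ring
      _ ≤ (1 / 2) ^ j * dist x y ^ α := by gcongr; exact ht.mul_rpow_le j
  calc dist (limit A b w k h x a) (limit A b w k h y a) ≤ _ := dist_add_add_le _ _ _ _
    _ ≤ _ := add_le_add h1 h2
    _ = _ := by ring

end IsCascade

namespace IsCascade

variable [Fintype ι] [DecidableEq ι] [Fintype κ] {A : Matrix κ ι ℝ} {b : κ → ℝ}
    {Ω : Set (ι → ℝ)} {w : ℕ → ι → ℝ} {k : ℕ → ι} {δ : ℕ → ℝ} {S : ℕ → Stage ι κ}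
    {h : ℕ → (ι → ℝ) → ℝ} {D N : ℕ → Set (ι → ℝ)} {K : ℕ → ℝ} {α : ℝ}

/-- Summing the gradient bounds over the live sets dominates all the gradients of a cascade. -/
def dom (S : ℕ → Stage ι κ) (K : ℕ → ℝ) (x : ι → ℝ) : ENNReal :=
  ∑' i, (S i).V.indicator (fun _ => ENNReal.ofReal (K i)) x

theorem measurable_dom (hc : IsCascade A b Ω w k δ S h D N) : Measurable (dom S K) :=
  Measurable.tsum fun i => measurable_const.indicator (hc.valid i).isOpen.measurableSet

theorem lintegral_dom (hc : IsCascade A b Ω w k δ S h D N) :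
    ∫⁻ x, dom S K x = ∑' i, ENNReal.ofReal (K i) * volume (S i).V := by
  unfold dom
  rw [lintegral_tsum fun i =>
    (measurable_const.indicator (hc.valid i).isOpen.measurableSet).aemeasurable]
  refine tsum_congr fun i => ?_
  rw [lintegral_indicator (hc.valid i).isOpen.measurableSet, setLIntegral_const]

theorem integrable_dom (hc : IsCascade A b Ω w k δ S h D N)
    (hK : ∑' i, ENNReal.ofReal (K i) * volume (S i).V ≠ ⊤) :
    Integrable fun x => (dom S K x).toReal :=
  integrable_toReal_of_lintegral_ne_top hc.measurable_dom.aemeasurable (by rwa [hc.lintegral_dom])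

theorem ae_le_dom (hc : IsCascade A b Ω w k δ S h D N)
    (hK : ∑' i, ENNReal.ofReal (K i) * volume (S i).V ≠ ⊤) :
    ∀ᵐ x, ∀ i, x ∈ (S i).V → K i ≤ (dom S K x).toReal := by
  filter_upwards [ae_lt_top hc.measurable_dom (by rwa [hc.lintegral_dom])] with x hx i hi
  refine (ENNReal.ofReal_le_iff_le_toReal hx.ne).1 ?_
  have := ENNReal.le_tsum (f := fun i => (S i).V.indicator (fun _ => ENNReal.ofReal (K i)) x) i
  simpa [hi, dom] using this

theorem ae_abs_grad_limit_le (hc : IsCascade A b Ω w k δ S h D N) (ht : IsTame A w k δ K α)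
    (hV : Tendsto (fun j => volume (S j).V) atTop (𝓝 0))
    (hK : ∑' i, ENNReal.ofReal (K i) * volume (S i).V ≠ ⊤) :
    ∀ᵐ x, x ∈ Ω → ∀ a l, |grad (limit A b w k h) x a l| ≤ (dom S K x).toReal := by
  filter_upwards [hc.ae_le_dom hK, hc.ae_exists_mem hV] with x hx hx' hxΩ a l
  obtain ⟨i, hi⟩ := hx' hxΩ
  obtain ⟨B, hB, hb, -⟩ := hc.exists_locallyAffineAt ht hi
  rw [hB.grad_eq]
  exact (hb a l).trans (hx i (hc.mem_V hi))

theorem ae_abs_grad_u_le (hc : IsCascade A b Ω w k δ S h D N) (ht : IsTame A w k δ K α)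
    (hV : Tendsto (fun j => volume (S j).V) atTop (𝓝 0))
    (hK : ∑' i, ENNReal.ofReal (K i) * volume (S i).V ≠ ⊤) (j : ℕ) :
    ∀ᵐ x, x ∈ Ω → ∀ a l, |grad (S j).u x a l| ≤ (dom S K x).toReal := by
  filter_upwards [hc.ae_le_dom hK, hc.ae_exists_mem hV] with x hx hx' hxΩ a l
  obtain ⟨i, hi⟩ := hx' hxΩ
  rcases lt_or_ge i j with hij | hij
  · obtain ⟨B, -, hb, hB⟩ := hc.exists_locallyAffineAt ht hi
    rw [(hB j hij).grad_eq]
    exact (hb a l).trans (hx i (hc.mem_V hi))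
  · have hxj : x ∈ (S j).V := hc.antitone_V hij (hc.mem_V hi)
    rw [((hc.valid j).affine x hxj).grad_eq]
    refine le_trans ?_ (hx j hxj)
    rw [scaleCols, Matrix.of_apply]
    split_ifs
    · exact (le_add_of_nonneg_right (abs_nonneg _)).trans (ht.entry_le j a l)
    · rw [abs_zero]; exact ht.nonneg j

theorem ae_tendsto_grad (hc : IsCascade A b Ω w k δ S h D N) (ht : IsTame A w k δ K α)
    (hV : Tendsto (fun j => volume (S j).V) atTop (𝓝 0)) :
    ∀ᵐ x, x ∈ Ω → ∀ a l, Tendsto (fun j => grad (S j).u x a l) atTop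
      (𝓝 (grad (limit A b w k h) x a l)) := by
  filter_upwards [hc.ae_exists_mem hV] with x hx' hxΩ a l
  obtain ⟨i, hi⟩ := hx' hxΩ
  obtain ⟨B, hB, -, hB'⟩ := hc.exists_locallyAffineAt ht hi
  refine tendsto_const_nhds.congr' ?_
  filter_upwards [eventually_gt_atTop i] with j hj
  rw [hB.grad_eq, (hB' j hj).grad_eq]

theorem integral_u_mul (hc : IsCascade A b Ω w k δ S h D N) (j : ℕ) {φ : (ι → ℝ) → ℝ}
    (hφ : ContDiff ℝ 1 φ) (hφc : HasCompactSupport φ) (hφΩ : tsupport φ ⊆ Ω) (a : κ) (i : ι) :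
    ∫ x, (S j).u x a * fderiv ℝ φ x (Pi.single i 1)
      = - ∫ x in Ω, grad (S j).u x a i * φ x := by
  obtain ⟨C, hC⟩ := hc.exists_lipschitzWith_u j a
  obtain ⟨C', hC'⟩ := hφ.lipschitzWith_of_hasCompactSupport hφc one_ne_zero
  have key := hC.integral_lineDeriv_mul_eq (μ := volume) hC' hφc (Pi.single i 1)
  rw [setIntegral_eq_integral_of_forall_compl_eq_zero fun x hx => ?_]
  · simp only [grad, Matrix.of_apply]
    rw [key, ← integral_neg]
    refine integral_congr_ae (Eventually.of_forall fun x => ?_)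
    simp only
    rw [(hφ.differentiable one_ne_zero x).lineDeriv_eq_fderiv, map_neg]
    ring
  · rw [image_eq_zero_of_notMem_tsupport fun h => hx (hφΩ h), mul_zero]

theorem hasWeakGradientOn_limit (hc : IsCascade A b Ω w k δ S h D N) (ht : IsTame A w k δ K α)
    (hα : α ∈ Ioo (0 : ℝ) 1) (hΩ : IsOpen Ω) (hΩb : Bornology.IsBounded Ω)
    (hV : Tendsto (fun j => volume (S j).V) atTop (𝓝 0))
    (hK : ∑' i, ENNReal.ofReal (K i) * volume (S i).V ≠ ⊤) :
    HasWeakGradientOn (limit A b w k h) (grad (limit A b w k h)) Ω := by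
  have hcont := hc.continuous_limit ht hα
  have hmeas : ∀ a i, Measurable fun x => grad (limit A b w k h) x a i := fun a i =>
    measurable_lineDeriv ((continuous_apply a).comp hcont)
  refine ⟨?_, fun a i => ?_, fun φ hφ hφc hφΩ a i => ?_⟩
  · exact (hcont.continuousOn.integrableOn_compact hΩb.isCompact_closure).mono_set subset_closure
  · refine Integrable.mono' (hc.integrable_dom hK).integrableOn (hmeas a i).aestronglyMeasurable ?_
    rw [ae_restrict_iff' hΩ.measurableSet]
    filter_upwards [hc.ae_abs_grad_limit_le ht hV hK] with x hx hxΩ using hx hxΩ a i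
  · have hφ1 : ContDiff ℝ 1 φ := hφ 1
    set dφ : (ι → ℝ) → ℝ := fun x => fderiv ℝ φ x (Pi.single i 1) with hdφ
    have hdφcont : Continuous dφ := (hφ1.continuous_fderiv one_ne_zero).clm_apply continuous_const
    have hdφc : HasCompactSupport dφ := hφc.fderiv_apply ℝ _
    have hdφ0 : ∀ x ∉ Ω, dφ x = 0 := fun x hx => by
      have : fderiv ℝ φ x = 0 :=
        image_eq_zero_of_notMem_tsupport fun h => hx (hφΩ (tsupport_fderiv_subset ℝ h))
      simp only [hdφ, this, _root_.zero_apply]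
    rw [setIntegral_eq_integral_of_forall_compl_eq_zero fun x hx =>
      mul_eq_zero_of_right _ (hdφ0 x hx)]
    have hlim1 : Tendsto (fun j => ∫ x, (S j).u x a * dφ x) atTop
        (𝓝 (∫ x, limit A b w k h x a * dφ x)) := by
      refine tendsto_integral_of_dominated_convergence
        (fun x => (|lmap A b x a| + 2) * |dφ x|) (fun j => ?_) ?_ (fun j => ?_) ?_
      · obtain ⟨C, hC⟩ := hc.exists_lipschitzWith_u j a
        exact (hC.continuous.mul hdφcont).aestronglyMeasurable
      · exact ((((continuous_lmap A b a).abs).add continuous_const).mul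
          hdφcont.abs).integrable_of_hasCompactSupport (hdφc.comp_left abs_zero).mul_left
      · refine Eventually.of_forall fun x => ?_
        rw [norm_mul, Real.norm_eq_abs, Real.norm_eq_abs]
        exact mul_le_mul_of_nonneg_right (hc.abs_u_le ht hα j x a) (abs_nonneg _)
      · exact Eventually.of_forall fun x => (hc.tendsto_u ht hα x a).mul_const _
    obtain ⟨M, hM⟩ := hφ1.continuous.bounded_above_of_compact_support hφc
    have hlim2 : Tendsto (fun j => ∫ x in Ω, grad (S j).u x a i * φ x) atTop
        (𝓝 (∫ x in Ω, grad (limit A b w k h) x a i * φ x)) := by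
      refine tendsto_integral_of_dominated_convergence
        (fun x => (dom S K x).toReal * M) (fun j => ?_) ?_ (fun j => ?_) ?_
      · obtain ⟨C, hC⟩ := hc.exists_lipschitzWith_u j a
        exact ((measurable_lineDeriv hC.continuous).mul
          hφ1.continuous.measurable).aestronglyMeasurable
      · exact ((hc.integrable_dom hK).mul_const M).integrableOn
      · rw [ae_restrict_iff' hΩ.measurableSet]
        filter_upwards [hc.ae_abs_grad_u_le ht hV hK j] with x hx hxΩ
        rw [norm_mul]
        exact mul_le_mul (hx hxΩ a i) (hM x) (norm_nonneg _) ENNReal.toReal_nonneg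
      · rw [ae_restrict_iff' hΩ.measurableSet]
        filter_upwards [hc.ae_tendsto_grad ht hV] with x hx hxΩ
        exact (hx hxΩ a i).mul_const _
    refine tendsto_nhds_unique hlim1 (hlim2.neg.congr fun j => ?_)
    exact (hc.integral_u_mul j hφ1 hφc hφΩ a i).symm

end IsCascade

theorem abs_apply_le_frobNorm [Fintype ι] [Fintype κ] (A : Matrix κ ι ℝ) (a : κ) (i : ι) :
    |A a i| ≤ frobNorm A := by
  refine Real.abs_le_sqrt ?_
  refine (Finset.single_le_sum (f := fun i => A a i ^ 2) (fun i _ => sq_nonneg _)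
    (Finset.mem_univ i)).trans ?_
  exact Finset.single_le_sum (f := fun a => ∑ i, A a i ^ 2)
    (fun a _ => Finset.sum_nonneg fun i _ => sq_nonneg _) (Finset.mem_univ a)

theorem frobNorm_le [Fintype ι] {B : Matrix ι ι ℝ} {c : ℝ} (hc : 0 ≤ c)
    (h : ∀ a i, |B a i| ≤ c) : frobNorm B ≤ Fintype.card ι * c := by
  refine Real.sqrt_le_iff.2 ⟨by positivity, ?_⟩
  calc ∑ a, ∑ i, B a i ^ 2 ≤ ∑ _a : ι, ∑ _i : ι, c ^ 2 :=
        Finset.sum_le_sum fun a _ => Finset.sum_le_sum fun i _ => sq_le_sq' (abs_le.1 (h a i)).1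
          (abs_le.1 (h a i)).2
    _ = (Fintype.card ι * c) ^ 2 := by simp; ring

theorem frobNorm_nonneg [Fintype ι] [Fintype κ] (A : Matrix κ ι ℝ) : 0 ≤ frobNorm A :=
  Real.sqrt_nonneg _

namespace IsCascade

variable [Fintype ι] [DecidableEq ι] {A : Matrix ι ι ℝ} {b : ι → ℝ}
    {Ω : Set (ι → ℝ)} {w : ℕ → ι → ℝ} {k : ℕ → ι} {δ : ℕ → ℝ} {S : ℕ → Stage ι ι}
    {h : ℕ → (ι → ℝ) → ℝ} {D N : ℕ → Set (ι → ℝ)} {K : ℕ → ℝ} {α : ℝ}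

theorem integral_error_lt (hc : IsCascade A b Ω w k δ S h D N) (ht : IsTame A w k δ K α)
    (hα : α ∈ Ioo (0 : ℝ) 1) (hV : Tendsto (fun j => volume (S j).V) atTop (𝓝 0))
    (hΩ0 : volume Ω ≠ 0) (hΩt : volume Ω ≠ ⊤)
    {s ε : ℝ} (hs : 0 ≤ s) (hε : 0 < ε)
    (hδ : ∀ j, (1 + Fintype.card ι * K j) ^ s * δ j ≤ ε / 4 * (1 / 2) ^ j) :
    ∫ x in {x ∈ Ω | grad (limit A b w k h) x ∉ {X : Matrix ι ι ℝ | X.rank ≤ 1}},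
      (1 + frobNorm (grad (limit A b w k h) x)) ^ s < ε * (volume Ω).toReal := by
  have hmeas : Measurable fun x => (1 + frobNorm (grad (limit A b w k h) x)) ^ s := by
    have : ∀ a i, Measurable fun x => grad (limit A b w k h) x a i := fun a i =>
      measurable_lineDeriv ((continuous_apply a).comp (hc.continuous_limit ht hα))
    unfold frobNorm
    fun_prop
  have hnn : ∀ x, 0 ≤ (1 + frobNorm (grad (limit A b w k h) x)) ^ s := fun x => by
    have := frobNorm_nonneg (grad (limit A b w k h) x)
    positivity
  rw [integral_eq_lintegral_of_nonneg_ae (Eventually.of_forall hnn) hmeas.aestronglyMeasurable]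
  have hle : ∫⁻ x in {x ∈ Ω | grad (limit A b w k h) x ∉ {X : Matrix ι ι ℝ | X.rank ≤ 1}},
      ENNReal.ofReal ((1 + frobNorm (grad (limit A b w k h) x)) ^ s)
      ≤ ENNReal.ofReal (ε / 2) * volume Ω := by
    have hsub : ({x ∈ Ω | grad (limit A b w k h) x ∉ {X : Matrix ι ι ℝ | X.rank ≤ 1}} : Set _)
        ≤ᵐ[volume] ⋃ i, N i := by
      filter_upwards [hc.ae_exists_mem hV] with x hx
      rintro ⟨hxΩ, hxr⟩
      obtain ⟨i, hi | hi⟩ := hx hxΩ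
      · obtain ⟨B, hB, hr, -⟩ := hc.exists_locallyAffineAt_done hi
        exact absurd (by rwa [hB.grad_eq]) hxr
      · exact mem_iUnion.2 ⟨i, hi⟩
    refine (lintegral_mono_set' hsub).trans ((lintegral_iUnion_le _ _).trans ?_)
    have hgeom : ∑' i : ℕ, ENNReal.ofReal (ε / 4 * (1 / 2) ^ i) = ENNReal.ofReal (ε / 2) := by
      rw [← ENNReal.ofReal_tsum_of_nonneg (fun i => by positivity)
        (summable_geometric_two.mul_left _), tsum_mul_left, tsum_geometric_two]
      congr 1; ring
    rw [← hgeom, ← ENNReal.tsum_mul_right]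
    refine ENNReal.tsum_le_tsum fun i => ?_
    have hKi := ht.nonneg i
    calc ∫⁻ x in N i, ENNReal.ofReal ((1 + frobNorm (grad (limit A b w k h) x)) ^ s)
        ≤ ∫⁻ x in N i, ENNReal.ofReal ((1 + Fintype.card ι * K i) ^ s) := by
          refine setLIntegral_mono' (hc.step i).isOpen_err.measurableSet fun x hx => ?_
          obtain ⟨B, hB, hb, -⟩ := hc.exists_locallyAffineAt ht (Or.inr hx)
          have := frobNorm_nonneg B
          rw [hB.grad_eq]
          gcongr
          exact frobNorm_le hKi hb
      _ = ENNReal.ofReal ((1 + Fintype.card ι * K i) ^ s) * volume (N i) := setLIntegral_const _ _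
      _ ≤ ENNReal.ofReal ((1 + Fintype.card ι * K i) ^ s) *
          (ENNReal.ofReal (δ i) * volume Ω) := by
          gcongr
          refine (hc.step i).volume_err.trans ?_
          gcongr
          exact hc.V_subset i
      _ ≤ ENNReal.ofReal (ε / 4 * (1 / 2) ^ i) * volume Ω := by
          rw [← mul_assoc, ← ENNReal.ofReal_mul (by positivity)]
          exact mul_le_mul_left (ENNReal.ofReal_le_ofReal (hδ i)) _
  have hpos : 0 < (volume Ω).toReal := ENNReal.toReal_pos hΩ0 hΩt
  calc _ ≤ (ENNReal.ofReal (ε / 2) * volume Ω).toReal :=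
        ENNReal.toReal_mono (ENNReal.mul_ne_top ENNReal.ofReal_ne_top hΩt) hle
    _ = ε / 2 * (volume Ω).toReal := by
        rw [ENNReal.toReal_mul, ENNReal.toReal_ofReal (by positivity)]
    _ < _ := by nlinarith

theorem volume_lt_frobNorm_le (hc : IsCascade A b Ω w k δ S h D N) (ht : IsTame A w k δ K α)
    (hV : Tendsto (fun j => volume (S j).V) atTop (𝓝 0)) {t : ℝ} {j : ℕ}
    (htj : ∀ i < j, Fintype.card ι * K i ≤ t) :
    volume {x ∈ Ω | t < frobNorm (grad (limit A b w k h) x)} ≤ volume (S j).V := by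
  refine measure_mono_ae ?_
  filter_upwards [hc.ae_exists_mem hV] with x hx
  rintro ⟨hxΩ, hxt⟩
  obtain ⟨i, hi⟩ := hx hxΩ
  rcases lt_or_ge i j with hij | hij
  · obtain ⟨B, hB, hb, -⟩ := hc.exists_locallyAffineAt ht hi
    rw [hB.grad_eq] at hxt
    exact absurd (hxt.trans_le ((frobNorm_le (ht.nonneg i) hb).trans (htj i hij))) (lt_irrefl _)
  · exact hc.antitone_V hij (hc.mem_V hi)

end IsCascade

theorem exists_small_step {K c₁ c₂ L α : ℝ} (hc₁ : 0 < c₁) (hc₂ : 0 < c₂) (hα : α < 1) :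
    ∃ δ : ℝ, 0 < δ ∧ δ ≤ 1 ∧ K * δ ^ (1 - α) ≤ c₁ ∧ L * δ ≤ c₂ := by
  have h1 : Tendsto (fun δ : ℝ => K * δ ^ (1 - α)) (𝓝[>] 0) (𝓝 0) := by
    have := ((Real.continuousAt_rpow_const 0 (1 - α) (Or.inr (by linarith))).const_mul K).tendsto
    rw [Real.zero_rpow (by linarith), mul_zero] at this
    exact this.mono_left nhdsWithin_le_nhds
  have h2 : Tendsto (fun δ : ℝ => L * δ) (𝓝[>] 0) (𝓝 0) := by
    have : Continuous fun δ : ℝ => L * δ := by fun_prop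
    simpa using (this.tendsto 0).mono_left nhdsWithin_le_nhds
  have h3 : ∀ᶠ δ : ℝ in 𝓝[>] 0, δ ∈ Ioc (0 : ℝ) 1 := Ioc_mem_nhdsGT one_pos
  obtain ⟨δ, hδ, hδ1, hδ2⟩ := (h3.and ((h1.eventually (ge_mem_nhds hc₁)).and
    (h2.eventually (ge_mem_nhds hc₂)))).exists
  exact ⟨δ, hδ.1, hδ.2, hδ1, hδ2⟩

theorem summable_half_pow_div (d : ℕ) [NeZero d] : Summable fun j : ℕ => (1 / 2 : ℝ) ^ (j / d) := by
  rw [← (Nat.divModEquiv d).symm.summable_iff]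
  have : Summable fun p : ℕ × Fin d => (1 / 2 : ℝ) ^ p.1 * 1 :=
    summable_geometric_two.mul_of_nonneg (g := fun _ : Fin d => (1 : ℝ)) Summable.of_finite
      (fun i => by positivity) fun _ => zero_le_one
  refine this.congr fun p => ?_
  have : (p.1 * d + p.2) / d = p.1 := by
    rw [mul_comm, Nat.mul_add_div p.2.pos, Nat.div_eq_of_lt p.2.2, add_zero]
  simp [this]

theorem reducesWith_rank_le_one (d : ℕ) (hd : 2 ≤ d) :
    ReducesWith (16 * (d : ℝ) ^ 2) (univ : Set (Matrix (Fin d) (Fin d) ℝ))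
      {X : Matrix (Fin d) (Fin d) ℝ | X.rank ≤ 1} 2 := by
  rintro A - b ε hε α hα s hs Ω ⟨hΩ, hΩb, hΩc, -⟩
  have hd0 : 0 < d := by omega
  have : NeZero d := ⟨hd0.ne'⟩
  have hΩt : volume Ω ≠ ⊤ := hΩb.measure_lt_top.ne
  have hΩ0 : volume Ω ≠ 0 := (hΩ.measure_pos volume hΩc.nonempty).ne'
  set F := frobNorm A with hF
  have hF0 : 0 ≤ F := frobNorm_nonneg A
  set K : ℕ → ℝ := fun j => 4 * 2 ^ (j / d) * F with hK
  have hK0 : ∀ j, 0 ≤ K j := fun j => by positivity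
  choose δ hδ0 hδ1 hδ2 hδ3 using fun j => exists_small_step (K := K j)
    (L := (1 + Fintype.card (Fin d) * K j) ^ s)
    (c₁ := (1 / 2) ^ j) (c₂ := ε / 4 * (1 / 2) ^ j) (by positivity)
    (mul_pos (div_pos hε.1 four_pos) (by positivity)) hα.2
  obtain ⟨S, h, D, N, hc⟩ := exists_isCascade A b hΩ (wt d) (fun j => ⟨j % d, Nat.mod_lt j hd0⟩) δ
    (by simpa using hd) hδ0 (wt_zero d) fun j => wt_succ d j hd0
  have ht : IsTame A (wt d) (fun j => ⟨j % d, Nat.mod_lt j hd0⟩) δ K α := by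
    refine ⟨hδ0, hδ1, hK0, fun j a i => ?_, hδ2⟩
    have hw : ∀ i, |wt d j i * A a i| ≤ 2 * 2 ^ (j / d) * F := fun i => by
      rw [abs_mul, abs_of_nonneg ((pow_nonneg zero_le_two _).trans (le_wt d j i))]
      exact mul_le_mul (wt_le d j i) (abs_apply_le_frobNorm A a i) (abs_nonneg _) (by positivity)
    calc _ ≤ 2 * 2 ^ (j / d) * F + 2 * 2 ^ (j / d) * F := add_le_add (hw _) (hw _)
      _ = K j := by rw [hK]; ring
  have hvol : ∀ j, volume (S j).V ≤ ENNReal.ofReal (d ^ 2 * ((2 ^ (j / d)) ^ 2)⁻¹) * volume Ω :=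
    fun j => by
      have := hc.volume_V_le (wt_zero d) (fun j => wt_succ d j hd0) j
        (pow_pos two_pos (j / d)) (le_wt d j)
      rwa [Fintype.card_fin] at this
  have hsummable : Summable fun j : ℕ => (1 / 2 : ℝ) ^ (j / d) := summable_half_pow_div d
  have hV : Tendsto (fun j => volume (S j).V) atTop (𝓝 0) := by
    have h0 : Tendsto (fun j : ℕ => ENNReal.ofReal (d ^ 2 * (1 / 2) ^ (j / d)) * volume Ω) atTop
        (𝓝 0) := by
      have := ENNReal.Tendsto.mul_const (b := volume Ω) (ENNReal.tendsto_ofReal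
        (hsummable.tendsto_atTop_zero.const_mul ((d : ℝ) ^ 2))) (Or.inr hΩt)
      simpa using this
    refine tendsto_of_tendsto_of_tendsto_of_le_of_le tendsto_const_nhds h0 (fun _ => zero_le)
      fun j => (hvol j).trans ?_
    gcongr
    rw [one_div, inv_pow]
    have : (1 : ℝ) ≤ 2 ^ (j / d) := one_le_pow₀ one_le_two
    gcongr
    nlinarith
  have hKV : ∑' j, ENNReal.ofReal (K j) * volume (S j).V ≠ ⊤ := by
    have hb : ∀ j, ENNReal.ofReal (K j) * volume (S j).V
        ≤ ENNReal.ofReal (4 * F * d ^ 2 * (1 / 2) ^ (j / d)) * volume Ω := fun j => by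
      refine (mul_le_mul_right (hvol j) _).trans (le_of_eq ?_)
      rw [← mul_assoc, ← ENNReal.ofReal_mul (hK0 j)]
      congr 2
      simp only [hK, one_div, inv_pow]
      field_simp
    refine ne_top_of_le_ne_top ?_ (ENNReal.tsum_le_tsum hb)
    rw [ENNReal.tsum_mul_right]
    exact ENNReal.mul_ne_top (hsummable.mul_left _).tsum_ofReal_ne_top hΩt
  refine ⟨_, grad (IsCascade.limit A b (wt d) (fun j => ⟨j % d, Nat.mod_lt j hd0⟩) h),
    hc.isPiecewiseAffineOn_limit ht hΩ hV, hc.hasWeakGradientOn_limit ht hα hΩ hΩb hV hKV,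
    hc.memHolder_limit ht hα hΩb, fun x hx => hc.limit_eq_lmap fun hxΩ => ?_,
    hc.integral_error_lt ht hα hV hΩ0 hΩt (zero_le_one.trans (le_of_lt hs)) hε.1 hδ3,
    fun t ht0 => ?_⟩
  · rw [hΩ.frontier_eq] at hx; exact hx.2 hxΩ
  · rw [Real.rpow_neg ht0.le, Real.rpow_two, Real.rpow_two, Real.rpow_two]
    have hd1 : (1 : ℝ) ≤ d := by exact_mod_cast hd0
    set Q : ℝ := 4 * d * (1 + F) with hQ
    have hQ0 : 0 < Q := by positivity
    have hQ2 : 4 * (d : ℝ) ^ 2 * Q ^ 2 ≤ (16 * (d : ℝ) ^ 2) ^ 2 * (1 + F ^ 2) := by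
      have : (1 + F) ^ 2 ≤ 2 * (1 + F ^ 2) := by nlinarith [sq_nonneg (1 - F)]
      calc 4 * (d : ℝ) ^ 2 * Q ^ 2 = 64 * (d : ℝ) ^ 4 * (1 + F) ^ 2 := by rw [hQ]; ring
        _ ≤ 64 * (d : ℝ) ^ 4 * (2 * (1 + F ^ 2)) := by gcongr
        _ ≤ _ := by
          have : 0 ≤ (d : ℝ) ^ 4 * (1 + F ^ 2) := by positivity
          nlinarith
    rcases lt_or_ge t Q with htQ | htQ
    · refine (measure_mono fun x hx => hx.1).trans (le_mul_of_one_le_left zero_le ?_)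
      rw [ENNReal.one_le_ofReal, ← div_eq_mul_inv, one_le_div (by positivity)]
      refine le_trans ?_ hQ2
      have : t ^ 2 ≤ Q ^ 2 := by gcongr
      have : 1 ≤ (d : ℝ) ^ 2 := one_le_pow₀ hd1
      nlinarith [sq_nonneg Q]
    · obtain ⟨m, hm1, hm2⟩ := exists_nat_pow_near ((one_le_div hQ0).2 htQ) (one_lt_two (α := ℝ))
      rw [le_div_iff₀ hQ0] at hm1
      rw [div_lt_iff₀ hQ0] at hm2
      refine (hc.volume_lt_frobNorm_le ht hV (j := m * d) fun i hi => ?_).trans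
        ((hvol _).trans ?_)
      · rw [Fintype.card_fin]
        refine le_trans ?_ hm1
        have : (2 : ℝ) ^ (i / d) ≤ 2 ^ m := pow_le_pow_right₀ one_le_two
          (Nat.div_le_of_le_mul (by rw [mul_comm]; exact hi.le))
        calc (d : ℝ) * K i = 2 ^ (i / d) * (4 * d * F) := by rw [hK]; ring
          _ ≤ 2 ^ m * Q := by rw [hQ]; gcongr; linarith
      · refine mul_le_mul_left (ENNReal.ofReal_le_ofReal ?_) _
        rw [Nat.mul_div_cancel _ hd0, ← div_eq_mul_inv, ← div_eq_mul_inv,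
          div_le_div_iff₀ (by positivity) (by positivity)]
        have h1 : t ^ 2 ≤ (2 ^ (m + 1) * Q) ^ 2 := by gcongr
        calc (d : ℝ) ^ 2 * t ^ 2 ≤ d ^ 2 * (2 ^ (m + 1) * Q) ^ 2 := by gcongr
          _ = 4 * (d : ℝ) ^ 2 * Q ^ 2 * (2 ^ m) ^ 2 := by rw [pow_succ]; ring
          _ ≤ _ := by gcongr

/-- Proposition (Stage 1): `ℝ^{2n×2n}` can be reduced to the rank-`≤ 1` matrices in weak `L²`. -/
theorem stage1_reduction (n : ℕ) (hn : 0 < n) :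
    ReducedTo (Set.univ : Set (Matrix (Fin (2 * n)) (Fin (2 * n)) ℝ))
      {X : Matrix (Fin (2 * n)) (Fin (2 * n)) ℝ | X.rank ≤ 1} 2 := by
  refine ⟨_, ?_, reducesWith_rank_le_one (2 * n) (by omega)⟩
  have : (1 : ℝ) ≤ ((2 * n : ℕ) : ℝ) := by exact_mod_cast (by omega : 1 ≤ 2 * n)
  nlinarith

end Paper
end
end

section
/- For every positive integer n and every p ∈ (1,∞), the set {X ∈ ℝ^{2n×2n} : rank X ≤ 1} can be reduced to L in weak L^p. -/
open MeasureTheory Set Filter Topology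

noncomputable section

namespace Paper

variable {ι κ : Type*}

/-- Block-diagonal `2n×2n` matrices (w.r.t. the splitting `ℝ^{2n} = ℝ^n × ℝ^n`). -/
def L1set (n : ℕ) : Set (Matrix (Fin n ⊕ Fin n) (Fin n ⊕ Fin n) ℝ) :=
  {X | (∀ i j, X (Sum.inl i) (Sum.inr j) = 0) ∧ (∀ i j, X (Sum.inr i) (Sum.inl j) = 0)}

/-- Block anti-diagonal `2n×2n` matrices. -/
def L2set (n : ℕ) : Set (Matrix (Fin n ⊕ Fin n) (Fin n ⊕ Fin n) ℝ) :=
  {X | (∀ i j, X (Sum.inl i) (Sum.inl j) = 0) ∧ (∀ i j, X (Sum.inr i) (Sum.inr j) = 0)}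

/-- Split matrices `L = L₁ ∪ L₂`. -/
def LSet (n : ℕ) : Set (Matrix (Fin n ⊕ Fin n) (Fin n ⊕ Fin n) ℝ) := L1set n ∪ L2set n

/-- Matrices of determinant one. -/
def SigmaSet (n : ℕ) : Set (Matrix (Fin n ⊕ Fin n) (Fin n ⊕ Fin n) ℝ) := {X | X.det = 1}


/-- The scalar affine function with slope `q.1` and constant term `q.2`. -/
def affEval [Fintype ι] (q : (ι → ℝ) × ℝ) (x : ι → ℝ) : ℝ := (∑ i, q.1 i * x i) + q.2

lemma continuous_affEval [Fintype ι] (q : (ι → ℝ) × ℝ) : Continuous (affEval q) := by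
  unfold affEval; fun_prop

lemma volume_affEval_eq [Fintype ι] {q q' : (ι → ℝ) × ℝ} (h : q ≠ q') :
    volume {x | affEval q x = affEval q' x} = 0 := by
  classical
  let s : AffineSubspace ℝ (ι → ℝ) :=
    { carrier := {x | affEval q x = affEval q' x}
      smul_vsub_vadd_mem' := by
        intro c x y z hx hy hz
        simp only [Set.mem_ofPred_eq, affEval, vsub_eq_sub, vadd_eq_add, Pi.add_apply,
          Pi.smul_apply, Pi.sub_apply, smul_eq_mul, mul_add, mul_sub, mul_left_comm _ c,
          Finset.sum_add_distrib, Finset.sum_sub_distrib, ← Finset.mul_sum] at *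
        linear_combination c * hx - c * hy + hz }
  refine Measure.addHaar_affineSubspace volume s fun hs => h ?_
  have key : ∀ x, affEval q x = affEval q' x := fun x => by
    have : x ∈ s := hs ▸ AffineSubspace.mem_top ℝ _ x
    exact this
  have h2 : q.2 = q'.2 := by simpa [affEval] using key 0
  refine Prod.ext (funext fun i => ?_) h2
  simpa [affEval, h2, Pi.single_apply] using key (Pi.single i 1)

/-- The points at which the affine functions in `J` take pairwise distinct values. -/
def genericSet [Fintype ι] (J : Finset ((ι → ℝ) × ℝ)) : Set (ι → ℝ) :=
  {x | ∀ q ∈ J, ∀ q' ∈ J, q ≠ q' → affEval q x ≠ affEval q' x}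

lemma isOpen_genericSet [Fintype ι] (J : Finset ((ι → ℝ) × ℝ)) : IsOpen (genericSet J) := by
  have : genericSet J = ⋂ q ∈ J, ⋂ q' ∈ J, {x | q ≠ q' → affEval q x ≠ affEval q' x} := by
    ext x; simp [genericSet]
  rw [this]
  refine isOpen_biInter_finset fun q _ => isOpen_biInter_finset fun q' _ => ?_
  by_cases h : q = q'
  · simp [h]
  · simpa [h] using isOpen_ne_fun (continuous_affEval q) (continuous_affEval q')

lemma volume_compl_genericSet [Fintype ι] (J : Finset ((ι → ℝ) × ℝ)) :
    volume (genericSet J)ᶜ = 0 := by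
  have : (genericSet J)ᶜ ⊆ ⋃ q ∈ J, ⋃ q' ∈ J, {x | q ≠ q' ∧ affEval q x = affEval q' x} := by
    intro x hx
    simp only [genericSet, Set.mem_compl_iff, Set.mem_ofPred_eq] at hx
    push Not at hx
    obtain ⟨q, hq, q', hq', hne, he⟩ := hx
    simp only [Set.mem_iUnion]
    exact ⟨q, hq, q', hq', hne, he⟩
  refine measure_mono_null this ?_
  refine (measure_biUnion_null_iff J.countable_toSet).2 fun q _ =>
    (measure_biUnion_null_iff J.countable_toSet).2 fun q' _ => ?_
  by_cases h : q = q'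
  · simp [h]
  · simpa [h] using volume_affEval_eq h

/-- A continuous selection of finitely many affine functions is locally affine at generic points. -/
lemma eventuallyEq_affEval [Fintype ι] {J : Finset ((ι → ℝ) × ℝ)} {h : (ι → ℝ) → ℝ}
    {Ω : Set (ι → ℝ)} (hc : Continuous h) (hΩ : IsOpen Ω)
    (hsel : ∀ x ∈ Ω, ∃ q ∈ J, h x = affEval q x) {x : ι → ℝ} (hx : x ∈ Ω ∩ genericSet J)
    {q : (ι → ℝ) × ℝ} (hq : q ∈ J) (hxq : h x = affEval q x) : h =ᶠ[𝓝 x] affEval q := by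
  have hne : ∀ᶠ y in 𝓝 x, ∀ q' ∈ J, q ≠ q' → h y ≠ affEval q' y := by
    refine (Filter.eventually_all_finset J).2 fun q' hq' => ?_
    by_cases he : q = q'
    · simp [he]
    · have h1 : h x ≠ affEval q' x := hxq ▸ hx.2 q hq q' hq' he
      filter_upwards [(isOpen_ne_fun hc (continuous_affEval q')).mem_nhds h1] with y hy _ using hy
  filter_upwards [hne, hΩ.mem_nhds hx.1] with y hy hyΩ
  obtain ⟨q', hq', he⟩ := hsel y hyΩ
  by_cases hqq : q = q'
  · rw [he, hqq]
  · exact absurd he (hy q' hq' hqq)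

/-- A continuous selection of finitely many affine functions is affine on every preconnected set
of generic points. -/
lemma exists_affEval_of_isPreconnected [Fintype ι] {J : Finset ((ι → ℝ) × ℝ)} {h : (ι → ℝ) → ℝ}
    {Ω V : Set (ι → ℝ)} (hc : Continuous h) (hΩ : IsOpen Ω)
    (hsel : ∀ x ∈ Ω, ∃ q ∈ J, h x = affEval q x) (hV : IsPreconnected V)
    (hVΩ : V ⊆ Ω ∩ genericSet J) : ∃ q, ∀ x ∈ V, h x = affEval q x := by
  rcases V.eq_empty_or_nonempty with rfl | ⟨x₀, hx₀⟩
  · exact ⟨0, by simp⟩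
  obtain ⟨q, hq, hqx⟩ := hsel x₀ (hVΩ hx₀).1
  refine ⟨q, ?_⟩
  have hsub := hV.subset_left_of_subset_union
    (u := {x | x ∈ Ω ∩ genericSet J ∧ h x = affEval q x}) (v := {x | h x ≠ affEval q x})
    ?_ (isOpen_ne_fun hc (continuous_affEval q)) ?_ ?_ ⟨x₀, hx₀, hVΩ hx₀, hqx⟩
  · exact fun x hx => (hsub hx).2
  · rw [isOpen_iff_mem_nhds]
    rintro x ⟨hx, hxq⟩
    filter_upwards [(hΩ.inter (isOpen_genericSet J)).mem_nhds hx,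
      eventuallyEq_affEval hc hΩ hsel hx hq hxq] with y hy hyq using ⟨hy, hyq⟩
  · exact Set.disjoint_left.2 fun x hx hx' => hx' hx.2
  · intro x hx
    by_cases he : h x = affEval q x
    · exact Or.inl ⟨hVΩ hx, he⟩
    · exact Or.inr he

lemma frontier_connectedComponentIn_subset {X : Type*} [TopologicalSpace X]
    [LocallyConnectedSpace X] {U : Set X} (hU : IsOpen U) (x : X) :
    frontier (connectedComponentIn U x) ⊆ closure U \ U := by
  intro y hy
  refine ⟨closure_mono (connectedComponentIn_subset U x) hy.1, fun hyU => hy.2 ?_⟩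
  rw [hU.connectedComponentIn.interior_eq]
  obtain ⟨z, hzy, hzx⟩ := mem_closure_iff.1 hy.1 _ hU.connectedComponentIn
    (mem_connectedComponentIn hyU)
  rw [connectedComponentIn_eq hzx, ← connectedComponentIn_eq hzy]
  exact mem_connectedComponentIn hyU

lemma isPiecewiseAffineOn_of_preconnected [Fintype ι] {u : (ι → ℝ) → κ → ℝ} {Ω U : Set (ι → ℝ)}
    (hΩ : IsRegularDomain Ω) (hU : IsOpen U) (hUΩ : U ⊆ Ω) (hnull : volume (Ω \ U) = 0)
    (haff : ∀ V ⊆ U, IsPreconnected V → IsAffineOn u V) : IsPiecewiseAffineOn u Ω := by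
  have hsub : ∀ V ∈ connectedComponentIn U '' U, V ⊆ U := by
    rintro _ ⟨x, -, rfl⟩; exact connectedComponentIn_subset U x
  have hdisj : (connectedComponentIn U '' U).PairwiseDisjoint id := by
    rintro _ ⟨x, -, rfl⟩ _ ⟨y, -, rfl⟩ hne
    refine Set.disjoint_left.2 fun z hz hz' => hne ?_
    rw [connectedComponentIn_eq hz, connectedComponentIn_eq hz']
  have hopen : ∀ V ∈ connectedComponentIn U '' U, IsOpen V := by
    rintro _ ⟨x, -, rfl⟩; exact hU.connectedComponentIn
  have hconn : ∀ V ∈ connectedComponentIn U '' U, IsConnected V := by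
    rintro _ ⟨x, hx, rfl⟩; exact isConnected_connectedComponentIn_iff.2 hx
  refine ⟨connectedComponentIn U '' U,
    hdisj.countable_of_isOpen hopen fun V hV => (hconn V hV).nonempty,
    fun V hV => ⟨⟨hopen V hV, hΩ.2.1.subset ((hsub V hV).trans hUΩ), hconn V hV, ?_⟩,
      (hsub V hV).trans hUΩ, haff V (hsub V hV) (hconn V hV).isPreconnected⟩, hdisj, ?_⟩
  · obtain ⟨x, -, rfl⟩ := hV
    refine measure_mono_null (fun y hy => ?_) (measure_union_null hΩ.2.2.2 hnull)
    obtain ⟨hy1, hy2⟩ := frontier_connectedComponentIn_subset hU x hy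
    by_cases hyΩ : y ∈ Ω
    · exact Or.inr ⟨hyΩ, hy2⟩
    · exact Or.inl ⟨closure_mono hUΩ hy1, by rwa [hΩ.1.interior_eq]⟩
  · refine measure_mono_null (Set.sdiff_subset_sdiff_right fun x hx => ?_) hnull
    exact ⟨_, ⟨x, hx, rfl⟩, mem_connectedComponentIn hx⟩

/-- A maximum of finitely many pyramids, supported in a union of balls for the supremum norm. -/
lemma exists_pyramid [Fintype ι] (T : Finset ((ι → ℝ) × ℝ)) :
    ∃ (d : (ι → ℝ) → ℝ) (J : Finset ((ι → ℝ) × ℝ)), LipschitzWith 1 d ∧ (∀ x, 0 ≤ d x) ∧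
      (∀ x, ∃ q ∈ J, d x = affEval q x) ∧
      ∀ x, 0 < d x ↔ ∃ q ∈ T, x ∈ Metric.ball q.1 q.2 := by
  classical
  induction T using Finset.induction_on with
  | empty =>
    exact ⟨0, {0}, LipschitzWith.const' 0, by simp, by simp [affEval], by simp⟩
  | insert c T _ ih =>
    obtain ⟨d, J, hd, hd0, hsel, hpos⟩ := ih
    refine ⟨fun x => max (d x) (c.2 - ‖x - c.1‖),
      J ∪ insert (0, c.2) ((Finset.univ.image fun i => (-Pi.single i 1, c.2 + c.1 i)) ∪
        Finset.univ.image fun i => (Pi.single i 1, c.2 - c.1 i)), ?_,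
      fun x => le_max_of_le_left (hd0 x), fun x => ?_, fun x => ?_⟩
    · have : LipschitzWith 1 fun x : ι → ℝ => c.2 - ‖x - c.1‖ := by
        refine LipschitzWith.of_dist_le_mul fun x y => ?_
        rw [Real.dist_eq, NNReal.coe_one, one_mul, dist_eq_norm, abs_sub_comm]
        have := abs_norm_sub_norm_le (x - c.1) (y - c.1)
        rw [sub_sub_sub_cancel_right] at this
        convert this using 2
        ring
      simpa using hd.max this
    · rcases le_total (c.2 - ‖x - c.1‖) (d x) with hle | hle
      · obtain ⟨q, hq, he⟩ := hsel x
        exact ⟨q, Finset.mem_union_left _ hq, by simpa [hle] using he⟩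
      · have hn : ‖x - c.1‖ = 0 ∨ ∃ i, ‖x - c.1‖ = ‖(x - c.1) i‖ := by
          rcases isEmpty_or_nonempty ι with h | h
          · exact Or.inl (by simp [Subsingleton.elim x c.1])
          · obtain ⟨i, -, hi⟩ := Finset.exists_mem_eq_sup Finset.univ Finset.univ_nonempty
              fun i => ‖(x - c.1) i‖₊
            exact Or.inr ⟨i, by rw [Pi.norm_def, hi, coe_nnnorm]⟩
        rcases hn with hn | ⟨i, hn⟩
        · exact ⟨(0, c.2), by simp, by simp [hn, affEval] at hle ⊢; linarith⟩
        · rw [Real.norm_eq_abs] at hn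
          rcases abs_cases ((x - c.1) i) with ⟨ha, -⟩ | ⟨ha, -⟩
          · refine ⟨(-Pi.single i 1, c.2 + c.1 i),
              Finset.mem_union_right _ <| Finset.mem_insert_of_mem <|
              Finset.mem_union_left _ <| Finset.mem_image_of_mem _ (Finset.mem_univ i), ?_⟩
            beta_reduce
            rw [max_eq_right hle, hn, ha]
            simp [affEval, Pi.single_apply]; ring
          · refine ⟨(Pi.single i 1, c.2 - c.1 i),
              Finset.mem_union_right _ <| Finset.mem_insert_of_mem <|
              Finset.mem_union_right _ <| Finset.mem_image_of_mem _ (Finset.mem_univ i), ?_⟩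
            beta_reduce
            rw [max_eq_right hle, hn, ha]
            simp [affEval, Pi.single_apply]; ring
    · simp [hpos, or_comm, dist_eq_norm]

/-- The sawtooth function `t ↦ dist(t, ℤ)`. -/
def sawtooth (t : ℝ) : ℝ := |t - round t|

lemma abs_sawtooth_sub_le (s t : ℝ) : |sawtooth s - sawtooth t| ≤ |s - t| := by
  have key : ∀ s t : ℝ, sawtooth s ≤ |s - t| + sawtooth t := fun s t =>
    (round_le s (round t)).trans (abs_sub_le s t _)
  rw [abs_sub_le_iff]
  have h1 := key s t
  have h2 := key t s
  rw [abs_sub_comm t s] at h2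
  constructor <;> linarith

/-- The sawtooth of slopes `± m` and amplitude at most `1 / (2 * k)`. -/
def sawFun [Fintype ι] (m : ι → ℝ) (k : ℝ) (x : ι → ℝ) : ℝ := sawtooth (k * ∑ i, m i * x i) / k

lemma abs_sum_mul_sub_le [Fintype ι] (m x y : ι → ℝ) :
    |∑ i, m i * x i - ∑ i, m i * y i| ≤ (∑ i, |m i|) * dist x y := by
  rw [← Finset.sum_sub_distrib, Finset.sum_mul]
  refine (Finset.abs_sum_le_sum_abs _ _).trans (Finset.sum_le_sum fun i _ => ?_)
  rw [← mul_sub, abs_mul, ← Real.dist_eq]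
  exact mul_le_mul_of_nonneg_left (dist_le_pi_dist x y i) (abs_nonneg _)

lemma lipschitzWith_sawFun [Fintype ι] (m : ι → ℝ) {k : ℝ} (hk : 0 < k) :
    LipschitzWith (∑ i, |m i|).toNNReal (sawFun m k) := by
  refine LipschitzWith.of_dist_le_mul fun x y => ?_
  rw [Real.coe_toNNReal _ (by positivity), Real.dist_eq, sawFun, sawFun, ← sub_div, abs_div,
    abs_of_pos hk, div_le_iff₀ hk]
  refine (abs_sawtooth_sub_le _ _).trans ?_
  rw [← mul_sub, abs_mul, abs_of_pos hk, mul_comm]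
  exact mul_le_mul_of_nonneg_right (abs_sum_mul_sub_le m x y) hk.le

lemma exists_sawFun_selection [Fintype ι] (m : ι → ℝ) {k : ℝ} (hk : 0 < k) {Ω : Set (ι → ℝ)}
    (hΩ : Bornology.IsBounded Ω) : ∃ J : Finset ((ι → ℝ) × ℝ), ∀ x ∈ Ω,
      ∃ q ∈ J, (q.1 = m ∨ q.1 = -m) ∧ sawFun m k x = affEval q x := by
  classical
  obtain ⟨R, hR⟩ := hΩ.exists_norm_le
  obtain ⟨Z, hZ⟩ := exists_nat_gt (k * ((∑ i, |m i|) * R) + 1)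
  refine ⟨((Finset.Icc (-(Z : ℤ)) Z).image fun z : ℤ => (m, -(z : ℝ) / k)) ∪
    (Finset.Icc (-(Z : ℤ)) Z).image fun z : ℤ => (-m, (z : ℝ) / k), fun x hx => ?_⟩
  set t := k * ∑ i, m i * x i with ht
  have habs : |t| ≤ k * ((∑ i, |m i|) * R) := by
    rw [ht, abs_mul, abs_of_pos hk]
    have h1 := abs_sum_mul_sub_le m x 0
    simp only [Pi.zero_apply, mul_zero, Finset.sum_const_zero, sub_zero, dist_zero_right] at h1
    exact mul_le_mul_of_nonneg_left
      (h1.trans (mul_le_mul_of_nonneg_left (hR x hx) (by positivity))) hk.le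
  have hr := abs_le.1 (abs_sub_round t)
  have ht' := abs_le.1 habs
  have hmem : round t ∈ Finset.Icc (-(Z : ℤ)) Z := by
    rw [Finset.mem_Icc]
    constructor
    · have : (-(Z : ℝ)) ≤ round t := by linarith
      exact_mod_cast this
    · have : (round t : ℝ) ≤ Z := by linarith
      exact_mod_cast this
  rcases abs_cases (t - round t) with ⟨ha, -⟩ | ⟨ha, -⟩
  · refine ⟨(m, -(round t : ℝ) / k), Finset.mem_union_left _ (Finset.mem_image_of_mem _ hmem),
      Or.inl rfl, ?_⟩
    rw [sawFun, sawtooth, ← ht, ha, affEval, div_eq_iff hk.ne', add_mul, div_mul_cancel₀ _ hk.ne',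
      ht]
    ring
  · refine ⟨(-m, (round t : ℝ) / k), Finset.mem_union_right _ (Finset.mem_image_of_mem
      (fun z : ℤ => (-m, (z : ℝ) / k)) hmem), Or.inr rfl, ?_⟩
    rw [sawFun, sawtooth, ← ht, ha, affEval, div_eq_iff hk.ne', add_mul, div_mul_cancel₀ _ hk.ne',
      ht]
    simp only [Pi.neg_apply, neg_mul, Finset.sum_neg_distrib]
    ring

/-- A Lipschitz function supported in `Ω`, locally affine off a null set, whose gradient is `± m`
off a set of small measure. -/
lemma exists_scalar_lamination [Fintype ι] {m : ι → ℝ} (hm : m ≠ 0) {Ω : Set (ι → ℝ)}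
    (hΩ : IsOpen Ω) (hb : Bornology.IsBounded Ω) {δ : ENNReal} (hδ : δ ≠ 0) :
    ∃ (h : (ι → ℝ) → ℝ) (J : Finset ((ι → ℝ) × ℝ)) (K : Set (ι → ℝ)),
      LipschitzWith (∑ i, |m i|).toNNReal h ∧ (∀ x ∉ Ω, h x = 0) ∧
      (∀ x ∈ Ω, ∃ q ∈ J, h x = affEval q x) ∧ K ⊆ Ω ∧ volume (Ω \ K) < δ ∧
      ∀ x ∈ K, ∃ q ∈ J, (q.1 = m ∨ q.1 = -m) ∧ h x = affEval q x := by
  classical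
  obtain ⟨K, hKΩ, hK, hKδ⟩ :=
    hΩ.measurableSet.exists_isCompact_sdiff_lt (μ := volume) hb.measure_lt_top.ne hδ
  have hL : 0 < ∑ i, |m i| := by
    obtain ⟨i, hi⟩ := Function.ne_iff.1 hm
    exact Finset.sum_pos' (fun _ _ => abs_nonneg _) ⟨i, Finset.mem_univ _, abs_pos.2 hi⟩
  set L := ∑ i, |m i| with hLdef
  obtain ⟨T, hTΩ, hTK⟩ : ∃ T : Finset ((ι → ℝ) × ℝ),
      (∀ q ∈ T, Metric.ball q.1 q.2 ⊆ Ω) ∧ ∀ x ∈ K, ∃ q ∈ T, x ∈ Metric.ball q.1 q.2 := by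
    choose! r hr0 hr using fun x (hx : x ∈ Ω) => Metric.isOpen_iff.1 hΩ x hx
    obtain ⟨t, ht, hcov⟩ := hK.elim_nhds_subcover (fun x => Metric.ball x (r x))
      fun x hx => Metric.ball_mem_nhds x (hr0 x (hKΩ hx))
    refine ⟨t.image fun x => (x, r x), ?_, fun x hx => ?_⟩
    · simp only [Finset.mem_image]
      rintro _ ⟨x, hx, rfl⟩
      exact hr x (hKΩ (ht x hx))
    · obtain ⟨y, hy, hxy⟩ := Set.mem_iUnion₂.1 (hcov hx)
      exact ⟨_, Finset.mem_image_of_mem _ hy, hxy⟩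
  obtain ⟨d, J₁, hd, hd0, hsel, hpos⟩ := exists_pyramid T
  obtain ⟨η, hη, hηK⟩ := hK.exists_forall_le' hd.continuous.continuousOn
    fun x hx => (hpos x).2 (hTK x hx)
  set k : ℝ := 1 / (L * η) with hkdef
  have hk : 0 < k := by positivity
  have hsaw : ∀ x, 0 ≤ sawFun m k x ∧ sawFun m k x ≤ L * η := fun x => by
    refine ⟨div_nonneg (abs_nonneg _) hk.le, ?_⟩
    rw [sawFun, div_le_iff₀ hk, hkdef, mul_one_div_cancel (by positivity)]
    exact (abs_sub_round _).trans (by norm_num)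
  obtain ⟨J₂, hJ₂⟩ := exists_sawFun_selection m hk hb
  refine ⟨fun x => min (sawFun m k x) (L * d x),
    J₂ ∪ J₁.image fun q => (L • q.1, L * q.2), K, ?_, fun x hx => ?_, fun x hx => ?_, hKΩ, hKδ,
    fun x hx => ?_⟩
  · have hLd : LipschitzWith L.toNNReal fun x => L * d x := by
      refine LipschitzWith.of_dist_le_mul fun x y => ?_
      have := hd.dist_le_mul x y
      rw [NNReal.coe_one, one_mul] at this
      rw [Real.dist_eq, ← mul_sub, abs_mul, abs_of_pos hL, Real.coe_toNNReal _ hL.le]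
      exact mul_le_mul_of_nonneg_left this hL.le
    simpa [← hLdef] using (lipschitzWith_sawFun m hk).min hLd
  · have : d x = 0 := by
      refine le_antisymm (not_lt.1 fun h0 => ?_) (hd0 x)
      obtain ⟨q, hq, hxq⟩ := (hpos x).1 h0
      exact hx (hTΩ q hq hxq)
    simpa [this] using (hsaw x).1
  · rcases min_choice (sawFun m k x) (L * d x) with he | he
    · obtain ⟨q, hq, -, hqx⟩ := hJ₂ x hx
      exact ⟨q, Finset.mem_union_left _ hq, he.trans hqx⟩
    · obtain ⟨q, hq, hqx⟩ := hsel x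
      refine ⟨_, Finset.mem_union_right _ (Finset.mem_image_of_mem _ hq), he.trans ?_⟩
      simp [hqx, affEval, mul_add, Finset.mul_sum, mul_assoc]
  · obtain ⟨q, hq, hqm, hqx⟩ := hJ₂ x (hKΩ hx)
    refine ⟨q, Finset.mem_union_left _ hq, hqm, ?_⟩
    rw [← hqx]
    exact min_eq_left ((hsaw x).2.trans (mul_le_mul_of_nonneg_left (hηK x hx) hL.le))

lemma hasWeakGradientOn_of_lipschitzWith [Fintype ι] [DecidableEq ι] [Fintype κ]
    {u : (ι → ℝ) → κ → ℝ} {C : κ → NNReal} (hu : ∀ k, LipschitzWith (C k) fun x => u x k)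
    {Ω : Set (ι → ℝ)} (hb : Bornology.IsBounded Ω) :
    HasWeakGradientOn u (fun x k i => lineDeriv ℝ (fun y => u y k) x (Pi.single i 1)) Ω where
  integrable :=
    ((continuous_pi fun k => (hu k).continuous).continuousOn.integrableOn_compact
      hb.isCompact_closure).mono_set subset_closure
  integrable_grad k i :=
    Measure.integrableOn_of_bounded hb.measure_lt_top.ne
      (measurable_lineDeriv (hu k).continuous).aestronglyMeasurable
      (ae_of_all _ fun _ => norm_lineDeriv_le_of_lipschitz ℝ (hu k))
  parts φ hφ hφc hφΩ k i := by
    have hφ1 : ContDiff ℝ 1 φ := mod_cast hφ 1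
    obtain ⟨D, hD⟩ := hφ1.lipschitzWith_of_hasCompactSupport hφc one_ne_zero
    have hφd : Differentiable ℝ φ := hφ1.differentiable one_ne_zero
    have key := (hu k).integral_lineDeriv_mul_eq (μ := volume) hD hφc (Pi.single i 1)
    rw [setIntegral_eq_integral_of_forall_compl_eq_zero fun x hx => by
        rw [fderiv_of_notMem_tsupport ℝ fun h => hx (hφΩ h)]; simp,
      setIntegral_eq_integral_of_forall_compl_eq_zero fun x hx => by
        rw [image_eq_zero_of_notMem_tsupport fun h => hx (hφΩ h), mul_zero], key,
      ← integral_neg]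
    refine integral_congr_ae (ae_of_all _ fun x => ?_)
    simp only [(hφd x).lineDeriv_eq_fderiv, map_neg]
    ring

lemma memHolder_of_lipschitzWith [Fintype ι] [Fintype κ] {u : (ι → ℝ) → κ → ℝ} {C : NNReal}
    (hu : LipschitzWith C u) {S : Set (ι → ℝ)} (hS : Bornology.IsBounded S) {α : ℝ}
    (hα : α < 1) : MemHolder α S u := by
  refine ⟨hu.continuous.continuousOn, C * Metric.diam S ^ (1 - α), fun x hx y hy => ?_⟩
  refine (hu.dist_le_mul x y).trans ?_
  rw [mul_assoc]
  refine mul_le_mul_of_nonneg_left ?_ C.coe_nonneg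
  calc dist x y = dist x y ^ (1 - α) * dist x y ^ α := by
        rw [← Real.rpow_add' dist_nonneg (by simp)]; simp
    _ ≤ _ := by
        gcongr
        exact Metric.dist_le_diam_of_mem hS hx hy

lemma exists_eq_mul_of_rank_le_one [Fintype ι] [Nonempty ι] [Fintype κ] {A : Matrix κ ι ℝ}
    (hA : A.rank ≤ 1) : ∃ (a : κ → ℝ) (m : ι → ℝ), m ≠ 0 ∧ ∀ k i, A k i = a k * m i := by
  classical
  obtain ⟨v, hv⟩ := finrank_le_one_iff.1 hA
  choose m hm using fun i => hv ⟨A.mulVecLin (Pi.single i 1), _, rfl⟩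
  have hAm : ∀ k i, A k i = (v : κ → ℝ) k * m i := fun k i => by
    have := congrFun (congrArg Subtype.val (hm i)) k
    simp at this
    linarith
  by_cases h : m = 0
  · exact ⟨0, 1, one_ne_zero, by simp [hAm, h]⟩
  · exact ⟨v, m, h, hAm⟩

lemma frobNorm_eq_of_eq_mul [Fintype ι] [Fintype κ] {A : Matrix κ ι ℝ} {a : κ → ℝ} {m : ι → ℝ}
    (hA : ∀ k i, A k i = a k * m i) :
    frobNorm A ^ 2 = (∑ k, a k ^ 2) * ∑ i, m i ^ 2 := by
  rw [frobNorm, Real.sq_sqrt (by positivity), Finset.sum_mul_sum]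
  simp [hA, mul_pow]

lemma frobNorm_le_of_abs_le [Fintype ι] [Fintype κ] {A G : Matrix κ ι ℝ} {a : κ → ℝ}
    {m : ι → ℝ} (hA : ∀ k i, A k i = a k * m i)
    (hG : ∀ k i, |G k i| ≤ 2 * |a k| * ∑ j, |m j|) :
    frobNorm G ≤ 2 * Fintype.card ι * frobNorm A := by
  have hL : (∑ j, |m j|) ^ 2 ≤ Fintype.card ι * ∑ j, m j ^ 2 := by
    simpa using sq_sum_le_card_mul_sum_sq (s := Finset.univ) (f := fun j => |m j|)
  rw [frobNorm]
  refine Real.sqrt_le_iff.2 ⟨mul_nonneg (by positivity) (Real.sqrt_nonneg _), ?_⟩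
  rw [mul_pow, frobNorm_eq_of_eq_mul hA]
  calc ∑ k, ∑ i, G k i ^ 2 ≤ ∑ k, ∑ _i : ι, 4 * a k ^ 2 * (∑ j, |m j|) ^ 2 := by
        refine Finset.sum_le_sum fun k _ => Finset.sum_le_sum fun i _ => ?_
        have := pow_le_pow_left₀ (abs_nonneg _) (hG k i) 2
        rw [sq_abs, mul_pow, mul_pow, sq_abs] at this
        linarith
    _ = 4 * (Fintype.card ι * ∑ k, a k ^ 2) * (∑ j, |m j|) ^ 2 := by
        simp only [Finset.sum_const, Finset.card_univ, nsmul_eq_mul, Finset.mul_sum,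
          Finset.sum_mul]
        exact Finset.sum_congr rfl fun k _ => by ring
    _ ≤ 4 * (Fintype.card ι * ∑ k, a k ^ 2) * (Fintype.card ι * ∑ j, m j ^ 2) := by gcongr
    _ = _ := by ring

lemma hasLineDerivAt_affEval [Fintype ι] [DecidableEq ι] (q : (ι → ℝ) × ℝ) (x : ι → ℝ) (i : ι) :
    HasLineDerivAt ℝ (affEval q) (q.1 i) x (Pi.single i 1) := by
  have : (fun t : ℝ => affEval q (x + t • Pi.single i 1)) = fun t => affEval q x + t * q.1 i := by
    funext t
    simp [affEval, mul_add, Finset.sum_add_distrib, Pi.single_apply]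
    ring
  rw [HasLineDerivAt, this]
  simpa using ((hasDerivAt_id (0 : ℝ)).mul_const (q.1 i)).const_add (affEval q x)

/-- The sign `+1` on the first block and `-1` on the second block. -/
def blockSign {β γ : Type*} : β ⊕ γ → ℝ := Sum.elim 1 (-1)

lemma abs_blockSign {β γ : Type*} (k : β ⊕ γ) : |blockSign k| = 1 := by
  cases k <;> simp [blockSign]

lemma mem_LSet_of_eq_mul_add {n : ℕ} {X : Matrix (Fin n ⊕ Fin n) (Fin n ⊕ Fin n) ℝ}
    {a m r : Fin n ⊕ Fin n → ℝ}
    (hr : r = (fun i => blockSign i * m i) ∨ r = -fun i => blockSign i * m i)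
    (hX : ∀ k i, X k i = a k * m i + blockSign k * a k * r i) : X ∈ LSet n := by
  rcases hr with rfl | rfl
  · left; constructor <;> intro i j <;> simp [hX, blockSign]
  · right; constructor <;> intro i j <;> simp [hX, blockSign]

/-- The superposition of the affine map `lmap A b` and the scalar function `h` times the fixed
vector `v`. -/
def addScalar [Fintype ι] (A : Matrix κ ι ℝ) (b v : κ → ℝ) (h : (ι → ℝ) → ℝ) (x : ι → ℝ) :
    κ → ℝ := fun k => lmap A b x k + v k * h x

lemma addScalar_apply_eq_affEval [Fintype ι] {A : Matrix κ ι ℝ} {b v : κ → ℝ}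
    {h : (ι → ℝ) → ℝ} {x : ι → ℝ} {q : (ι → ℝ) × ℝ} (hq : h x = affEval q x) (k : κ) :
    addScalar A b v h x k = affEval (fun i => A k i + v k * q.1 i, b k + v k * q.2) x := by
  simp only [addScalar, lmap, hq, affEval, add_mul, Finset.sum_add_distrib, mul_add,
    Finset.mul_sum, mul_assoc]
  ring

lemma lipschitzWith_addScalar [Fintype ι] {A : Matrix κ ι ℝ} {a : κ → ℝ} {m : ι → ℝ}
    (hA : ∀ k i, A k i = a k * m i) (b : κ → ℝ) {v : κ → ℝ} (hv : ∀ k, |v k| = |a k|)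
    {h : (ι → ℝ) → ℝ} (hh : LipschitzWith (∑ i, |m i|).toNNReal h) (k : κ) :
    LipschitzWith (2 * |a k| * ∑ i, |m i|).toNNReal fun x => addScalar A b v h x k := by
  refine LipschitzWith.of_dist_le_mul fun x y => ?_
  have h1 := hh.dist_le_mul x y
  rw [Real.coe_toNNReal _ (by positivity), Real.dist_eq] at h1
  rw [Real.coe_toNNReal _ (by positivity), Real.dist_eq]
  have h2 := abs_sum_mul_sub_le m x y
  have : addScalar A b v h x k - addScalar A b v h y k =
      a k * (∑ i, m i * x i - ∑ i, m i * y i) + v k * (h x - h y) := by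
    simp only [addScalar, lmap, hA, mul_assoc, mul_sub, Finset.mul_sum]
    ring
  rw [this]
  refine (abs_add_le _ _).trans ?_
  rw [abs_mul, abs_mul, hv]
  have := mul_le_mul_of_nonneg_left (add_le_add h2 h1) (abs_nonneg (a k))
  linarith

lemma isAffineOn_addScalar [Fintype ι] {A : Matrix κ ι ℝ} {b v : κ → ℝ} {h : (ι → ℝ) → ℝ}
    {V : Set (ι → ℝ)} {q : (ι → ℝ) × ℝ} (hq : ∀ x ∈ V, h x = affEval q x) :
    IsAffineOn (addScalar A b v h) V :=
  ⟨fun k i => A k i + v k * q.1 i, fun k => b k + v k * q.2, fun x hx =>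
    funext fun k => addScalar_apply_eq_affEval (hq x hx) k⟩

lemma weak_type_of_frobNorm_le [Fintype ι] [Fintype κ] {G : (ι → ℝ) → Matrix κ ι ℝ}
    {A : Matrix κ ι ℝ} {M : ℝ} (hM : 1 ≤ M) (hG : ∀ x, frobNorm (G x) ≤ M * frobNorm A)
    {p : ℝ} (hp : 0 < p) (Ω : Set (ι → ℝ)) {t : ℝ} (ht : 0 < t) :
    volume {x ∈ Ω | t < frobNorm (G x)}
      ≤ ENNReal.ofReal (M ^ p * (1 + frobNorm A ^ p) * t ^ (-p)) * volume Ω := by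
  rcases le_or_gt (M * frobNorm A) t with hle | hlt
  · have : {x ∈ Ω | t < frobNorm (G x)} = ∅ := by
      ext x
      simpa using fun _ => (hG x).trans hle
    simp [this]
  · have hA0 : 0 ≤ frobNorm A := Real.sqrt_nonneg _
    have h1 : 1 ≤ M ^ p * (1 + frobNorm A ^ p) * t ^ (-p) := by
      rw [Real.rpow_neg ht.le, ← div_eq_mul_inv, one_le_div (by positivity)]
      calc t ^ p ≤ (M * frobNorm A) ^ p := by gcongr
        _ = M ^ p * frobNorm A ^ p := Real.mul_rpow (by positivity) hA0
        _ ≤ _ := by gcongr; linarith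
    calc volume {x ∈ Ω | t < frobNorm (G x)} ≤ 1 * volume Ω := by
          rw [one_mul]; exact measure_mono fun x hx => hx.1
      _ ≤ _ := by gcongr; exact ENNReal.one_le_ofReal.2 h1

/-- Proposition (Stage 2): the rank-`≤ 1` matrices can be reduced to the split matrices `L`
in weak `L^p` for every `p ∈ (1,∞)`. -/
theorem stage2_reduction (n : ℕ) (hn : 0 < n) (p : ℝ) (hp : 1 < p) :
    ReducedTo {X : Matrix (Fin n ⊕ Fin n) (Fin n ⊕ Fin n) ℝ | X.rank ≤ 1} (LSet n) p := by
  have : Nonempty (Fin n ⊕ Fin n) := ⟨Sum.inl ⟨0, hn⟩⟩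
  set M : ℝ := 2 * Fintype.card (Fin n ⊕ Fin n) with hMdef
  have hM : 1 ≤ M := by
    have : (1 : ℝ) ≤ Fintype.card (Fin n ⊕ Fin n) := by exact_mod_cast Fintype.card_pos
    linarith
  refine ⟨M, hM, fun A hA b ε hε α hα s hs Ω hΩ => ?_⟩
  obtain ⟨hΩo, hΩb, hΩc, hΩf⟩ := id hΩ
  obtain ⟨a, m, hm, hAm⟩ := exists_eq_mul_of_rank_le_one hA
  set m' : Fin n ⊕ Fin n → ℝ := fun i => blockSign i * m i with hm'def
  have hm' : m' ≠ 0 := by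
    obtain ⟨i, hi⟩ := Function.ne_iff.1 hm
    refine Function.ne_iff.2 ⟨i, abs_pos.1 ?_⟩
    rw [hm'def, abs_mul, abs_blockSign, one_mul]
    exact abs_pos.2 hi
  have hsum : ∑ i, |m' i| = ∑ i, |m i| := by simp [hm'def, abs_mul, abs_blockSign]
  have hvol : 0 < (volume Ω).toReal :=
    ENNReal.toReal_pos (hΩo.measure_pos volume hΩc.nonempty).ne' hΩb.measure_lt_top.ne
  have hA0 : 0 ≤ frobNorm A := Real.sqrt_nonneg _
  set R : ℝ := (1 + M * frobNorm A) ^ s with hRdef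
  have hR : 0 < R := Real.rpow_pos_of_pos (by positivity) s
  set δ : ℝ := ε * (volume Ω).toReal / R with hδdef
  have hδ : 0 < δ := div_pos (mul_pos hε.1 hvol) hR
  obtain ⟨h, J, K, hlip, h0, hsel, hKΩ, hKδ, hK⟩ :=
    exists_scalar_lamination hm' hΩo hΩb (ENNReal.ofReal_pos.2 hδ).ne'
  rw [hsum] at hlip
  set v : Fin n ⊕ Fin n → ℝ := fun k => blockSign k * a k with hvdef
  have hv : ∀ k, |v k| = |a k| := fun k => by rw [hvdef, abs_mul, abs_blockSign, one_mul]
  have hu := lipschitzWith_addScalar hAm b hv hlip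
  set u := addScalar A b v h with hudef
  set G : (Fin n ⊕ Fin n → ℝ) → Matrix (Fin n ⊕ Fin n) (Fin n ⊕ Fin n) ℝ :=
    fun x k i => lineDeriv ℝ (fun y => u y k) x (Pi.single i 1) with hGdef
  have hG : ∀ x, frobNorm (G x) ≤ M * frobNorm A := fun x => by
    refine frobNorm_le_of_abs_le hAm fun k i => ?_
    have := norm_lineDeriv_le_of_lipschitz ℝ (hu k) (x₀ := x) (v := Pi.single i 1)
    rwa [Real.coe_toNNReal _ (by positivity), Pi.norm_single, norm_one, mul_one] at this
  have hulip : ∃ C, LipschitzWith C u :=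
    ⟨_, LipschitzWith.of_dist_le_mul (K := ∑ k, (2 * |a k| * ∑ i, |m i|).toNNReal) fun x y =>
      (dist_pi_le_iff (by positivity)).2 fun k => ((hu k).dist_le_mul x y).trans <|
        mul_le_mul_of_nonneg_right (by
          exact_mod_cast Finset.single_le_sum
            (f := fun k => (2 * |a k| * ∑ i, |m i|).toNNReal) (fun _ _ => zero_le)
            (Finset.mem_univ k)) dist_nonneg⟩
  obtain ⟨C, hC⟩ := hulip
  refine ⟨u, G, ?_, hasWeakGradientOn_of_lipschitzWith hu hΩb,
    memHolder_of_lipschitzWith hC hΩb.closure hα.2, fun x hx => ?_, ?_,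
    fun t ht => weak_type_of_frobNorm_le hM hG (by linarith) Ω ht⟩
  · refine isPiecewiseAffineOn_of_preconnected hΩ (hΩo.inter (isOpen_genericSet J))
      Set.inter_subset_left (measure_mono_null (fun x hx => ?_) (volume_compl_genericSet J))
      fun V hV hVc => ?_
    · exact fun hxJ => hx.2 ⟨hx.1, hxJ⟩
    · obtain ⟨q, hq⟩ :=
        exists_affEval_of_isPreconnected hlip.continuous hΩo hsel hVc hV
      exact isAffineOn_addScalar hq
  · funext k
    have hxΩ : x ∉ Ω := by rw [hΩo.frontier_eq] at hx; exact hx.2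
    simp [hudef, addScalar, h0 x hxΩ]
  · have herr : {x ∈ Ω | G x ∉ LSet n} ⊆ (Ω \ K) ∪ (genericSet J)ᶜ := by
      rintro x ⟨hxΩ, hxG⟩
      by_contra hcon
      simp only [Set.mem_union, Set.mem_sdiff, Set.mem_compl_iff, not_or, not_and, not_not] at hcon
      obtain ⟨q, hqJ, hqm, hqx⟩ := hK x (hcon.1 hxΩ)
      have hev := eventuallyEq_affEval hlip.continuous hΩo hsel ⟨hxΩ, hcon.2⟩ hqJ hqx
      refine hxG (mem_LSet_of_eq_mul_add (a := a) hqm fun k i => ?_)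
      have hev' : (fun y => u y k) =ᶠ[𝓝 x]
          affEval (fun i => A k i + v k * q.1 i, b k + v k * q.2) := by
        filter_upwards [hev] with y hy using addScalar_apply_eq_affEval hy k
      rw [← hAm]
      exact hev'.lineDeriv_eq.trans (hasLineDerivAt_affEval _ x i).lineDeriv
    have hmeas : volume {x ∈ Ω | G x ∉ LSet n} < ENNReal.ofReal δ := by
      refine (measure_mono herr).trans_lt ((measure_union_le _ _).trans_lt ?_)
      rwa [volume_compl_genericSet, add_zero]
    have hreal : volume.real {x ∈ Ω | G x ∉ LSet n} < δ := by
      rwa [Measure.real, ← ENNReal.lt_ofReal_iff_toReal_lt hmeas.ne_top]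
    have hbound : ‖∫ x in {x ∈ Ω | G x ∉ LSet n}, (1 + frobNorm (G x)) ^ s‖ ≤
        R * volume.real {x ∈ Ω | G x ∉ LSet n} := by
      refine norm_setIntegral_le_of_norm_le_const (hmeas.trans ENNReal.ofReal_lt_top) fun x _ => ?_
      have hx0 : 0 ≤ frobNorm (G x) := Real.sqrt_nonneg _
      rw [Real.norm_of_nonneg (by positivity)]
      exact Real.rpow_le_rpow (by positivity) (by linarith [hG x])
        (zero_le_one.trans (le_of_lt hs))
    calc _ ≤ R * volume.real {x ∈ Ω | G x ∉ LSet n} := (le_abs_self _).trans hbound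
      _ < R * δ := by gcongr
      _ = _ := by rw [hδdef]; field_simp

end Paper
end
end

section
/- Let n ≥ 1 and let A ∈ ℝ^{2n×2n} with rank A ≤ 1. Then there exists a laminate of finite order ν on ℝ^{2n×2n} with barycenter A and supp ν ⊂ L ∩ {X : |X| ≤ 4|A|}; in fact ν can be taken of the form ν = (1/4)·Σ_{i=1}^4 δ_{A_i} where each A_i belongs to L and has rank at most 1. -/
open MeasureTheory Set Filter Topology

noncomputable section

namespace Paper

variable {ι κ : Type*}

variable [Fintype ι] [Fintype κ]

/-- Scaling the rows of `A` by `u` and its columns by `v`. -/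
def scaleRowsCols {ι κ : Type*} (A : Matrix κ ι ℝ) (u : κ → ℝ) (v : ι → ℝ) : Matrix κ ι ℝ :=
  Matrix.of fun k i => u k * A k i * v i

@[simp] lemma scaleRowsCols_apply {ι κ : Type*} (A : Matrix κ ι ℝ) (u : κ → ℝ) (v : ι → ℝ)
    (k : κ) (i : ι) : scaleRowsCols A u v k i = u k * A k i * v i := rfl

lemma rank_scaleRowsCols_le {ι κ : Type*} [Fintype ι] [Fintype κ] (A : Matrix κ ι ℝ)
    (u : κ → ℝ) (v : ι → ℝ) : (scaleRowsCols A u v).rank ≤ A.rank := by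
  classical
  have h : scaleRowsCols A u v = Matrix.diagonal u * A * Matrix.diagonal v := by
    ext k i
    simp [Matrix.mul_diagonal, Matrix.diagonal_mul]
  rw [h]
  exact (Matrix.rank_mul_le_left _ _).trans (Matrix.rank_mul_le_right _ _)

lemma frobNorm_scaleRowsCols_le {ι κ : Type*} [Fintype ι] [Fintype κ] (A : Matrix κ ι ℝ)
    {u : κ → ℝ} {v : ι → ℝ} {a b : ℝ} (ha : 0 ≤ a) (hb : 0 ≤ b)
    (hu : ∀ k, |u k| ≤ a) (hv : ∀ i, |v i| ≤ b) :
    frobNorm (scaleRowsCols A u v) ≤ a * b * frobNorm A := by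
  unfold frobNorm
  apply Real.sqrt_le_iff.2 ⟨by positivity, ?_⟩
  rw [mul_pow, Real.sq_sqrt (by positivity), Finset.mul_sum]
  refine Finset.sum_le_sum fun k _ => ?_
  rw [Finset.mul_sum]
  refine Finset.sum_le_sum fun i _ => ?_
  have hu2 : u k ^ 2 ≤ a ^ 2 := sq_le_sq' (abs_le.1 (hu k)).1 (abs_le.1 (hu k)).2
  have hv2 : v i ^ 2 ≤ b ^ 2 := sq_le_sq' (abs_le.1 (hv i)).1 (abs_le.1 (hv i)).2
  calc (scaleRowsCols A u v k i) ^ 2 = (u k ^ 2 * v i ^ 2) * A k i ^ 2 := by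
        rw [scaleRowsCols_apply]; ring
    _ ≤ (a ^ 2 * b ^ 2) * A k i ^ 2 := by gcongr
    _ = (a * b) ^ 2 * A k i ^ 2 := by ring

lemma eq_zero_of_rank_eq_zero {ι κ : Type*} [Fintype ι] (A : Matrix κ ι ℝ)
    (h : A.rank = 0) : A = 0 := by
  have hr : LinearMap.range A.mulVecLin = ⊥ := Submodule.finrank_eq_zero.1 h
  exact Matrix.mulVec_injective (funext fun v =>
    by simpa using LinearMap.congr_fun (LinearMap.range_eq_bot.1 hr) v)

lemma half_smul_add_half_smul {α : Type*} [MeasurableSpace α] (μ : Measure α) :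
    ENNReal.ofReal (1 / 2) • μ + ENNReal.ofReal (1 / 2) • μ = μ := by
  rw [← add_smul, ← ENNReal.ofReal_add (by norm_num) (by norm_num)]
  norm_num

lemma isProbabilityMeasure_half {α : Type*} [MeasurableSpace α] (μ ν : Measure α)
    [IsProbabilityMeasure μ] [IsProbabilityMeasure ν] :
    IsProbabilityMeasure (ENNReal.ofReal (1 / 2) • μ + ENNReal.ofReal (1 / 2) • ν) := by
  constructor
  simp only [Measure.add_apply, Measure.smul_apply, measure_univ, smul_eq_mul, mul_one]
  rw [← ENNReal.ofReal_add (by norm_num) (by norm_num)]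
  norm_num

/-- Splitting an atom into equal halves along a difference of rank at most one. -/
lemma IsLaminate.split_half {ι κ : Type*} [Fintype ι] [Fintype κ] {lam : ℝ}
    {A B B' : Matrix κ ι ℝ} {ν' : Measure (Matrix κ ι ℝ)} (hlam : lam ∈ Set.Ioc (0:ℝ) 1)
    [hprob : IsProbabilityMeasure ν'] (hrank : (B' - B).rank ≤ 1)
    (hA : A = (1 / 2 : ℝ) • B + (1 / 2 : ℝ) • B')
    (hν : IsLaminate (ENNReal.ofReal lam • Measure.dirac A + ENNReal.ofReal (1 - lam) • ν')) :
    IsLaminate (ENNReal.ofReal lam • (ENNReal.ofReal (1 / 2) • Measure.dirac B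
        + ENNReal.ofReal (1 / 2) • Measure.dirac B') + ENNReal.ofReal (1 - lam) • ν') := by
  rcases Nat.le_one_iff_eq_zero_or_eq_one.1 hrank with h | h
  · obtain rfl : B' = B := sub_eq_zero.1 (eq_zero_of_rank_eq_zero _ h)
    rw [half_smul_add_half_smul]
    rwa [show A = B' by rw [hA, ← add_smul]; norm_num] at hν
  · have key := IsLaminate.split lam (1 / 2) A B B' ν' hlam (by norm_num) hprob h
      (by rw [hA]; norm_num) hν
    rwa [show (1 - 1 / 2 : ℝ) = 1 / 2 by norm_num] at key

instance {ι κ : Type*} [Fintype ι] [Fintype κ] :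
    MeasurableSingletonClass (Matrix κ ι ℝ) :=
  inferInstanceAs (MeasurableSingletonClass (κ → ι → ℝ))

lemma barycenter_sum_dirac {ι κ σ : Type*} [Fintype ι] [Fintype κ] [Fintype σ] (c : ℝ)
    (hc : 0 ≤ c) (X : σ → Matrix κ ι ℝ) :
    barycenter (∑ s, ENNReal.ofReal c • Measure.dirac (X s)) = c • ∑ s, X s := by
  ext k i
  simp only [barycenter, Matrix.of_apply, Matrix.smul_apply, Matrix.sum_apply]
  rw [integral_finsetSum_measure]
  · simp [integral_smul_measure, Finset.mul_sum, ENNReal.toReal_ofReal hc]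
  · intro s _
    exact (integrable_dirac (by simp)).smul_measure ENNReal.ofReal_ne_top

/-- Splitting first the rows and then the columns into equal halves. -/
lemma isLaminate_quarters {ι κ : Type*} [Fintype ι] [Fintype κ]
    {A B B' C₀ C₁ C₂ C₃ : Matrix κ ι ℝ}
    (hA : A = (1 / 2 : ℝ) • B + (1 / 2 : ℝ) • B') (hAr : (B' - B).rank ≤ 1)
    (hB : B = (1 / 2 : ℝ) • C₀ + (1 / 2 : ℝ) • C₁) (hBr : (C₁ - C₀).rank ≤ 1)
    (hB' : B' = (1 / 2 : ℝ) • C₂ + (1 / 2 : ℝ) • C₃) (hBr' : (C₃ - C₂).rank ≤ 1) :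
    IsLaminate (∑ i, ENNReal.ofReal (1 / 4 : ℝ) • Measure.dirac (![C₀, C₁, C₂, C₃] i)) := by
  have hhalf : (1 - 1 / 2 : ℝ) = 1 / 2 := by norm_num
  have h₀ : IsLaminate (ENNReal.ofReal 1 • Measure.dirac A
      + ENNReal.ofReal (1 - 1) • Measure.dirac A) := by
    simpa using IsLaminate.dirac A
  have h₁ := h₀.split_half (by norm_num) hAr hA
  have h₂ : IsLaminate (ENNReal.ofReal (1 / 2) • Measure.dirac B
      + ENNReal.ofReal (1 - 1 / 2) • Measure.dirac B') := by
    rw [hhalf]; simpa using h₁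
  have h₃ := h₂.split_half (by norm_num) hBr hB
  have := isProbabilityMeasure_half (Measure.dirac C₀) (Measure.dirac C₁)
  have h₄ : IsLaminate (ENNReal.ofReal (1 / 2) • Measure.dirac B'
      + ENNReal.ofReal (1 - 1 / 2) • (ENNReal.ofReal (1 / 2) • Measure.dirac C₀
        + ENNReal.ofReal (1 / 2) • Measure.dirac C₁)) := by
    rw [hhalf] at h₃ ⊢
    rwa [add_comm]
  have h₅ := h₄.split_half (by norm_num) hBr' hB'
  have hq : ENNReal.ofReal (1 / 4) = ENNReal.ofReal (1 / 2) * ENNReal.ofReal (1 / 2) := by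
    rw [← ENNReal.ofReal_mul (by norm_num)]
    norm_num
  rw [hhalf, add_comm] at h₅
  simp only [smul_add, smul_smul, ← hq] at h₅
  simpa [Fin.sum_univ_four, add_assoc] using h₅

/-- Lemma: every rank-one `2n×2n` matrix is the barycenter of a finite-order laminate
`ν = (1/4) Σ_{i=1}^4 δ_{A_i}` supported on split matrices of rank at most one and norm `≤ 4|A|`. -/
theorem rank_one_to_split_laminate (n : ℕ) (hn : 0 < n)
    (A : Matrix (Fin n ⊕ Fin n) (Fin n ⊕ Fin n) ℝ) (hA : A.rank ≤ 1) :
    ∃ Amat : Fin 4 → Matrix (Fin n ⊕ Fin n) (Fin n ⊕ Fin n) ℝ,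
      (∀ i, Amat i ∈ LSet n ∧ (Amat i).rank ≤ 1 ∧ frobNorm (Amat i) ≤ 4 * frobNorm A) ∧
      IsLaminate (∑ i, (ENNReal.ofReal (1 / 4 : ℝ)) • Measure.dirac (Amat i)) ∧
      barycenter (∑ i, (ENNReal.ofReal (1 / 4 : ℝ)) • Measure.dirac (Amat i)) = A := by
  let p : Fin n ⊕ Fin n → ℝ := Sum.elim (fun _ => 2) (fun _ => 0)
  let q : Fin n ⊕ Fin n → ℝ := Sum.elim (fun _ => 0) (fun _ => 2)
  have hrank : ∀ u v, (scaleRowsCols A u v).rank ≤ 1 :=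
    fun u v => (rank_scaleRowsCols_le A u v).trans hA
  have hp : ∀ k, |p k| ≤ 2 := by rintro (k | k) <;> simp [p]
  have hq : ∀ k, |q k| ≤ 2 := by rintro (k | k) <;> simp [q]
  have hnorm : ∀ {u v : Fin n ⊕ Fin n → ℝ}, (∀ k, |u k| ≤ 2) → (∀ k, |v k| ≤ 2) →
      frobNorm (scaleRowsCols A u v) ≤ 4 * frobNorm A := fun hu hv => by
    have := frobNorm_scaleRowsCols_le A (by norm_num) (by norm_num) hu hv
    norm_num at this
    exact this
  have hrows : ∀ u v w, scaleRowsCols A v w - scaleRowsCols A u w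
      = scaleRowsCols A (v - u) w := fun u v w => by ext k i; simp; ring
  have hcols : ∀ u v w, scaleRowsCols A u w - scaleRowsCols A u v
      = scaleRowsCols A u (w - v) := fun u v w => by ext k i; simp; ring
  have hcombine : ∀ u, scaleRowsCols A u 1
      = (1 / 2 : ℝ) • scaleRowsCols A u p + (1 / 2 : ℝ) • scaleRowsCols A u q := fun u => by
    ext k (i | i) <;> simp [p, q] <;> ring
  refine ⟨![scaleRowsCols A p p, scaleRowsCols A p q, scaleRowsCols A q p,
    scaleRowsCols A q q], ?_, ?_, ?_⟩
  · intro i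
    fin_cases i
    · exact ⟨Or.inl (by constructor <;> intro i j <;> simp [p]), hrank _ _, hnorm hp hp⟩
    · exact ⟨Or.inr (by constructor <;> intro i j <;> simp [p, q]), hrank _ _, hnorm hp hq⟩
    · exact ⟨Or.inr (by constructor <;> intro i j <;> simp [p, q]), hrank _ _, hnorm hq hp⟩
    · exact ⟨Or.inl (by constructor <;> intro i j <;> simp [q]), hrank _ _, hnorm hq hq⟩
  · refine isLaminate_quarters (A := A) ?_ ?_ (hcombine p) ?_ (hcombine q) ?_
    · ext (k | k) i <;> simp [p, q]
    · rw [hrows]; exact hrank _ _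
    · rw [hcols]; exact hrank _ _
    · rw [hcols]; exact hrank _ _
  · rw [barycenter_sum_dirac _ (by norm_num)]
    ext (k | k) (i | i) <;> simp [Fin.sum_univ_four, p, q] <;> ring

end Paper
end
end
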